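/- Let k be an algebraically closed field of characteristic 0 and let d ≥ 2. Let F = (F₀,F₁,F₂) and G = (G₀,G₁,G₂) be triples of homogeneous polynomials of degree d in k[x,y,z] with no common zero in k³∖{0}, defining endomorphisms f₁ and f₂ of P²_k, and suppose φ is a k-algebra automorphism of k(x,y) with f₁* ∘ φ = φ ∘ f₂*. Then at least one of the following holds: (i) φ is induced by a linear automorphism, i.e. there exists N ∈ GL₃(k) with rows ℓ₀, ℓ₁, ℓ₂ (viewed as linear forms) such that φ(x) = ℓ₀(x,y,1)/ℓ₂(x,y,1) and φ(y) = ℓ₁(x,y,1)/ℓ₂(x,y,1); or (ii) f₁ is linearly conjugate to the composition of [x:y:z] ↦ [x^d:y^d:z^d] with a permutation of the coordinates, i.e. there exist M ∈ GL₃(k), c ∈ k^×, and a 3×3 permutation matrix Pσ such that M·F(v) = c·Pσ·(w₀^d, w₁^d, w₂^d) for all v ∈ k³, where w = M v; or (iii) there exist M ∈ GL₃(k), c ∈ k^×, and coefficients a₂,…,a_d ∈ k such that M·F(v) = c·(w₀^d, w₁^d + Σ_{j=2}^d a_j w₂^j w₁^{d−j}, w₂^d) for all v ∈ k³, where w = M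 v (the homogenization of the map (x,y) ↦ (x^d, y^d + Σ_{j=2}^d a_j y^{d−j}) of (A¹∖{0})×A¹). -/

import Mathlib

open Matrix MvPolynomial Finset

namespace PlaneEndo
section
variable {k : Type*} [Field k]

lemma exists_X_pow_eq_sum [IsAlgClosed k] {F : Fin 3 → MvPolynomial (Fin 3) k}
    (hF : ∀ v : Fin 3 → k, v ≠ 0 → ∃ i, eval v (F i) ≠ 0) :
    ∃ N : ℕ, ∀ i, ∃ a : Fin 3 → MvPolynomial (Fin 3) k, X i ^ N = ∑ j, F j * a j := by
  have key : ∀ i, ∃ N : ℕ, (X i : MvPolynomial (Fin 3) k) ^ N ∈ Ideal.span (Set.range F) := by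
    intro i
    have : (X i : MvPolynomial (Fin 3) k) ∈ (Ideal.span (Set.range F)).radical := by
      rw [← vanishingIdeal_zeroLocus_eq_radical (K := k)]
      rw [mem_vanishingIdeal_iff]
      intro v hv
      rw [zeroLocus_span] at hv
      by_cases h : v = 0
      · simp [h]
      · obtain ⟨j, hj⟩ := hF v h
        exact absurd (by simpa [aeval_eq_eval] using hv (F j) ⟨j, rfl⟩) hj
    exact this
  choose N hN using key
  refine ⟨∑ i, N i, fun i => ?_⟩
  have : (X i : MvPolynomial (Fin 3) k) ^ (∑ i, N i) ∈ Ideal.span (Set.range F) :=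
    Ideal.pow_mem_of_pow_mem _ (hN i)
      (Finset.single_le_sum (f := N) (fun _ _ => Nat.zero_le _) (mem_univ i))
  rw [Ideal.mem_span_range_iff_exists_fun] at this
  obtain ⟨c, hc⟩ := this
  exact ⟨c, by rw [← hc]; exact Finset.sum_congr rfl fun j _ => mul_comm _ _⟩

lemma X_pow_dvd_of_dvd_X_pow_mul {i j : Fin 3} (hij : i ≠ j) {N M : ℕ}
    {s : MvPolynomial (Fin 3) k}
    (h : (X i : MvPolynomial (Fin 3) k) ^ N ∣ X j ^ M * s) : X i ^ N ∣ s := by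
  have hp : Prime (X i : MvPolynomial (Fin 3) k) := X_prime
  refine hp.pow_dvd_of_dvd_mul_left N (fun h => ?_) h
  have := hp.dvd_of_dvd_pow h
  rw [MvPolynomial.X_dvd_X] at this
  exact hij this

lemma exists_eq_of_X_pow_mul {N : ℕ} {s a b : MvPolynomial (Fin 3) k}
    (h : X 2 ^ N * s = X 0 ^ N * a + X 1 ^ N * b) :
    ∃ p q, s = X 0 ^ N * p + X 1 ^ N * q := by
  set A : Set (Fin 3 →₀ ℕ) := {Finsupp.single 0 N, Finsupp.single 1 N} with hA
  have e : Ideal.span ((fun s => (monomial s) (1 : k)) '' A) =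
      Ideal.span {(X 0 : MvPolynomial (Fin 3) k) ^ N, X 1 ^ N} := by
    rw [hA, Set.image_pair]
    simp [X_pow_eq_monomial]
  have h1 : X 2 ^ N * s ∈ Ideal.span ((fun s => (monomial s) (1 : k)) '' A) := by
    rw [e, Ideal.mem_span_pair]
    exact ⟨a, b, by rw [h]; ring⟩
  have h2 : s ∈ Ideal.span ((fun s => (monomial s) (1 : k)) '' A) := by
    rw [mem_ideal_span_monomial_image] at h1 ⊢
    intro xi hxi
    have : Finsupp.single 2 N + xi ∈ (X 2 ^ N * s).support := by
      rw [X_pow_eq_monomial, mem_support_iff, coeff_monomial_mul]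
      simpa using hxi
    obtain ⟨si, hsi, hle⟩ := h1 _ this
    refine ⟨si, hsi, ?_⟩
    rcases hsi with h | h <;> subst h
    · rw [Finsupp.single_le_iff] at hle ⊢
      simpa using hle
    · rw [Finsupp.single_le_iff] at hle ⊢
      simpa using hle
  rw [e, Ideal.mem_span_pair] at h2
  obtain ⟨p, q, h⟩ := h2
  exact ⟨p, q, by rw [← h]; ring⟩

/-- A vector parallel to `F` is a multiple of `F`. -/
lemma exists_eq_smul_of_parallel {F : Fin 3 → MvPolynomial (Fin 3) k} {N : ℕ}
    (hN : ∀ i, ∃ a : Fin 3 → MvPolynomial (Fin 3) k, X i ^ N = ∑ j, F j * a j)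
    {u : Fin 3 → MvPolynomial (Fin 3) k} (h : ∀ i j, F i * u j = F j * u i) :
    ∃ s, ∀ i, u i = F i * s := by
  obtain ⟨a, ha⟩ := hN 0
  obtain ⟨b, hb⟩ := hN 1
  have hx : ∀ i, X 0 ^ N * u i = F i * ∑ j, a j * u j := by
    intro i
    rw [ha, Finset.mul_sum, Finset.sum_mul]
    exact Finset.sum_congr rfl fun j _ => by linear_combination a j * h j i
  have hy : ∀ i, X 1 ^ N * u i = F i * ∑ j, b j * u j := by
    intro i
    rw [hb, Finset.mul_sum, Finset.sum_mul]
    exact Finset.sum_congr rfl fun j _ => by linear_combination b j * h j i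
  set s := ∑ j, a j * u j
  set t := ∑ j, b j * u j
  have hex : ∃ i, F i ≠ 0 := by
    by_contra! hcon
    have : (X 0 : MvPolynomial (Fin 3) k) ^ N = 0 := by rw [ha]; simp [hcon]
    exact pow_ne_zero N (X_ne_zero _) this
  obtain ⟨i, hi⟩ := hex
  have h1 : X 1 ^ N * s = X 0 ^ N * t := by
    apply mul_left_cancel₀ hi
    linear_combination (-(X 1) ^ N) * hx i + X 0 ^ N * hy i
  obtain ⟨r, hr⟩ : X 0 ^ N ∣ s :=
    X_pow_dvd_of_dvd_X_pow_mul (j := 1) (M := N) (by decide) ⟨t, h1⟩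
  refine ⟨r, fun i => ?_⟩
  apply mul_left_cancel₀ (pow_ne_zero N (X_ne_zero (R := k) (0 : Fin 3)))
  rw [hx, hr]; ring

/-- Exactness of the Koszul complex of `F` in the middle. -/
lemma exists_cross_of_dot_eq_zero {F : Fin 3 → MvPolynomial (Fin 3) k} {N : ℕ}
    (hN : ∀ i, ∃ a : Fin 3 → MvPolynomial (Fin 3) k, X i ^ N = ∑ j, F j * a j)
    {g : Fin 3 → MvPolynomial (Fin 3) k} (h : ∑ j, F j * g j = 0) :
    ∃ w : Fin 3 → MvPolynomial (Fin 3) k, g = crossProduct F w := by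
  have hw : ∀ i, ∃ w : Fin 3 → MvPolynomial (Fin 3) k, (X i : MvPolynomial (Fin 3) k) ^ N • g =
      crossProduct F w := by
    intro i
    obtain ⟨a, ha⟩ := hN i
    refine ⟨crossProduct g a, ?_⟩
    rw [Fin.sum_univ_three] at h ha
    ext1 j
    fin_cases j <;> simp [cross_apply, ha]
    · linear_combination a 0 * h
    · linear_combination a 1 * h
    · linear_combination a 2 * h
  obtain ⟨w1, h1⟩ := hw 0
  obtain ⟨w2, h2⟩ := hw 1
  obtain ⟨w3, h3⟩ := hw 2
  have par : ∀ w : Fin 3 → MvPolynomial (Fin 3) k, crossProduct F w = 0 →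
      ∃ s, ∀ i, w i = F i * s := by
    intro w hw
    apply exists_eq_smul_of_parallel hN
    rw [cross_apply] at hw
    have e0 := congrFun hw 0
    have e1 := congrFun hw 1
    have e2 := congrFun hw 2
    simp at e0 e1 e2
    intro i j
    fin_cases i <;> fin_cases j <;> simp <;>
      first | linear_combination e0 | linear_combination e1 | linear_combination e2 |
        linear_combination -e0 | linear_combination -e1 | linear_combination -e2
  obtain ⟨s12, hs12⟩ := par ((X 1 : MvPolynomial (Fin 3) k) ^ N • w1 -
      (X 0 : MvPolynomial (Fin 3) k) ^ N • w2) (by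
    rw [map_sub, map_smul, map_smul, ← h1, ← h2, smul_smul, smul_smul, mul_comm, sub_self])
  obtain ⟨s13, hs13⟩ := par ((X 2 : MvPolynomial (Fin 3) k) ^ N • w1 -
      (X 0 : MvPolynomial (Fin 3) k) ^ N • w3) (by
    rw [map_sub, map_smul, map_smul, ← h1, ← h3, smul_smul, smul_smul, mul_comm, sub_self])
  obtain ⟨s23, hs23⟩ := par ((X 2 : MvPolynomial (Fin 3) k) ^ N • w2 -
      (X 1 : MvPolynomial (Fin 3) k) ^ N • w3) (by
    rw [map_sub, map_smul, map_smul, ← h2, ← h3, smul_smul, smul_smul, mul_comm, sub_self])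
  simp only [Pi.sub_apply, Pi.smul_apply, smul_eq_mul] at hs12 hs13 hs23
  have hex : ∃ i, F i ≠ 0 := by
    by_contra! hcon
    obtain ⟨a, ha⟩ := hN 0
    have : (X 0 : MvPolynomial (Fin 3) k) ^ N = 0 := by rw [ha]; simp [hcon]
    exact pow_ne_zero N (X_ne_zero _) this
  obtain ⟨i, hi⟩ := hex
  have hs : X 2 ^ N * s12 = X 0 ^ N * (-s23) + X 1 ^ N * s13 := by
    apply mul_left_cancel₀ hi
    linear_combination (-(X 2) ^ N) * hs12 i + X 1 ^ N * hs13 i - X 0 ^ N * hs23 i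
  obtain ⟨p, q, hpq⟩ := exists_eq_of_X_pow_mul hs
  have hdiv : ∀ i, ∃ w : MvPolynomial (Fin 3) k, w1 i - F i * q = X 0 ^ N * w := by
    intro i
    apply X_pow_dvd_of_dvd_X_pow_mul (j := 1) (M := N) (by decide)
    exact ⟨w2 i + F i * p, by linear_combination hs12 i + F i * hpq⟩
  choose w hw using hdiv
  refine ⟨w, ?_⟩
  have e : (X 0 : MvPolynomial (Fin 3) k) ^ N • g = (X 0 : MvPolynomial (Fin 3) k) ^ N •
      crossProduct F w := by
    rw [h1, ← map_smul]
    have : w1 = (X 0 : MvPolynomial (Fin 3) k) ^ N • w + q • F := by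
      ext1 i
      simp only [Pi.add_apply, Pi.smul_apply, smul_eq_mul]
      linear_combination hw i
    rw [this, map_add, map_smul _ q, cross_self, smul_zero, add_zero]
  exact smul_right_injective _ (pow_ne_zero N (X_ne_zero (R := k) (0 : Fin 3))) e
end
section
variable {k : Type*} [Field k]

/-- The map `c ↦ ∑ i, (c i)(F) * b i`. -/
noncomputable def combine {ι : Type*} (F : Fin 3 → MvPolynomial (Fin 3) k)
    (b : ι → MvPolynomial (Fin 3) k) :
    (ι →₀ MvPolynomial (Fin 3) k) →+ MvPolynomial (Fin 3) k :=
  Finsupp.liftAddHom fun i =>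
    (AddMonoidHom.mulRight (b i)).comp (bind₁ F).toRingHom.toAddMonoidHom

section
variable {ι : Type*} (F : Fin 3 → MvPolynomial (Fin 3) k) (b : ι → MvPolynomial (Fin 3) k)

@[simp] lemma combine_single (i : ι) (p : MvPolynomial (Fin 3) k) :
    combine F b (Finsupp.single i p) = bind₁ F p * b i := by
  simp [combine]

lemma combine_apply (c : ι →₀ MvPolynomial (Fin 3) k) :
    combine F b c = c.sum fun i p => bind₁ F p * b i := by
  rfl

lemma combine_smul (p : MvPolynomial (Fin 3) k) (c : ι →₀ MvPolynomial (Fin 3) k) :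
    combine F b (p • c) = bind₁ F p * combine F b c := by
  induction c using Finsupp.induction_linear with
  | zero => simp
  | add f g hf hg => rw [smul_add, map_add, map_add, hf, hg, mul_add]
  | single i q =>
    rw [Finsupp.smul_single, combine_single, combine_single, smul_eq_mul, map_mul, mul_assoc]
end

/-- A basis of the polynomial ring over its subring `k[F₀, F₁, F₂]`, with degree control. -/
structure FreeBasis (F : Fin 3 → MvPolynomial (Fin 3) k) (D : ℕ) where
  /-- index set -/
  ι : Type
  /-- basis elements -/
  b : ι → MvPolynomial (Fin 3) k
  /-- index of the unit -/
  i₀ : ι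
  b_one : b i₀ = 1
  span : ∀ (n : ℕ) (u : MvPolynomial (Fin 3) k), u.totalDegree ≤ n →
    ∃ c : ι →₀ MvPolynomial (Fin 3) k, combine F b c = u ∧ ∀ i, D * (c i).totalDegree ≤ n
  indep : ∀ c : ι →₀ MvPolynomial (Fin 3) k, combine F b c = 0 → c = 0

lemma homogeneousComponent_mul_of_isHomogeneous {p q : MvPolynomial (Fin 3) k} {D : ℕ}
    (hp : p.IsHomogeneous D) (n : ℕ) :
    homogeneousComponent n (p * q) =
      if D ≤ n then p * homogeneousComponent (n - D) q else 0 := by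
  have h1 : ∀ m : ℕ, homogeneousComponent n (p * homogeneousComponent m q) =
      if n = D + m then p * homogeneousComponent m q else 0 := fun m =>
    homogeneousComponent_of_mem (hp.mul (homogeneousComponent_isHomogeneous m q))
  conv_lhs => rw [← sum_homogeneousComponent q, Finset.mul_sum, map_sum]
  simp only [h1]
  split_ifs with h
  · have : ∀ m, (if n = D + m then p * homogeneousComponent m q else 0) =
        if m = n - D then p * homogeneousComponent m q else 0 := by
      intro m
      have : n = D + m ↔ m = n - D := by omega
      simp [this]
    simp only [this]
    rw [Finset.sum_ite_eq']
    split_ifs with h2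
    · rfl
    · rw [homogeneousComponent_eq_zero, mul_zero]
      simp at h2; omega
  · apply Finset.sum_eq_zero
    intro m _
    rw [if_neg (by omega)]

lemma exists_quotient_basis {F : Fin 3 → MvPolynomial (Fin 3) k} {D : ℕ} (hD : 1 ≤ D)
    (hom : ∀ i, (F i).IsHomogeneous D) :
    ∃ T : Set (Fin 3 →₀ ℕ), 0 ∈ T ∧
      (∀ u, ∃ (l : T →₀ k) (g : Fin 3 → MvPolynomial (Fin 3) k),
        u = (l.sum fun i a => monomial (i : Fin 3 →₀ ℕ) a) + ∑ j, F j * g j) ∧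
      (∀ (l : T →₀ k) (g : Fin 3 → MvPolynomial (Fin 3) k),
        (l.sum fun i a => monomial (i : Fin 3 →₀ ℕ) a) = ∑ j, F j * g j → l = 0) := by
  set I := Ideal.span (Set.range F) with hI
  set v : (Fin 3 →₀ ℕ) → MvPolynomial (Fin 3) k ⧸ I :=
    fun m => Ideal.Quotient.mkₐ k I (monomial m 1) with hv
  have hmem : ∀ u, u ∈ I ↔ ∃ g : Fin 3 → MvPolynomial (Fin 3) k, u = ∑ j, F j * g j := by
    intro u
    rw [hI, Ideal.mem_span_range_iff_exists_fun]
    constructor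
    · rintro ⟨g, rfl⟩
      exact ⟨g, Finset.sum_congr rfl fun j _ => mul_comm _ _⟩
    · rintro ⟨g, rfl⟩
      exact ⟨g, Finset.sum_congr rfl fun j _ => mul_comm _ _⟩
  have h0 : LinearIndepOn k v {0} := by
    rw [linearIndepOn_singleton_iff]
    intro h
    rw [hv] at h
    simp only [Ideal.Quotient.mkₐ_eq_mk] at h
    rw [Ideal.Quotient.eq_zero_iff_mem, hmem] at h
    obtain ⟨g, hg⟩ := h
    have := congrArg constantCoeff hg
    have hc : ∀ j, constantCoeff (F j) = 0 := fun j => by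
      rw [constantCoeff_eq]
      exact (hom j).coeff_eq_zero (by simp; omega)
    simp [hc] at this
  obtain ⟨T, -, hT0, hspan, hind⟩ := exists_linearIndepOn_extension h0 (Set.subset_univ _)
  have hlin : ∀ l : T →₀ k, (Ideal.Quotient.mkₐ k I)
      (l.sum fun i a => monomial (i : Fin 3 →₀ ℕ) a) = l.sum fun i a => a • v i := by
    intro l
    rw [Finsupp.sum, map_sum]
    refine Finset.sum_congr rfl fun i _ => ?_
    rw [hv]
    simp only
    rw [← map_smul, smul_monomial, smul_eq_mul, mul_one]
  refine ⟨T, hT0 rfl, fun u => ?_, fun l g h => ?_⟩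
  · have hu : Ideal.Quotient.mkₐ k I u ∈ Submodule.span k (v '' T) := by
      induction u using MvPolynomial.monomial_add_induction_on with
      | C a =>
        have : (C a : MvPolynomial (Fin 3) k) = a • monomial 0 1 := by
          rw [smul_monomial, smul_eq_mul, mul_one, C_apply]
        rw [this, map_smul]
        exact Submodule.smul_mem _ _ (hspan ⟨0, trivial, rfl⟩)
      | monomial_add a b f _ _ ih =>
        rw [map_add]
        refine Submodule.add_mem _ ?_ ih
        have : (monomial a b : MvPolynomial (Fin 3) k) = b • monomial a 1 := by
          simp [smul_monomial]
        rw [this, map_smul]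
        exact Submodule.smul_mem _ _ (hspan ⟨a, trivial, rfl⟩)
    rw [Set.image_eq_range, Finsupp.mem_span_range_iff_exists_finsupp] at hu
    obtain ⟨l, hl⟩ := hu
    refine ⟨l, ?_⟩
    have : u - (l.sum fun i a => monomial (i : Fin 3 →₀ ℕ) a) ∈ I := by
      rw [← Ideal.Quotient.eq_zero_iff_mem, map_sub, sub_eq_zero]
      have := hlin l
      rw [hl] at this
      exact this.symm
    obtain ⟨g, hg⟩ := (hmem _).1 this
    exact ⟨g, by rw [← hg]; ring⟩
  · have : (l.sum fun i a => a • v i) = 0 := by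
      rw [← hlin, h]
      exact Ideal.Quotient.eq_zero_iff_mem.2 ((hmem _).2 ⟨g, rfl⟩)
    rw [LinearIndepOn, linearIndependent_iff] at hind
    exact hind l (by simpa [Finsupp.linearCombination_apply] using this)

lemma exists_X_decomposition (p : MvPolynomial (Fin 3) k) : ∃ q : Fin 3 → MvPolynomial (Fin 3) k,
    (p = 0 → q = 0) ∧ p = C (constantCoeff p) + ∑ j, X j * q j := by
  by_cases h : p = 0
  · exact ⟨0, fun _ => rfl, by simp [h]⟩
  · have : p - C (constantCoeff p) ∈ Ideal.span (Set.range (X : Fin 3 → MvPolynomial (Fin 3) k))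
      := by
      rw [← Set.image_univ, mem_ideal_span_X_image]
      intro m hm
      by_contra! hcon
      have : m = 0 := by
        ext i
        simpa using hcon i trivial
      simp [this, constantCoeff_eq] at hm
    rw [Ideal.mem_span_range_iff_exists_fun] at this
    obtain ⟨c, hc⟩ := this
    refine ⟨c, fun h' => absurd h' h, ?_⟩
    have e : ∑ j, X j * c j = ∑ j, c j * X j := Finset.sum_congr rfl fun j _ => mul_comm _ _
    rw [e, hc]; ring

lemma mem_pow_idealOfVars_of_combine_eq_zero {ι : Type*} {F : Fin 3 → MvPolynomial (Fin 3) k}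
    {b : ι → MvPolynomial (Fin 3) k} {N : ℕ}
    (hN : ∀ i, ∃ a : Fin 3 → MvPolynomial (Fin 3) k, X i ^ N = ∑ j, F j * a j)
    (hspan : ∀ u, ∃ c : ι →₀ MvPolynomial (Fin 3) k, combine F b c = u)
    (hcon0 : ∀ c : ι →₀ MvPolynomial (Fin 3) k, combine F b c = 0 →
      ∀ i, constantCoeff (c i) = 0)
    (n : ℕ) : ∀ c : ι →₀ MvPolynomial (Fin 3) k, combine F b c = 0 →
      ∀ i, c i ∈ idealOfVars (Fin 3) k ^ n := by
  choose π hπ0 hπ using exists_X_decomposition (k := k)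
  induction n with
  | zero => intro c _ i; simp
  | succ n ih =>
    intro c hc
    set c' : Fin 3 → ι →₀ MvPolynomial (Fin 3) k := fun j =>
      c.mapRange (fun p => π p j) (by rw [hπ0 0 rfl]; rfl) with hc'
    have hcc : ∀ i, c i = ∑ j, X j * c' j i := by
      intro i
      conv_lhs => rw [hπ (c i), hcon0 c hc i, map_zero, zero_add]
      simp [hc']
    have hcs : c = ∑ j, (X j : MvPolynomial (Fin 3) k) • c' j := by
      ext1 i
      rw [hcc, Finsupp.finsetSum_apply]
      rfl
    have hK : ∑ j, F j * combine F b (c' j) = 0 := by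
      rw [← hc]
      conv_rhs => rw [hcs, map_sum]
      exact Finset.sum_congr rfl fun j _ => by rw [combine_smul, bind₁_X_right]
    obtain ⟨w, hw⟩ := exists_cross_of_dot_eq_zero hN hK
    choose e he using fun j => hspan (w j)
    rw [cross_apply] at hw
    have k0 := ih (c' 0 - ((X 1 : MvPolynomial (Fin 3) k) • e 2 -
      (X 2 : MvPolynomial (Fin 3) k) • e 1)) (by
        have := congrFun hw 0
        simp only [map_sub, combine_smul, bind₁_X_right, he]
        simpa [sub_eq_zero] using this)
    have k1 := ih (c' 1 - ((X 2 : MvPolynomial (Fin 3) k) • e 0 -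
      (X 0 : MvPolynomial (Fin 3) k) • e 2)) (by
        have := congrFun hw 1
        simp only [map_sub, combine_smul, bind₁_X_right, he]
        simpa [sub_eq_zero] using this)
    have k2 := ih (c' 2 - ((X 0 : MvPolynomial (Fin 3) k) • e 1 -
      (X 1 : MvPolynomial (Fin 3) k) • e 0)) (by
        have := congrFun hw 2
        simp only [map_sub, combine_smul, bind₁_X_right, he]
        simpa [sub_eq_zero] using this)
    intro i
    have hX : ∀ j, (X j : MvPolynomial (Fin 3) k) ∈ idealOfVars (Fin 3) k := fun j =>
      Ideal.subset_span ⟨j, rfl⟩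
    have m0 := Ideal.mul_mem_mul (hX 0) (k0 i)
    have m1 := Ideal.mul_mem_mul (hX 1) (k1 i)
    have m2 := Ideal.mul_mem_mul (hX 2) (k2 i)
    rw [← pow_succ'] at m0 m1 m2
    have := Ideal.add_mem _ (Ideal.add_mem _ m0 m1) m2
    convert this using 1
    rw [hcc, Fin.sum_univ_three]
    simp only [Finsupp.sub_apply, Finsupp.smul_apply, smul_eq_mul]
    ring

set_option maxHeartbeats 1000000 in
theorem exists_freeBasis [IsAlgClosed k] {F : Fin 3 → MvPolynomial (Fin 3) k} {D : ℕ}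
    (hD : 1 ≤ D) (hom : ∀ i, (F i).IsHomogeneous D)
    (hF : ∀ v : Fin 3 → k, v ≠ 0 → ∃ i, eval v (F i) ≠ 0) : Nonempty (FreeBasis F D) := by
  obtain ⟨N, hN⟩ := exists_X_pow_eq_sum hF
  obtain ⟨T, hT0, hsp, hind⟩ := exists_quotient_basis hD hom
  set b : T → MvPolynomial (Fin 3) k := fun i => monomial (i : Fin 3 →₀ ℕ) 1 with hb
  have hconst : ∀ l : T →₀ k, combine F b (l.mapRange C (map_zero _)) =
      l.sum fun i a => monomial (i : Fin 3 →₀ ℕ) a := by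
    intro l
    rw [combine_apply, Finsupp.sum_mapRange_index (by simp)]
    refine Finsupp.sum_congr fun i _ => ?_
    simp [hb, C_mul_monomial]
  have hhom : ∀ (n : ℕ) (u : MvPolynomial (Fin 3) k), u.IsHomogeneous n →
      ∃ c : T →₀ MvPolynomial (Fin 3) k, combine F b c = u ∧
        ∀ i, D * (c i).totalDegree ≤ n := by
    intro n
    induction n using Nat.strong_induction_on with
    | _ n ih =>
      intro u hu
      obtain ⟨l, g, hlg⟩ := hsp u
      have hu' : homogeneousComponent n u = u := homogeneousComponent_eq_self hu
      rw [hlg, map_add, map_sum, ← hlg] at hu'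
      have hl : homogeneousComponent n (l.sum fun i a => monomial (i : Fin 3 →₀ ℕ) a) =
          combine F b (Finsupp.mapRange C (map_zero _)
              (l.filter fun i : T => (i : Fin 3 →₀ ℕ).degree = n)) := by
        rw [hconst, Finsupp.sum, map_sum, Finsupp.sum_filter_index,
          Finsupp.support_filter, Finset.sum_filter]
        · refine Finset.sum_congr rfl fun i _ => ?_
          rw [homogeneousComponent_of_mem (isHomogeneous_monomial (l i) rfl)]
          simp [eq_comm]
      rw [hl] at hu'
      simp only [homogeneousComponent_mul_of_isHomogeneous (hom _)] at hu'
      by_cases hDn : D ≤ n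
      · simp only [if_pos hDn] at hu'
        have h3 : ∀ j, ∃ c : T →₀ MvPolynomial (Fin 3) k,
            combine F b c = homogeneousComponent (n - D) (g j) ∧
              ∀ i, D * (c i).totalDegree ≤ n - D := fun j =>
          ih (n - D) (by omega) _ (homogeneousComponent_isHomogeneous _ _)
        choose c hc hcd using h3
        refine ⟨(Finsupp.mapRange C (map_zero _)
            (l.filter fun i : T => (i : Fin 3 →₀ ℕ).degree = n)) +
          ∑ j, (X j : MvPolynomial (Fin 3) k) • c j, ?_, ?_⟩
        · rw [map_add, map_sum, ← hu']
          congr 1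
          refine Finset.sum_congr rfl fun j _ => ?_
          rw [combine_smul, hc, bind₁_X_right]
        · intro i
          rw [mul_comm, ← Nat.le_div_iff_mul_le (by omega), ← mem_restrictTotalDegree,
            Finsupp.add_apply, Finsupp.finsetSum_apply]
          refine Submodule.add_mem _ ?_ (Submodule.sum_mem _ fun j _ => ?_)
          · rw [mem_restrictTotalDegree]
            simp
          · rw [mem_restrictTotalDegree, Finsupp.smul_apply, smul_eq_mul,
              Nat.le_div_iff_mul_le (by omega)]
            have h4 := totalDegree_mul (X j) (c j i)
            rw [totalDegree_X] at h4
            calc _ ≤ (1 + (c j i).totalDegree) * D := Nat.mul_le_mul_right D h4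
              _ ≤ n := by have := hcd j i; nlinarith [Nat.sub_add_cancel hDn]
      · simp only [if_neg hDn, Finset.sum_const_zero, add_zero] at hu'
        refine ⟨_, hu', fun i => ?_⟩
        simp
  have hspan : ∀ (n : ℕ) (u : MvPolynomial (Fin 3) k), u.totalDegree ≤ n →
      ∃ c : T →₀ MvPolynomial (Fin 3) k, combine F b c = u ∧
        ∀ i, D * (c i).totalDegree ≤ n := by
    intro n u hu
    choose c hc hcd using fun m : ℕ => hhom m _ (homogeneousComponent_isHomogeneous m u)
    refine ⟨∑ m ∈ Finset.range (u.totalDegree + 1), c m, ?_, fun i => ?_⟩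
    · rw [map_sum, Finset.sum_congr rfl fun m _ => hc m, sum_homogeneousComponent]
    · rw [mul_comm, ← Nat.le_div_iff_mul_le (by omega), ← mem_restrictTotalDegree,
        Finsupp.finsetSum_apply]
      refine Submodule.sum_mem _ fun m hm => ?_
      rw [mem_restrictTotalDegree, Nat.le_div_iff_mul_le (by omega), mul_comm]
      have := hcd m i
      simp at hm
      omega
  choose π hπ0 hπ using exists_X_decomposition (k := k)
  have hcon0 : ∀ c : T →₀ MvPolynomial (Fin 3) k, combine F b c = 0 →
      ∀ i, constantCoeff (c i) = 0 := by
    intro c hc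
    have h1 : ∀ p : MvPolynomial (Fin 3) k, bind₁ F p =
        C (constantCoeff p) + ∑ j, F j * bind₁ F (π p j) := by
      intro p
      conv_lhs => rw [hπ p]
      simp
    have h2 : combine F b c = (c.mapRange constantCoeff (map_zero _)).sum
        (fun i a => monomial (i : Fin 3 →₀ ℕ) a) +
        ∑ j, F j * c.sum fun i p => bind₁ F (π p j) * b i := by
      rw [combine_apply, Finsupp.sum_mapRange_index (by simp)]
      simp only [Finsupp.sum, Finset.mul_sum]
      rw [Finset.sum_comm, ← Finset.sum_add_distrib]
      refine Finset.sum_congr rfl fun i _ => ?_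
      rw [h1, add_mul, Finset.sum_mul]
      congr 1
      · simp [hb, C_mul_monomial]
      · exact Finset.sum_congr rfl fun j _ => by ring
    have h3 := hind (c.mapRange constantCoeff (map_zero _))
      (fun j => - c.sum fun i p => bind₁ F (π p j) * b i) (by
        rw [hc] at h2
        simp only [mul_neg, Finset.sum_neg_distrib]
        linear_combination -h2)
    intro i
    simpa using DFunLike.congr_fun h3 i
  have hpow := mem_pow_idealOfVars_of_combine_eq_zero hN
    (fun u => (hspan _ u le_rfl).imp fun _ h => h.1) hcon0
  exact ⟨⟨T, b, ⟨0, hT0⟩, by simp [hb], hspan, fun c hc => by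
    ext1 i
    by_contra hne
    obtain ⟨m, hm⟩ := support_nonempty.2 hne
    have := (mem_pow_idealOfVars_iff _ _).1 (hpow (m.degree + 1) c hc i) m hm
    omega⟩⟩
end
section
variable {k : Type*} [Field k]

lemma pderiv_bind₁ (B : Fin 3 → MvPolynomial (Fin 3) k) (p : MvPolynomial (Fin 3) k) (j : Fin 3) :
    pderiv j (bind₁ B p) = ∑ i, bind₁ B (pderiv i p) * pderiv j (B i) := by
  induction p using MvPolynomial.induction_on with
  | C a => simp
  | add p q hp hq => simp only [map_add, hp, hq, add_mul, Finset.sum_add_distrib]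
  | mul_X p i hp =>
    simp only [map_mul, Derivation.leibniz, bind₁_X_right, hp, smul_eq_mul, map_add, add_mul,
      Finset.sum_add_distrib, Finset.mul_sum, pderiv_X]
    congr 1
    · rw [Finset.sum_eq_single i]
      · simp
      · intro b _ hb
        simp [Pi.single_eq_of_ne' hb]
      · simp
    · exact Finset.sum_congr rfl fun l _ => by ring

/-- Composition of polynomial maps. -/
noncomputable def comp (A B : Fin 3 → MvPolynomial (Fin 3) k) : Fin 3 → MvPolynomial (Fin 3) k :=
  fun i => bind₁ B (A i)

/-- Jacobian matrix. -/
noncomputable def jac (A : Fin 3 → MvPolynomial (Fin 3) k) :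
    Matrix (Fin 3) (Fin 3) (MvPolynomial (Fin 3) k) :=
  Matrix.of fun i j => pderiv j (A i)

@[simp] lemma jac_apply (A : Fin 3 → MvPolynomial (Fin 3) k) (i j : Fin 3) :
    jac A i j = pderiv j (A i) := rfl

/-- Jacobian determinant. -/
noncomputable def jdet (A : Fin 3 → MvPolynomial (Fin 3) k) : MvPolynomial (Fin 3) k :=
  (jac A).det

lemma jac_comp (A B : Fin 3 → MvPolynomial (Fin 3) k) :
    jac (comp A B) = (jac A).map (bind₁ B) * jac B := by
  ext1 i j
  rw [Matrix.mul_apply]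
  exact pderiv_bind₁ B (A i) j

lemma jdet_comp (A B : Fin 3 → MvPolynomial (Fin 3) k) :
    jdet (comp A B) = bind₁ B (jdet A) * jdet B := by
  rw [jdet, jac_comp, det_mul, jdet, jdet, AlgHom.map_det]
  rfl

namespace FreeBasis
variable {F : Fin 3 → MvPolynomial (Fin 3) k} {D : ℕ} (B : FreeBasis F D)
include B

lemma bind_injective : Function.Injective (bind₁ F) := by
  rw [injective_iff_map_eq_zero]
  intro p hp
  have := B.indep (Finsupp.single B.i₀ p) (by rw [combine_single, hp, zero_mul])
  simpa using this

lemma isRelPrime_bind {p q : MvPolynomial (Fin 3) k} (h : IsRelPrime p q) :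
    IsRelPrime (bind₁ F p) (bind₁ F q) := by
  by_cases hp : p = 0
  · have hq : IsUnit q := h (by simp [hp]) dvd_rfl
    exact (hq.map (bind₁ F)).isRelPrime_right
  rintro g ⟨a, ha⟩ ⟨b, hb⟩
  obtain ⟨ca, hca, -⟩ := B.span _ a le_rfl
  obtain ⟨cb, hcb, -⟩ := B.span _ b le_rfl
  have h1 : combine F B.b (p • cb - q • ca) = 0 := by
    rw [map_sub, combine_smul, combine_smul, hca, hcb, ha, hb]; ring
  have h2 := B.indep _ h1
  have h3 : ∀ i, p ∣ ca i := fun i => by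
    have : p * cb i - q * ca i = 0 := DFunLike.congr_fun h2 i
    exact h.dvd_of_dvd_mul_left ⟨cb i, by linear_combination -this⟩
  have h4 : bind₁ F p ∣ a := by
    rw [← hca, combine_apply]
    exact Finset.dvd_sum fun i _ => ((map_dvd (bind₁ F) (h3 i)).mul_right _)
  obtain ⟨a', rfl⟩ := h4
  have hp' : bind₁ F p ≠ 0 := fun h0 => hp (B.bind_injective (by rw [h0, map_zero]))
  refine IsUnit.of_mul_eq_one a' ?_
  apply mul_left_cancel₀ hp'
  rw [mul_one]
  conv_rhs => rw [ha]
  ring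

lemma surjective_eval [IsAlgClosed k] (w : Fin 3 → k) : ∃ v, ∀ i, eval v (F i) = w i := by
  by_contra! hcon
  set I := Ideal.span (Set.range fun i => F i - C (w i)) with hI
  have htop : (1 : MvPolynomial (Fin 3) k) ∈ I := by
    have : (1 : MvPolynomial (Fin 3) k) ∈ I.radical := by
      rw [← vanishingIdeal_zeroLocus_eq_radical (K := k), mem_vanishingIdeal_iff]
      intro v hv
      rw [hI, zeroLocus_span] at hv
      obtain ⟨i, hi⟩ := hcon v
      have := hv (F i - C (w i)) ⟨i, rfl⟩
      simp [aeval_eq_eval, sub_eq_zero] at this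
      exact absurd this hi
    obtain ⟨n, hn⟩ := this
    simpa using hn
  rw [Ideal.mem_span_range_iff_exists_fun] at htop
  obtain ⟨u, hu⟩ := htop
  choose c hc _ using fun i => B.span _ (u i) le_rfl
  have h1 : combine F B.b (Finsupp.single B.i₀ 1 -
      ∑ i, (X i - C (w i) : MvPolynomial (Fin 3) k) • c i) = 0 := by
    rw [map_sub, combine_single, B.b_one, map_sum, map_one, one_mul, sub_eq_zero]
    rw [← hu]
    refine Finset.sum_congr rfl fun i _ => ?_
    rw [combine_smul, hc]
    simp [mul_comm]
  have h2 := DFunLike.congr_fun (B.indep _ h1) B.i₀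
  rw [Finsupp.sub_apply, Finsupp.finsetSum_apply] at h2
  have h3 := congrArg (eval w) h2
  simp [Finsupp.smul_apply] at h3

lemma jdet_ne_zero [CharZero k] : jdet F ≠ 0 := by
  intro h0
  obtain ⟨θ, hθ, hθ0⟩ := Matrix.exists_mulVec_eq_zero_iff.2 h0
  have hindep : AlgebraicIndependent k F := B.bind_injective
  have htr : IsTranscendenceBasis k F := by
    apply hindep.isTranscendenceBasis_of_lift_trdeg_le_of_finite
    rw [MvPolynomial.trdeg_of_isDomain]
    simp
  have halg := htr.isAlgebraic
  let δ := mkDerivation k θ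
  have hδ : ∀ p, δ p = ∑ j, pderiv j p * θ j := by
    intro p
    induction p using MvPolynomial.induction_on with
    | C a => simp [δ]
    | add p q hp hq => simp only [map_add, hp, hq, add_mul, Finset.sum_add_distrib]
    | mul_X p i hp =>
      simp only [Derivation.leibniz, hp, smul_eq_mul, add_mul,
        Finset.sum_add_distrib, Finset.mul_sum, pderiv_X]
      congr 1
      · rw [Finset.sum_eq_single i]
        · simp [δ]
        · intro b _ hb
          simp [Pi.single_eq_of_ne' hb]
        · simp
      · exact Finset.sum_congr rfl fun l _ => by ring
  have hker : ∀ r : Algebra.adjoin k (Set.range F), δ r = 0 := by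
    rintro ⟨r, hr⟩
    induction hr using Algebra.adjoin_induction with
    | mem x hx =>
      obtain ⟨i, rfl⟩ := hx
      rw [hδ]
      exact congrFun hθ0 i
    | algebraMap r => exact δ.map_algebraMap r
    | add x y _ _ hx hy => simpa using by rw [hx, hy, add_zero]
    | mul x y _ _ hx hy =>
      simp only at hx hy
      simp [hx, hy]
  let δ' : Derivation (Algebra.adjoin k (Set.range F)) (MvPolynomial (Fin 3) k)
      (MvPolynomial (Fin 3) k) := Derivation.mk'
    { toFun := δ
      map_add' := map_add δ
      map_smul' := fun r x => by
        rw [Algebra.smul_def, Derivation.leibniz, Algebra.smul_def]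
        have : δ (algebraMap (Algebra.adjoin k (Set.range F)) (MvPolynomial (Fin 3) k) r) = 0 :=
          hker r
        rw [this, smul_zero, add_zero, RingHom.id_apply]
        exact (Algebra.smul_def r (δ x)).symm } (fun a b => δ.leibniz a b)
  have hz : ∀ (u : MvPolynomial (Fin 3) k) (n : ℕ)
      (p : Polynomial (Algebra.adjoin k (Set.range F))), p.natDegree ≤ n → p ≠ 0 →
      Polynomial.aeval u p = 0 → δ' u = 0 := by
    intro u n
    induction n with
    | zero =>
      intro p hp hp0 hpu
      rw [Polynomial.eq_C_of_natDegree_le_zero hp] at hpu hp0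
      simp at hpu hp0
      exact absurd hpu hp0
    | succ n ih =>
      intro p hp hp0 hpu
      have h1 := Derivation.map_aeval δ' p u
      rw [hpu, map_zero, smul_eq_mul, eq_comm, mul_eq_zero] at h1
      rcases h1 with h1 | h1
      · by_cases hd : Polynomial.derivative p = 0
        · have := Polynomial.derivative_eq_zero.1 hd
          exact ih p (by omega) hp0 hpu
        · refine ih _ ?_ hd h1
          have := Polynomial.natDegree_derivative_le p
          omega
      · exact h1
  apply hθ
  funext i
  obtain ⟨p, hp0, hp⟩ := halg.isAlgebraic (X i)
  have : δ (X i) = 0 := hz (X i) _ p le_rfl hp0 hp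
  simpa [δ] using this

end FreeBasis
end
section
variable {k : Type*} [Field k]

lemma aeval_mul_of_isHomogeneous {σ R : Type*} [CommRing R] [Algebra k R] {p : MvPolynomial σ k}
    {n : ℕ} (hp : p.IsHomogeneous n) (q : R) (v : σ → R) :
    aeval (fun i => q * v i) p = q ^ n * aeval v p := by
  rw [aeval_def, aeval_def, eval₂_eq, eval₂_eq, Finset.mul_sum]
  refine Finset.sum_congr rfl fun m hm => ?_
  have h := hp (mem_support_iff.1 hm)
  rw [Finsupp.weight_apply] at h
  simp only [mul_pow, Finset.prod_mul_distrib, Finset.prod_pow_eq_pow_sum]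
  rw [← h]
  simp [Finsupp.sum]
  ring

lemma bind₁_mul_of_isHomogeneous {σ τ : Type*} {p : MvPolynomial σ k} {n : ℕ}
    (hp : p.IsHomogeneous n) (q : MvPolynomial τ k) (v : σ → MvPolynomial τ k) :
    bind₁ (fun i => q * v i) p = q ^ n * bind₁ v p :=
  aeval_mul_of_isHomogeneous hp q v

lemma eval_smul_of_isHomogeneous {σ : Type*} {p : MvPolynomial σ k} {n : ℕ}
    (hp : p.IsHomogeneous n) (c : k) (v : σ → k) :
    eval (c • v) p = c ^ n * eval v p := by
  have := aeval_mul_of_isHomogeneous hp c v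
  rwa [aeval_eq_eval, aeval_eq_eval] at this

/-- The grading of a polynomial ring, as a map into polynomials in one more variable. -/
noncomputable def gradingMap (σ k : Type*) [Field k] :
    MvPolynomial σ k →ₐ[k] Polynomial (MvPolynomial σ k) :=
  aeval fun i => Polynomial.X * Polynomial.C (X i)

lemma gradingMap_of_isHomogeneous {σ : Type*} {p : MvPolynomial σ k} {n : ℕ}
    (hp : p.IsHomogeneous n) : gradingMap σ k p = Polynomial.X ^ n * Polynomial.C p := by
  rw [gradingMap, aeval_mul_of_isHomogeneous hp]
  congr 1
  have : (aeval fun i => Polynomial.C (X i) : MvPolynomial σ k →ₐ[k] _) =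
      (Polynomial.CAlgHom : MvPolynomial σ k →ₐ[MvPolynomial σ k] _).restrictScalars k := by
    ext i
    simp
  rw [this]
  rfl

lemma gradingMap_eq_sum {σ : Type*} (p : MvPolynomial σ k) : gradingMap σ k p =
    ∑ i ∈ range (p.totalDegree + 1),
        Polynomial.X ^ i * Polynomial.C (homogeneousComponent i p) := by
  conv_lhs => rw [← sum_homogeneousComponent p]
  rw [map_sum]
  exact Finset.sum_congr rfl fun i _ =>
    gradingMap_of_isHomogeneous (homogeneousComponent_isHomogeneous i p)

lemma aeval_one_gradingMap {σ : Type*} (p : MvPolynomial σ k) :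
    Polynomial.eval 1 (gradingMap σ k p) = p := by
  rw [gradingMap_eq_sum, Polynomial.eval_finsetSum]
  simp [sum_homogeneousComponent]

lemma coeff_gradingMap {σ : Type*} (p : MvPolynomial σ k) (n : ℕ) :
    (gradingMap σ k p).coeff n = homogeneousComponent n p := by
  rw [gradingMap_eq_sum, Polynomial.finsetSum_coeff]
  simp only [Polynomial.coeff_mul_C, Polynomial.coeff_X_pow, ite_mul, one_mul, zero_mul]
  rw [Finset.sum_ite_eq]
  split_ifs with h
  · rfl
  · rw [homogeneousComponent_eq_zero]
    simpa using h

/-- A factor of a nonzero homogeneous polynomial is homogeneous. -/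
lemma exists_isHomogeneous_of_mul {σ : Type*} {p q : MvPolynomial σ k} {n : ℕ}
    (h : (p * q).IsHomogeneous n) (h0 : p * q ≠ 0) : p.IsHomogeneous p.totalDegree := by
  have hp : gradingMap σ k p ≠ 0 := fun h => h0 (by
    rw [← aeval_one_gradingMap p, h]; simp)
  have hq : gradingMap σ k q ≠ 0 := fun h => h0 (by
    rw [← aeval_one_gradingMap q, h]; simp)
  have e := gradingMap_of_isHomogeneous h
  rw [map_mul, Polynomial.X_pow_mul, Polynomial.C_mul_X_pow_eq_monomial] at e
  have h1 := congrArg Polynomial.natDegree e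
  have h2 := congrArg Polynomial.natTrailingDegree e
  rw [Polynomial.natDegree_mul hp hq, Polynomial.natDegree_monomial_eq _ h0] at h1
  rw [Polynomial.natTrailingDegree_mul hp hq, Polynomial.natTrailingDegree_monomial h0] at h2
  have h3 := Polynomial.natTrailingDegree_le_natDegree (gradingMap σ k p)
  have h4 := Polynomial.natTrailingDegree_le_natDegree (gradingMap σ k q)
  set N := (gradingMap σ k p).natDegree with hN
  have h5 : ∀ i, i ≠ N → homogeneousComponent i p = 0 := by
    intro i hi
    rw [← coeff_gradingMap]
    rcases lt_or_gt_of_ne hi with h | h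
    · exact Polynomial.coeff_eq_zero_of_lt_natTrailingDegree (by omega)
    · exact Polynomial.coeff_eq_zero_of_natDegree_lt (by omega)
  have h6 : p.IsHomogeneous N := by
    rw [← sum_homogeneousComponent p]
    refine IsHomogeneous.sum _ _ _ fun i _ => ?_
    by_cases hi : i = N
    · rw [← hi]; exact homogeneousComponent_isHomogeneous i p
    · rw [h5 i hi]; exact isHomogeneous_zero _ _ _
  rwa [h6.totalDegree (left_ne_zero_of_mul h0)]

/-- Dehomogenisation. -/
noncomputable def dehom : MvPolynomial (Fin 3) k →ₐ[k] MvPolynomial (Fin 2) k :=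
  aeval ![X 0, X 1, 1]

lemma eval_dehom (v : Fin 2 → k) (P : MvPolynomial (Fin 3) k) :
    eval v (dehom P) = eval ![v 0, v 1, 1] P := by
  have : (aeval v).comp dehom = (aeval ![v 0, v 1, 1] : MvPolynomial (Fin 3) k →ₐ[k] k) := by
    ext i
    fin_cases i <;> simp [dehom]
  have := DFunLike.congr_fun this P
  simpa [aeval_eq_eval] using this

lemma eq_zero_of_dehom_eq_zero [Infinite k] {P : MvPolynomial (Fin 3) k} {n : ℕ}
    (hP : P.IsHomogeneous n) (h : dehom P = 0) : P = 0 := by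
  have h1 : X 2 * P = 0 := by
    refine MvPolynomial.funext fun v => ?_
    by_cases h2 : v 2 = 0
    · simp [h2]
    have : v = v 2 • ![v 0 / v 2, v 1 / v 2, 1] := by
      funext i
      fin_cases i <;> simp <;> field_simp
    have h3 := eval_dehom ![v 0 / v 2, v 1 / v 2] P
    rw [h] at h3
    rw [map_mul, this, eval_smul_of_isHomogeneous hP]
    simp at h3
    rw [← h3]
    simp
  simpa using h1

lemma exists_homogenization (p : MvPolynomial (Fin 2) k) {n : ℕ} (hn : p.totalDegree ≤ n) :
    ∃ P : MvPolynomial (Fin 3) k, P.IsHomogeneous n ∧ dehom P = p := by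
  refine ⟨∑ u ∈ p.support, C (p.coeff u) * (X 0 ^ u 0 * X 1 ^ u 1 * X 2 ^ (n - (u 0 + u 1))),
    IsHomogeneous.sum _ _ _ fun u hu => ?_, ?_⟩
  · have h := le_totalDegree hu
    have h' : u 0 + u 1 ≤ n := by
      rw [Finsupp.sum_fintype _ _ (by simp)] at h
      simp [Fin.sum_univ_two] at h
      omega
    have := ((isHomogeneous_X_pow (R := k) (0 : Fin 3) (u 0)).mul
      (isHomogeneous_X_pow 1 (u 1))).mul (isHomogeneous_X_pow 2 (n - (u 0 + u 1)))
    have := (isHomogeneous_C (Fin 3) (p.coeff u)).mul this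
    convert this using 1
    omega
  · conv_rhs => rw [p.as_sum]
    rw [map_sum]
    refine Finset.sum_congr rfl fun u _ => ?_
    rw [monomial_eq, Finsupp.prod_fintype _ _ (by simp)]
    simp [dehom]

lemma dvd_of_forall_dvd_mul {R : Type*} [CommRing R] [IsDomain R] [UniqueFactorizationMonoid R]
    {ι : Type*} {a : ι → R} (ha : ∀ p, Prime p → ∃ i, ¬ p ∣ a i) {w : R} (hw : w ≠ 0) :
    ∀ u, (∀ i, w ∣ a i * u) → w ∣ u := by
  induction w using UniqueFactorizationMonoid.induction_on_prime with
  | h₁ => exact absurd rfl hw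
  | h₂ x hx => exact fun u _ => hx.dvd
  | h₃ a' p ha' hp ih =>
    intro u h
    obtain ⟨i, hi⟩ := ha p hp
    obtain ⟨u', rfl⟩ := (hp.dvd_or_dvd ((dvd_mul_right p a').trans (h i))).resolve_left hi
    refine mul_dvd_mul_left p (ih ha' u' fun j => ?_)
    have := h j
    rw [mul_left_comm] at this
    exact (mul_dvd_mul_iff_left hp.ne_zero).1 this

lemma exists_eq_mul_of_parallel {R : Type*} [CommRing R] [IsDomain R]
    [UniqueFactorizationMonoid R] {ι : Type*} {A B : ι → R}
    (hB : ∀ p, Prime p → ∃ i, ¬ p ∣ B i) (hB0 : ∃ i, B i ≠ 0)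
    (h : ∀ i j, A i * B j = A j * B i) : ∃ c, ∀ i, A i = c * B i := by
  obtain ⟨j, hj⟩ := hB0
  obtain ⟨c, hc⟩ := dvd_of_forall_dvd_mul hB hj (A j) fun i => ⟨A i, by
    linear_combination h j i⟩
  refine ⟨c, fun i => mul_right_cancel₀ hj ?_⟩
  rw [h, hc]; ring

end
section
variable {k : Type*} [Field k]

/-- A polynomial in homogeneous coordinates, as an element of `k(x,y)`. -/
noncomputable def ev : MvPolynomial (Fin 3) k →ₐ[k] FractionRing (MvPolynomial (Fin 2) k) :=
  (IsScalarTower.toAlgHom k (MvPolynomial (Fin 2) k) (FractionRing (MvPolynomial (Fin 2) k))).comp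
    dehom

lemma ev_apply (P : MvPolynomial (Fin 3) k) :
    ev P = algebraMap (MvPolynomial (Fin 2) k) (FractionRing (MvPolynomial (Fin 2) k)) (dehom P) :=
  rfl

lemma eq_zero_of_ev_eq_zero [Infinite k] {P : MvPolynomial (Fin 3) k} {n : ℕ}
    (hP : P.IsHomogeneous n) (h : ev P = 0) : P = 0 := by
  rw [ev_apply, FaithfulSMul.algebraMap_eq_zero_iff] at h
  exact eq_zero_of_dehom_eq_zero hP h

/-- The homogeneous triple `A` represents the endomorphism `ψ` of `k(x,y)`. -/
structure Represents (ψ : FractionRing (MvPolynomial (Fin 2) k) →ₐ[k]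
    FractionRing (MvPolynomial (Fin 2) k)) (A : Fin 3 → MvPolynomial (Fin 3) k) : Prop where
  ne_zero : ev (A 2) ≠ 0
  map_x : ψ (algebraMap (MvPolynomial (Fin 2) k) _ (X 0)) = ev (A 0) / ev (A 2)
  map_y : ψ (algebraMap (MvPolynomial (Fin 2) k) _ (X 1)) = ev (A 1) / ev (A 2)

namespace Represents
variable {ψ ψ₁ ψ₂ : FractionRing (MvPolynomial (Fin 2) k) →ₐ[k]
    FractionRing (MvPolynomial (Fin 2) k)} {A B : Fin 3 → MvPolynomial (Fin 3) k}

lemma map_ev (h : Represents ψ A) {P : MvPolynomial (Fin 3) k} {n : ℕ}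
    (hP : P.IsHomogeneous n) : ψ (ev P) * ev (A 2) ^ n = ev (bind₁ A P) := by
  have h1 : ψ.comp ev = aeval ![ev (A 0) / ev (A 2), ev (A 1) / ev (A 2), 1] := by
    ext i
    fin_cases i
    · simpa [ev_apply, dehom] using h.map_x
    · simpa [ev_apply, dehom] using h.map_y
    · simp [ev_apply, dehom]
  have h2 : ev.comp (bind₁ A) =
      aeval fun i => ev (A 2) * ![ev (A 0) / ev (A 2), ev (A 1) / ev (A 2), 1] i := by
    ext i
    have := h.ne_zero
    fin_cases i <;> simp <;> field_simp
  have h3 := DFunLike.congr_fun h1 P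
  have h4 := DFunLike.congr_fun h2 P
  rw [aeval_mul_of_isHomogeneous hP] at h4
  simp only [AlgHom.comp_apply] at h3 h4
  rw [h3, h4, mul_comm]

lemma comp (h₁ : Represents ψ₁ A) (h₂ : Represents ψ₂ B) {n : ℕ}
    (hB : ∀ i, (B i).IsHomogeneous n) : Represents (ψ₁.comp ψ₂) (comp B A) := by
  have h0 := h₁.ne_zero
  have hz : ψ₁ (ev (B 2)) ≠ 0 := by
    simpa using h₂.ne_zero
  have h3 : ∀ i, ev (PlaneEndo.comp B A i) = ψ₁ (ev (B i)) * ev (A 2) ^ n := fun i =>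
    (h₁.map_ev (hB i)).symm
  refine ⟨?_, ?_, ?_⟩
  · rw [h3]
    exact mul_ne_zero hz (pow_ne_zero _ h0)
  · rw [h3, h3, AlgHom.comp_apply, h₂.map_x, map_div₀]
    field_simp
  · rw [h3, h3, AlgHom.comp_apply, h₂.map_y, map_div₀]
    field_simp

lemma parallel [Infinite k] (hA : Represents ψ A) (hB : Represents ψ B) {a b : ℕ}
    (hAh : ∀ i, (A i).IsHomogeneous a) (hBh : ∀ i, (B i).IsHomogeneous b) (i j : Fin 3) :
    A i * B j = A j * B i := by
  have hA0 : A 2 ≠ 0 := fun h => hA.ne_zero (by rw [h, map_zero])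
  have hB0 : B 2 ≠ 0 := fun h => hB.ne_zero (by rw [h, map_zero])
  have hA1 := hA.ne_zero
  have hB1 := hB.ne_zero
  have h2 : ∀ i, A i * B 2 = A 2 * B i := by
    intro i
    rw [← sub_eq_zero]
    refine eq_zero_of_ev_eq_zero (((hAh i).mul (hBh 2)).sub ((hAh 2).mul (hBh i))) ?_
    rw [map_sub, map_mul, map_mul]
    fin_cases i
    · have := hA.map_x.symm.trans hB.map_x
      field_simp at this
      simp only [Fin.zero_eta]
      linear_combination this
    · have := hA.map_y.symm.trans hB.map_y
      field_simp at this
      simp only [Fin.mk_one]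
      linear_combination this
    · simp
  apply mul_left_cancel₀ (mul_ne_zero hA0 hB0)
  linear_combination A 2 * B j * h2 i - A 2 * B i * h2 j

lemma id : Represents (AlgHom.id k (FractionRing (MvPolynomial (Fin 2) k))) X := by
  constructor <;> simp [ev_apply, dehom]

end Represents

lemma isHomogeneous_of_mul_left {σ : Type*} {p q : MvPolynomial σ k} {a n : ℕ}
    (hp : p.IsHomogeneous a) (hp0 : p ≠ 0) (h : (p * q).IsHomogeneous n) :
    q.IsHomogeneous (n - a) := by
  by_cases hq : q = 0
  · rw [hq]; exact isHomogeneous_zero _ _ _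
  have h0 := mul_ne_zero hp0 hq
  have h1 := exists_isHomogeneous_of_mul (by rwa [mul_comm] at h) (mul_comm p q ▸ h0)
  have h2 := (hp.mul h1).totalDegree h0
  rw [h.totalDegree h0] at h2
  rw [h2]
  simpa using h1

lemma exists_primitive_represents [Infinite k] (ψ : FractionRing (MvPolynomial (Fin 2) k) →ₐ[k]
    FractionRing (MvPolynomial (Fin 2) k)) : ∃ (m : ℕ) (A : Fin 3 → MvPolynomial (Fin 3) k),
    Represents ψ A ∧ (∀ i, (A i).IsHomogeneous m) ∧ ∀ p, Prime p → ∃ i, ¬ p ∣ A i := by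
  have key : ∃ (m : ℕ) (A : Fin 3 → MvPolynomial (Fin 3) k),
      Represents ψ A ∧ ∀ i, (A i).IsHomogeneous m := by
    obtain ⟨a, b, hb, hx⟩ := IsFractionRing.div_surjective (A := MvPolynomial (Fin 2) k)
      (ψ (algebraMap (MvPolynomial (Fin 2) k) _ (X 0)))
    obtain ⟨a', b', hb', hy⟩ := IsFractionRing.div_surjective (A := MvPolynomial (Fin 2) k)
      (ψ (algebraMap (MvPolynomial (Fin 2) k) _ (X 1)))
    have hb0 := nonZeroDivisors.ne_zero hb
    have hb0' := nonZeroDivisors.ne_zero hb'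
    set n := (a * b').totalDegree + (a' * b).totalDegree + (b * b').totalDegree
    obtain ⟨A0, h0, e0⟩ := exists_homogenization (a * b') (n := n) (by omega)
    obtain ⟨A1, h1, e1⟩ := exists_homogenization (a' * b) (n := n) (by omega)
    obtain ⟨A2, h2, e2⟩ := exists_homogenization (b * b') (n := n) (by omega)
    have hb1 : algebraMap _ (FractionRing (MvPolynomial (Fin 2) k)) b ≠ 0 := by
      simpa using hb0
    have hb1' : algebraMap _ (FractionRing (MvPolynomial (Fin 2) k)) b' ≠ 0 := by
      simpa using hb0'
    refine ⟨n, ![A0, A1, A2], ⟨?_, ?_, ?_⟩, ?_⟩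
    · simp [ev_apply, e2, hb0, hb0']
    · simp only [ev_apply, Matrix.cons_val, e0, e2, map_mul, ← hx]
      field_simp
    · simp only [ev_apply, Matrix.cons_val, e1, e2, map_mul, ← hy]
      field_simp
    · intro i
      fin_cases i <;> assumption
  classical
  set m := Nat.find key with hm
  obtain ⟨A, hA, hAh⟩ := Nat.find_spec key
  refine ⟨m, A, hA, hAh, ?_⟩
  by_contra! hcon
  obtain ⟨p, hp, hd⟩ := hcon
  choose A' hA' using hd
  have hA0 : A 2 ≠ 0 := fun h => hA.ne_zero (by rw [h, map_zero])
  have hph := exists_isHomogeneous_of_mul (hA' 2 ▸ hAh 2) (hA' 2 ▸ hA0)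
  have hpos : 0 < p.totalDegree := by
    rw [Nat.pos_iff_ne_zero]
    intro h0
    refine hp.not_isUnit ?_
    rw [isUnit_iff_totalDegree_of_isReduced]
    refine ⟨?_, h0⟩
    rw [totalDegree_eq_zero_iff_eq_C] at h0
    rw [isUnit_iff_ne_zero]
    intro h1
    rw [h1, map_zero] at h0
    exact hp.ne_zero h0
  have hev : ev p ≠ 0 := fun h => hp.ne_zero (eq_zero_of_ev_eq_zero hph h)
  have hle : p.totalDegree ≤ m := by
    have := totalDegree_mul_of_isDomain hp.ne_zero (right_ne_zero_of_mul (hA' 2 ▸ hA0))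
    rw [← hA' 2, (hAh 2).totalDegree hA0] at this
    omega
  refine Nat.find_min key (m := m - p.totalDegree) (by omega) ⟨A', ⟨?_, ?_, ?_⟩, fun i =>
    isHomogeneous_of_mul_left hph hp.ne_zero (hA' i ▸ hAh i)⟩
  · intro h
    exact hA.ne_zero (by rw [hA', map_mul, h, mul_zero])
  · rw [hA.map_x, hA' 0, hA' 2, map_mul, map_mul, mul_div_mul_left _ _ hev]
  · rw [hA.map_y, hA' 1, hA' 2, map_mul, map_mul, mul_div_mul_left _ _ hev]

end
section
variable {k : Type*} [Field k]

lemma eval_bind₁ {σ τ : Type*} (H : σ → MvPolynomial τ k) (p : MvPolynomial σ k) (v : τ → k) :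
    eval v (bind₁ H p) = eval (fun i => eval v (H i)) p := by
  have := aeval_bind₁ (S := k) v H p
  simpa [aeval_eq_eval] using this

lemma dvd_of_forall_eval_eq_zero [IsAlgClosed k] {p q : MvPolynomial (Fin 3) k} (hp : Prime p)
    (h : ∀ v, eval v p = 0 → eval v q = 0) : p ∣ q := by
  have h1 : (Ideal.span {p}).IsPrime := (Ideal.span_singleton_prime hp.ne_zero).2 hp
  rw [← Ideal.mem_span_singleton, ← h1.radical,
    ← vanishingIdeal_zeroLocus_eq_radical (K := k), mem_vanishingIdeal_iff]
  intro v hv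
  rw [zeroLocus_span] at hv
  have := hv p rfl
  rw [aeval_eq_eval] at this ⊢
  exact h v this

/-- Endomorphisms `F` and `G` of degree `d` which are conjugate by a birational map `H` with
inverse `H'`. -/
structure Conj (d m m' : ℕ) (F G H H' : Fin 3 → MvPolynomial (Fin 3) k)
    (Q Q' : MvPolynomial (Fin 3) k) (c c' : k) : Prop where
  F_hom : ∀ i, (F i).IsHomogeneous d
  G_hom : ∀ i, (G i).IsHomogeneous d
  F_nz : ∀ v : Fin 3 → k, v ≠ 0 → ∃ i, eval v (F i) ≠ 0
  G_nz : ∀ v : Fin 3 → k, v ≠ 0 → ∃ i, eval v (G i) ≠ 0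
  H_hom : ∀ i, (H i).IsHomogeneous m
  H'_hom : ∀ i, (H' i).IsHomogeneous m'
  H_prim : ∀ p, Prime p → ∃ i, ¬ p ∣ H i
  H'_prim : ∀ p, Prime p → ∃ i, ¬ p ∣ H' i
  H_F : ∀ i, bind₁ F (H i) = C c * bind₁ H (G i)
  H'_G : ∀ i, bind₁ G (H' i) = C c' * bind₁ H' (F i)
  H'_H : ∀ i, bind₁ H (H' i) = Q * X i
  H_H' : ∀ i, bind₁ H' (H i) = Q' * X i
  Q_ne : Q ≠ 0
  Q'_ne : Q' ≠ 0
  c_ne : c ≠ 0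
  c'_ne : c' ≠ 0

lemma exists_smul_conj [IsAlgClosed k] {d m : ℕ} (hd : 1 ≤ d)
    {F G H : Fin 3 → MvPolynomial (Fin 3) k}
    (hF : ∀ i, (F i).IsHomogeneous d) (hG : ∀ i, (G i).IsHomogeneous d)
    (hFnz : ∀ v : Fin 3 → k, v ≠ 0 → ∃ i, eval v (F i) ≠ 0)
    (hGnz : ∀ v : Fin 3 → k, v ≠ 0 → ∃ i, eval v (G i) ≠ 0)
    (hH : ∀ i, (H i).IsHomogeneous m) (hHp : ∀ p, Prime p → ∃ i, ¬ p ∣ H i)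
    (h : ∀ i j, comp H F i * comp G H j = comp H F j * comp G H i) :
    ∃ c : k, c ≠ 0 ∧ ∀ i, bind₁ F (H i) = C c * bind₁ H (G i) := by
  obtain ⟨B⟩ := exists_freeBasis hd hF hFnz
  have hp : ∀ p, Prime p → ∃ i, ¬ p ∣ comp G H i := by
    intro p hp
    by_contra! hcon
    obtain ⟨i, hi⟩ := hHp p hp
    refine hi (dvd_of_forall_eval_eq_zero hp fun v hv => ?_)
    by_contra h0
    obtain ⟨j, hj⟩ := hGnz (fun i => eval v (H i)) fun h => h0 (congrFun h i)
    apply hj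
    obtain ⟨a, ha⟩ := hcon j
    have := congrArg (eval v) ha
    rw [map_mul, hv, zero_mul] at this
    rw [← this]
    exact (eval_bind₁ _ _ _).symm
  obtain ⟨i, hi⟩ := hp _ (X_prime (i := 0))
  have hi0 : comp G H i ≠ 0 := fun h => hi (h ▸ dvd_zero _)
  obtain ⟨c, hc⟩ := exists_eq_mul_of_parallel hp ⟨i, hi0⟩ h
  have hFi : ∃ j, comp H F j ≠ 0 := by
    obtain ⟨j, hj⟩ := hHp _ (X_prime (i := 0))
    refine ⟨j, fun h => hj ?_⟩
    rw [B.bind_injective (h.trans (map_zero _).symm)]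
    exact dvd_zero _
  have hc0 : c ≠ 0 := by
    rintro rfl
    obtain ⟨j, hj⟩ := hFi
    exact hj (by rw [hc, zero_mul])
  have h1 : (comp H F i).IsHomogeneous (d * m) := (hH i).aeval F hF
  have h2 : (comp G H i).IsHomogeneous (m * d) := (hG i).aeval H hH
  have h3 := totalDegree_mul_of_isDomain hc0 hi0
  rw [← hc, h1.totalDegree (by rw [hc]; exact mul_ne_zero hc0 hi0), h2.totalDegree hi0,
    mul_comm] at h3
  have h4 : c.totalDegree = 0 := by omega
  rw [totalDegree_eq_zero_iff_eq_C] at h4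
  refine ⟨coeff 0 c, fun h => hc0 (by rw [h4, h, map_zero]), fun i => ?_⟩
  rw [← h4]
  exact hc i

theorem exists_conj [IsAlgClosed k] {d : ℕ} (hd : 1 ≤ d)
    {F G : Fin 3 → MvPolynomial (Fin 3) k}
    (hF : ∀ i, (F i).IsHomogeneous d) (hG : ∀ i, (G i).IsHomogeneous d)
    (hFnz : ∀ v : Fin 3 → k, v ≠ 0 → ∃ i, eval v (F i) ≠ 0)
    (hGnz : ∀ v : Fin 3 → k, v ≠ 0 → ∃ i, eval v (G i) ≠ 0)
    {f g : FractionRing (MvPolynomial (Fin 2) k) →ₐ[k] FractionRing (MvPolynomial (Fin 2) k)}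
    (hf : Represents f F) (hg : Represents g G)
    (φ : FractionRing (MvPolynomial (Fin 2) k) ≃ₐ[k] FractionRing (MvPolynomial (Fin 2) k))
    (hconj : ∀ u, f (φ u) = φ (g u)) :
    ∃ m m' H H' Q Q' c c', Represents φ.toAlgHom H ∧ Conj d m m' F G H H' Q Q' c c' := by
  obtain ⟨m, H, hφ, hH, hHp⟩ := exists_primitive_represents φ.toAlgHom
  obtain ⟨m', H', hφ', hH', hHp'⟩ := exists_primitive_represents φ.symm.toAlgHom
  have e1 : f.comp φ.toAlgHom = φ.toAlgHom.comp g := AlgHom.ext hconj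
  have e2 : g.comp φ.symm.toAlgHom = φ.symm.toAlgHom.comp f := by
    refine AlgHom.ext fun u => ?_
    apply φ.injective
    have := hconj (φ.symm u)
    simp at this
    simp [this]
  have h1 : ∀ i, (comp H F i).IsHomogeneous (d * m) := fun i => (hH i).aeval F hF
  have h2 : ∀ i, (comp G H i).IsHomogeneous (m * d) := fun i => (hG i).aeval H hH
  have h3 : ∀ i, (comp H' G i).IsHomogeneous (d * m') := fun i => (hH' i).aeval G hG
  have h4 : ∀ i, (comp F H' i).IsHomogeneous (m' * d) := fun i => (hF i).aeval H' hH'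
  have h5 : ∀ i, (comp H' H i).IsHomogeneous (m * m') := fun i => (hH' i).aeval H hH
  have h6 : ∀ i, (comp H H' i).IsHomogeneous (m' * m) := fun i => (hH i).aeval H' hH'
  have hX : ∀ i : Fin 3, (X i : MvPolynomial (Fin 3) k).IsHomogeneous 1 := isHomogeneous_X k
  have hXp : ∀ p : MvPolynomial (Fin 3) k, Prime p → ∃ i : Fin 3, ¬ p ∣ X i := by
    intro p hp
    by_contra! hcon
    have h0 := (hp.associated_of_dvd X_prime (hcon 0)).symm.dvd.trans (hcon 1)
    rw [X_dvd_X] at h0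
    simp at h0
  have hX0 : ∃ i : Fin 3, (X i : MvPolynomial (Fin 3) k) ≠ 0 := ⟨0, X_ne_zero _⟩
  obtain ⟨c, hc, hc1⟩ := exists_smul_conj hd hF hG hFnz hGnz hH hHp
    ((hf.comp hφ hH).parallel (e1 ▸ hφ.comp hg hG) h1 h2)
  obtain ⟨c', hc', hc1'⟩ := exists_smul_conj hd hG hF hGnz hFnz hH' hHp'
    ((hg.comp hφ' hH').parallel (e2 ▸ hφ'.comp hf hF) h3 h4)
  have r1 := hφ.comp hφ' hH'
  have r2 := hφ'.comp hφ hH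
  have e3 : φ.toAlgHom.comp φ.symm.toAlgHom =
      AlgHom.id k (FractionRing (MvPolynomial (Fin 2) k)) := by ext; simp
  have e4 : φ.symm.toAlgHom.comp φ.toAlgHom =
      AlgHom.id k (FractionRing (MvPolynomial (Fin 2) k)) := by ext; simp
  rw [e3] at r1
  rw [e4] at r2
  obtain ⟨Q, hQ⟩ := exists_eq_mul_of_parallel hXp hX0 (r1.parallel Represents.id h5 hX)
  obtain ⟨Q', hQ'⟩ := exists_eq_mul_of_parallel hXp hX0 (r2.parallel Represents.id h6 hX)
  refine ⟨m, m', H, H', Q, Q', c, c', hφ, hF, hG, hFnz, hGnz, hH, hH', hHp, hHp', hc1, hc1', hQ,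
    hQ', ?_, ?_, hc, hc'⟩
  · rintro rfl
    exact r1.ne_zero (by rw [hQ, zero_mul, map_zero])
  · rintro rfl
    exact r2.ne_zero (by rw [hQ', zero_mul, map_zero])

lemma jdet_mul_X {Q : MvPolynomial (Fin 3) k} {n : ℕ} (hQ : Q.IsHomogeneous n) :
    jdet (fun i => Q * X i) = ((n : MvPolynomial (Fin 3) k) + 1) * Q ^ 3 := by
  have h := hQ.sum_X_mul_pderiv
  rw [Fin.sum_univ_three] at h
  simp only [jdet, det_fin_three, jac_apply, Derivation.leibniz, pderiv_X, smul_eq_mul]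
  simp
  simp only [nsmul_eq_mul] at h
  linear_combination Q ^ 2 * h

namespace Conj
variable {d m m' : ℕ} {F G H H' : Fin 3 → MvPolynomial (Fin 3) k}
    {Q Q' : MvPolynomial (Fin 3) k} {c c' : k}

lemma symm (S : Conj d m m' F G H H' Q Q' c c') : Conj d m' m G F H' H Q' Q c' c :=
  ⟨S.G_hom, S.F_hom, S.G_nz, S.F_nz, S.H'_hom, S.H_hom, S.H'_prim, S.H_prim, S.H'_G, S.H_F,
    S.H_H', S.H'_H, S.Q'_ne, S.Q_ne, S.c'_ne, S.c_ne⟩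

variable (S : Conj d m m' F G H H' Q Q' c c')
include S

lemma Q_X_hom : (Q * X 0).IsHomogeneous (m * m') :=
  S.H'_H 0 ▸ (S.H'_hom 0).aeval H S.H_hom

lemma pos : 1 ≤ m ∧ 1 ≤ m' := by
  have h := S.Q_X_hom
  have h1 := h.totalDegree (mul_ne_zero S.Q_ne (X_ne_zero _))
  rw [totalDegree_mul_of_isDomain S.Q_ne (X_ne_zero _), totalDegree_X] at h1
  constructor
  · rcases Nat.eq_zero_or_pos m with h | h
    · rw [h] at h1; omega
    · exact h
  · rcases Nat.eq_zero_or_pos m' with h | h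
    · rw [h] at h1; omega
    · exact h

lemma Q_hom : Q.IsHomogeneous (m * m' - 1) :=
  isHomogeneous_of_mul_left (isHomogeneous_X k 0) (X_ne_zero _) (mul_comm Q (X 0) ▸ S.Q_X_hom)

lemma Q_comp_F [IsAlgClosed k] (hd : 1 ≤ d) : ∃ κ : k, κ ≠ 0 ∧ bind₁ F Q = C κ * Q ^ d := by
  refine ⟨c ^ m' * c', mul_ne_zero (pow_ne_zero _ S.c_ne) S.c'_ne, ?_⟩
  obtain ⟨B⟩ := exists_freeBasis hd S.F_hom S.F_nz
  have h1 : F 0 ≠ 0 := fun h => X_ne_zero (R := k) 0 (B.bind_injective (by simpa using h))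
  apply mul_right_cancel₀ h1
  have h2 := congrArg (bind₁ F) (S.H'_H 0)
  rw [bind₁_bind₁, map_mul, bind₁_X_right] at h2
  rw [← h2]
  have h3 : (fun i => bind₁ F (H i)) = fun i => C c * bind₁ H (G i) := funext S.H_F
  rw [h3, bind₁_mul_of_isHomogeneous (S.H'_hom 0), ← bind₁_bind₁, S.H'_G, map_mul, bind₁_bind₁]
  have h4 : (fun i => bind₁ H (H' i)) = fun i => Q * X i := funext S.H'_H
  rw [h4, bind₁_mul_of_isHomogeneous (S.F_hom 0)]
  simp
  ring

lemma Q'_comp_H : bind₁ H Q' = Q ^ m := by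
  obtain ⟨i, hi⟩ := S.H_prim _ (X_prime (i := 0))
  have hi0 : H i ≠ 0 := fun h => hi (h ▸ dvd_zero _)
  have h2 := congrArg (bind₁ H) (S.H_H' i)
  apply mul_right_cancel₀ hi0
  rw [bind₁_bind₁, map_mul, bind₁_X_right] at h2
  have h4 : (fun i => bind₁ H (H' i)) = fun i => Q * X i := funext S.H'_H
  rw [← h2, h4, bind₁_mul_of_isHomogeneous (S.H_hom i)]
  simp

lemma jdet_mul : bind₁ H (jdet H') * jdet H = (m * m' : ℕ) * Q ^ 3 := by
  rw [← jdet_comp]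
  have h4 : comp H' H = fun i => Q * X i := funext S.H'_H
  rw [h4, jdet_mul_X S.Q_hom]
  have := S.pos
  have h5 : 1 ≤ m * m' := Nat.mul_pos this.1 this.2
  rw [Nat.cast_sub h5]
  simp

lemma jdet_ne_zero [CharZero k] : jdet H ≠ 0 := by
  have h := S.jdet_mul
  have := S.pos
  have h5 : (m * m' : ℕ) ≠ 0 := (Nat.mul_pos this.1 this.2).ne'
  have h6 : ((m * m' : ℕ) : MvPolynomial (Fin 3) k) ≠ 0 := Nat.cast_ne_zero.2 h5
  exact right_ne_zero_of_mul (h ▸ mul_ne_zero h6 (pow_ne_zero 3 S.Q_ne))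

lemma jdet_dvd [CharZero k] : jdet H ∣ Q ^ 3 := by
  have h := S.jdet_mul
  have := S.pos
  have h5 : ((m * m' : ℕ) : k) ≠ 0 := Nat.cast_ne_zero.2 (Nat.mul_pos this.1 this.2).ne'
  refine ⟨C ((m * m' : ℕ) : k)⁻¹ * bind₁ H (jdet H'), ?_⟩
  have h7 : C ((m * m' : ℕ) : k)⁻¹ * ((m * m' : ℕ) : MvPolynomial (Fin 3) k) = 1 := by
    rw [← map_natCast (C : k →+* MvPolynomial (Fin 3) k), ← map_mul, inv_mul_cancel₀ h5, map_one]
  linear_combination -C ((m * m' : ℕ) : k)⁻¹ * h - Q ^ 3 * h7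

end Conj
end
section
variable {k : Type*} [Field k]

lemma isUnit_iff_exists_C {σ : Type*} {p : MvPolynomial σ k} :
    IsUnit p ↔ ∃ c : k, c ≠ 0 ∧ p = C c := by
  rw [isUnit_iff_eq_C_of_isReduced]
  simp only [isUnit_iff_ne_zero]

lemma exists_primes {Q : MvPolynomial (Fin 3) k} (hQ : Q ≠ 0) :
    ∃ (r : ℕ) (p : Fin r → MvPolynomial (Fin 3) k), (∀ i, Prime (p i)) ∧
      (∀ i j, p i ∣ p j → i = j) ∧ (∀ i, p i ∣ Q) ∧ ∀ q, Prime q → q ∣ Q → ∃ i, q ∣ p i := by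
  induction Q using UniqueFactorizationMonoid.induction_on_prime with
  | h₁ => exact absurd rfl hQ
  | h₂ x hx =>
    exact ⟨0, Fin.elim0, fun i => i.elim0, fun i => i.elim0, fun i => i.elim0,
      fun q hq hqx => absurd (isUnit_of_dvd_unit hqx hx) hq.not_isUnit⟩
  | h₃ a π ha hπ ih =>
    obtain ⟨r, p, h1, h2, h3, h4⟩ := ih ha
    by_cases h : π ∣ a
    · refine ⟨r, p, h1, h2, fun i => (h3 i).mul_left _, fun q hq hqa => ?_⟩
      rcases hq.dvd_or_dvd hqa with h5 | h5
      · exact h4 q hq (h5.trans h)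
      · exact h4 q hq h5
    · refine ⟨r + 1, Fin.cons π p, ?_, ?_, ?_, ?_⟩
      · refine Fin.cases ?_ fun i => ?_
        · simpa using hπ
        · simpa using h1 i
      · refine Fin.cases (Fin.cases ?_ fun j => ?_) fun i => Fin.cases ?_ fun j => ?_
        · simp
        · intro h5
          simp only [Fin.cons_zero, Fin.cons_succ] at h5
          exact absurd (h5.trans (h3 j)) h
        · intro h5
          simp only [Fin.cons_zero, Fin.cons_succ] at h5
          exact absurd (((h1 i).associated_of_dvd hπ h5).symm.dvd.trans (h3 i)) h
        · intro h5
          simp only [Fin.cons_succ] at h5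
          rw [h2 i j h5]
      · refine Fin.cases ?_ fun i => ?_
        · simp
        · simpa using (h3 i).mul_left _
      · intro q hq hqa
        rcases hq.dvd_or_dvd hqa with h5 | h5
        · exact ⟨0, by simpa using h5⟩
        · obtain ⟨i, hi⟩ := h4 q hq h5
          exact ⟨i.succ, by simpa using hi⟩

lemma exists_eq_prod_pow {r : ℕ} {p : Fin r → MvPolynomial (Fin 3) k} (hp : ∀ i, Prime (p i))
    {u : MvPolynomial (Fin 3) k} (hu : u ≠ 0)
    (h : ∀ q, Prime q → q ∣ u → ∃ i, q ∣ p i) :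
    ∃ (c : k) (n : Fin r → ℕ), c ≠ 0 ∧ u = C c * ∏ i, p i ^ n i := by
  induction u using UniqueFactorizationMonoid.induction_on_prime with
  | h₁ => exact absurd rfl hu
  | h₂ x hx =>
    obtain ⟨c, hc, rfl⟩ := isUnit_iff_exists_C.1 hx
    exact ⟨c, 0, hc, by simp⟩
  | h₃ a π ha hπ ih =>
    obtain ⟨c, n, hc, hn⟩ := ih ha fun q hq hqa => h q hq (hqa.mul_left _)
    obtain ⟨i, hi⟩ := h π hπ (dvd_mul_right _ _)
    obtain ⟨v, hv⟩ := (hπ.associated_of_dvd (hp i) hi).symm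
    obtain ⟨c', hc', hv'⟩ := isUnit_iff_exists_C.1 v.isUnit
    refine ⟨c * c', n + Pi.single i 1, mul_ne_zero hc hc', ?_⟩
    rw [hn, ← hv, hv']
    simp only [Pi.add_apply, pow_add, Finset.prod_mul_distrib, map_mul]
    have : ∏ j, p j ^ (Pi.single i 1 : Fin r → ℕ) j = p i := by
      rw [Finset.prod_eq_single i]
      · simp
      · intro b _ hb
        simp [Pi.single_eq_of_ne hb]
      · simp
    rw [this]
    ring

lemma exists_not_dvd_pderiv [CharZero k] {p : MvPolynomial (Fin 3) k} (hp : Prime p) {n : ℕ}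
    (hn : p.IsHomogeneous n) : ∃ i, ¬ p ∣ pderiv i p := by
  by_contra! hcon
  have hn0 : n ≠ 0 := by
    rintro rfl
    have := hn.totalDegree hp.ne_zero
    rw [totalDegree_eq_zero_iff_eq_C] at this
    refine hp.not_isUnit (isUnit_iff_exists_C.2 ⟨_, fun h => ?_, this⟩)
    rw [h, map_zero] at this
    exact hp.ne_zero this
  have h0 : ∀ i, pderiv i p = 0 := by
    intro i
    by_contra h0
    obtain ⟨q, hq⟩ := hcon i
    have h1 := hn.pderiv (i := i)
    have h2 := totalDegree_mul_of_isDomain hp.ne_zero (right_ne_zero_of_mul (hq ▸ h0))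
    rw [← hq, h1.totalDegree h0, hn.totalDegree hp.ne_zero] at h2
    omega
  have h1 := hn.sum_X_mul_pderiv
  simp only [h0, mul_zero, Finset.sum_const_zero, nsmul_eq_mul] at h1
  rcases mul_eq_zero.1 h1.symm with h2 | h2
  · exact hn0 (Nat.cast_eq_zero.1 h2)
  · exact hp.ne_zero h2

lemma pow_dvd_jdet [CharZero k] {F : Fin 3 → MvPolynomial (Fin 3) k} {d : ℕ} (B : FreeBasis F d)
    {p q : MvPolynomial (Fin 3) k} (hp : Prime p) (hq : Prime q) {n : ℕ} (hn : p.IsHomogeneous n)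
    {c : k} {e : ℕ} (h : bind₁ F p = C c * q ^ e) : q ^ (e - 1) ∣ jdet F := by
  rcases Nat.eq_zero_or_pos e with rfl | he
  · simp
  obtain ⟨i, hi⟩ := exists_not_dvd_pderiv hp hn
  have h1 : IsRelPrime (bind₁ F p) (bind₁ F (pderiv i p)) :=
    B.isRelPrime_bind ((hp.irreducible.isRelPrime_iff_not_dvd).2 hi)
  have h2 : ¬ q ∣ bind₁ F (pderiv i p) := fun h3 =>
    hq.not_isUnit (h1 (h ▸ (dvd_pow_self q he.ne').mul_left _) h3)
  have h3 : (fun i => bind₁ F (pderiv i p)) ᵥ* jac F =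
      q ^ (e - 1) • fun j => C c * (e : MvPolynomial (Fin 3) k) * pderiv j q := by
    funext j
    have := congrArg (pderiv j) h
    rw [pderiv_bind₁] at this
    simp only [vecMul, dotProduct, jac_apply, Pi.smul_apply, smul_eq_mul]
    rw [this]
    simp [Derivation.leibniz, Derivation.leibniz_pow]
    ring
  have h4 := congrArg (fun v => v ᵥ* (jac F).adjugate) h3
  simp only [vecMul_vecMul, mul_adjugate, smul_vecMul] at h4
  have h5 := congrFun h4 i
  simp only [vecMul_smul, vecMul_one, Pi.smul_apply, smul_eq_mul] at h5
  exact hq.pow_dvd_of_dvd_mul_right _ h2 ⟨_, h5⟩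

end
section
variable {k : Type*} [Field k]

/-- The prime factors of `Q`, permuted by pullback under `F`. -/
structure PrimeData (F : Fin 3 → MvPolynomial (Fin 3) k) (d : ℕ) (Q : MvPolynomial (Fin 3) k)
    {r : ℕ} (p : Fin r → MvPolynomial (Fin 3) k) (σ : Equiv.Perm (Fin r)) (c : Fin r → k)
    (e : Fin r → ℕ) : Prop where
  prime : ∀ i, Prime (p i)
  eq_of_dvd : ∀ i j, p i ∣ p j → i = j
  dvd : ∀ i, p i ∣ Q
  hom : ∀ i, (p i).IsHomogeneous (p i).totalDegree
  factor : ∀ N u, u ∣ Q ^ N → ∃ (c : k) (n : Fin r → ℕ), c ≠ 0 ∧ u = C c * ∏ i, p i ^ n i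
  pullback : ∀ i, bind₁ F (p i) = C (c i) * p (σ i) ^ e i
  c_ne : ∀ i, c i ≠ 0
  degree : ∀ i, e i * (p (σ i)).totalDegree = d * (p i).totalDegree
  pos : 0 < r
  degree_pos : ∀ i, 0 < (p i).totalDegree
  sum_le : ∑ i, (p i).totalDegree ≤ 3

lemma totalDegree_pos_of_prime {p : MvPolynomial (Fin 3) k} (hp : Prime p) :
    0 < p.totalDegree := by
  rw [Nat.pos_iff_ne_zero]
  intro h0
  rw [totalDegree_eq_zero_iff_eq_C] at h0
  refine hp.not_isUnit (isUnit_iff_exists_C.2 ⟨_, fun h => ?_, h0⟩)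
  rw [h, map_zero] at h0
  exact hp.ne_zero h0

lemma isHomogeneous_jdet {F : Fin 3 → MvPolynomial (Fin 3) k} {d : ℕ}
    (hF : ∀ i, (F i).IsHomogeneous d) : (jdet F).IsHomogeneous (3 * (d - 1)) := by
  have h : ∀ i j, (pderiv j (F i)).IsHomogeneous (d - 1) := fun i j => (hF i).pderiv
  rw [jdet, det_apply]
  refine IsHomogeneous.sum _ _ _ fun σ _ => ?_
  rw [Units.smul_def, zsmul_eq_mul, ← map_intCast (C : k →+* MvPolynomial (Fin 3) k),
    ← zero_add (3 * (d - 1))]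
  refine (isHomogeneous_C _ _).mul ?_
  have := IsHomogeneous.prod (R := k) Finset.univ (fun i => jac F (σ i) i) (fun _ => d - 1)
    fun i _ => h _ _
  simpa using this

lemma prod_pow_dvd {r : ℕ} {p : Fin r → MvPolynomial (Fin 3) k} (hp : ∀ i, Prime (p i))
    (h : ∀ i j, p i ∣ p j → i = j) {n : Fin r → ℕ} {u : MvPolynomial (Fin 3) k}
    (hu : ∀ i, p i ^ n i ∣ u) : ∏ i, p i ^ n i ∣ u := by
  refine Finset.prod_dvd_of_isRelPrime ?_ fun i _ => hu i
  intro i _ j _ hij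
  have : IsRelPrime (p i) (p j) :=
    ((hp i).irreducible.isRelPrime_iff_not_dvd).2 fun h1 => hij (h i j h1)
  exact this.pow

lemma totalDegree_prod_pow {r : ℕ} {p : Fin r → MvPolynomial (Fin 3) k} (hp : ∀ i, Prime (p i))
    (n : Fin r → ℕ) : (∏ i, p i ^ n i).totalDegree = ∑ i, n i * (p i).totalDegree := by
  have h1 : ∀ i (m : ℕ), (p i ^ m).totalDegree = m * (p i).totalDegree := by
    intro i m
    induction m with
    | zero => simp
    | succ m ih =>
      rw [pow_succ, totalDegree_mul_of_isDomain (pow_ne_zero _ (hp i).ne_zero) (hp i).ne_zero, ih]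
      ring
  have h2 : ∀ s : Finset (Fin r),
      (∏ i ∈ s, p i ^ n i).totalDegree = ∑ i ∈ s, n i * (p i).totalDegree := by
    intro s
    induction s using Finset.induction_on with
    | empty => simp
    | insert a s ha ih =>
      rw [Finset.prod_insert ha, Finset.sum_insert ha, totalDegree_mul_of_isDomain
        (pow_ne_zero _ (hp a).ne_zero)
        (Finset.prod_ne_zero_iff.2 fun j _ => pow_ne_zero _ (hp j).ne_zero), ih, h1]
  exact h2 _

namespace Conj
variable {d m m' : ℕ} {F G H H' : Fin 3 → MvPolynomial (Fin 3) k}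
    {Q Q' : MvPolynomial (Fin 3) k} {c c' : k} (S : Conj d m m' F G H H' Q Q' c c')
include S

theorem exists_primeData [IsAlgClosed k] [CharZero k] (hd : 2 ≤ d) (hm : 2 ≤ m * m') :
    ∃ (r : ℕ) (p : Fin r → MvPolynomial (Fin 3) k) (σ : Equiv.Perm (Fin r)) (c : Fin r → k)
      (e : Fin r → ℕ), PrimeData F d Q p σ c e := by
  obtain ⟨B⟩ := exists_freeBasis (by omega) S.F_hom S.F_nz
  obtain ⟨r, p, h1, h2, h3, h4⟩ := exists_primes S.Q_ne
  have hom : ∀ i, (p i).IsHomogeneous (p i).totalDegree := by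
    intro i
    obtain ⟨q, hq⟩ := h3 i
    exact exists_isHomogeneous_of_mul (hq ▸ S.Q_hom) (hq ▸ S.Q_ne)
  have factor : ∀ N u, u ∣ Q ^ N →
      ∃ (c : k) (n : Fin r → ℕ), c ≠ 0 ∧ u = C c * ∏ i, p i ^ n i := by
    intro N u hu
    refine exists_eq_prod_pow h1 (ne_zero_of_dvd_ne_zero (pow_ne_zero _ S.Q_ne) hu) ?_
    exact fun q hq hqu => h4 q hq (hq.dvd_of_dvd_pow (hqu.trans hu))
  have dpos : ∀ i, 0 < (p i).totalDegree := fun i => totalDegree_pos_of_prime (h1 i)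
  have homF : ∀ i, (bind₁ F (p i)).IsHomogeneous (d * (p i).totalDegree) := fun i =>
    (hom i).aeval F S.F_hom
  have hF0 : ∀ i, bind₁ F (p i) ≠ 0 := fun i h =>
    (h1 i).ne_zero (B.bind_injective (h.trans (map_zero _).symm))
  obtain ⟨κ, hκ, hQF⟩ := S.Q_comp_F (by omega)
  have hfac : ∀ i, ∃ (c : k) (n : Fin r → ℕ), c ≠ 0 ∧ bind₁ F (p i) = C c * ∏ i, p i ^ n i := by
    intro i
    apply factor d
    have := map_dvd (bind₁ F) (h3 i)
    rwa [hQF, IsUnit.dvd_mul_left] at this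
    exact isUnit_iff_exists_C.2 ⟨κ, hκ, rfl⟩
  choose c n hc hn using hfac
  have hdeg : ∀ i, ∑ j, n i j * (p j).totalDegree = d * (p i).totalDegree := by
    intro i
    rw [← (homF i).totalDegree (hF0 i), hn, totalDegree_mul_of_isDomain (by simpa using hc i)
      (Finset.prod_ne_zero_iff.2 fun j _ => pow_ne_zero _ (h1 j).ne_zero), totalDegree_C,
      totalDegree_prod_pow h1, zero_add]
  have hdisj : ∀ i i' j, n i j ≠ 0 → n i' j ≠ 0 → i = i' := by
    intro i i' j h5 h6
    by_contra hne
    have h7 : IsRelPrime (p i) (p i') :=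
      ((h1 i).irreducible.isRelPrime_iff_not_dvd).2 fun h => hne (h2 i i' h)
    have h8 : ∀ i, n i j ≠ 0 → p j ∣ bind₁ F (p i) := by
      intro i h
      rw [hn]
      exact ((dvd_pow_self _ h).trans
        (Finset.dvd_prod_of_mem (fun j => p j ^ n i j) (mem_univ j))).mul_left _
    exact (h1 j).not_isUnit (B.isRelPrime_bind h7 (h8 i h5) (h8 i' h6))
  have hex : ∀ i, ∃ j, n i j ≠ 0 := by
    intro i
    by_contra! hcon
    have := hdeg i
    simp only [hcon, zero_mul, Finset.sum_const_zero] at this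
    have h5 := Nat.mul_pos (show 0 < d by omega) (dpos i)
    omega
  choose s hs using hex
  have hinj : Function.Injective s := fun i i' h => hdisj i i' (s i) (hs i) (h ▸ hs i')
  have hbij : Function.Bijective s := Finite.injective_iff_bijective.1 hinj
  have hz : ∀ i j, j ≠ s i → n i j = 0 := by
    intro i j hj
    by_contra h0
    obtain ⟨i', rfl⟩ := hbij.2 j
    exact hj (by rw [hdisj i i' _ h0 (hs i')])
  have hpb : ∀ i, bind₁ F (p i) = C (c i) * p (s i) ^ n i (s i) := by
    intro i
    rw [hn, Finset.prod_eq_single (s i)]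
    · exact fun j _ hj => by rw [hz i j hj, pow_zero]
    · simp
  have hdeg' : ∀ i, n i (s i) * (p (s i)).totalDegree = d * (p i).totalDegree := by
    intro i
    rw [← hdeg i, Finset.sum_eq_single (s i)]
    · exact fun j _ hj => by rw [hz i j hj, zero_mul]
    · simp
  refine ⟨r, p, Equiv.ofBijective s hbij, c, fun i => n i (s i), h1, h2, h3, hom, factor, hpb, hc,
    hdeg', ?_, dpos, ?_⟩
  · rw [Nat.pos_iff_ne_zero]
    rintro rfl
    obtain ⟨a, b, ha, hb⟩ := factor 1 Q (by simp)
    have := S.Q_hom.totalDegree S.Q_ne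
    rw [hb] at this
    simp at this
    omega
  · set E := Equiv.ofBijective s hbij
    have h5 : ∏ j, p j ^ (n (E.symm j) j - 1) ∣ jdet F := by
      refine prod_pow_dvd h1 h2 fun j => ?_
      obtain ⟨i, rfl⟩ := E.surjective j
      rw [Equiv.symm_apply_apply]
      exact pow_dvd_jdet B (h1 i) (h1 _) (hom i) (hpb i)
    have h6 := totalDegree_le_of_dvd_of_isDomain h5 B.jdet_ne_zero
    rw [totalDegree_prod_pow h1, (isHomogeneous_jdet S.F_hom).totalDegree B.jdet_ne_zero,
      ← Equiv.sum_comp E] at h6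
    simp only [Equiv.symm_apply_apply] at h6
    have h7 : ∑ i, (n i (E i) - 1) * (p (E i)).totalDegree + ∑ i, (p (E i)).totalDegree =
        d * ∑ i, (p i).totalDegree := by
      rw [← Finset.sum_add_distrib, Finset.mul_sum]
      refine Finset.sum_congr rfl fun i _ => ?_
      rw [← hdeg' i]
      have : 1 ≤ n i (E i) := Nat.one_le_iff_ne_zero.2 (hs i)
      obtain ⟨t, ht⟩ := Nat.exists_eq_add_of_le this
      change (n i (E i) - 1) * (p (E i)).totalDegree + _ = n i (E i) * _
      rw [ht, Nat.add_sub_cancel_left]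
      change t * (p (E i)).totalDegree + _ = (1 + t) * (p (E i)).totalDegree
      ring
    rw [Equiv.sum_comp E (fun i => (p i).totalDegree)] at h7
    obtain ⟨d', rfl⟩ : ∃ d', d = d' + 2 := ⟨d - 2, by omega⟩
    have h8 : d' + 2 - 1 = d' + 1 := by omega
    rw [h8] at h6
    set x := ∑ i, (p i).totalDegree
    have h9 : (d' + 1) * x ≤ (d' + 1) * 3 := by
      have : (d' + 2) * x = (d' + 1) * x + x := by ring
      omega
    exact Nat.le_of_mul_le_mul_left h9 (by omega)

end Conj
end
section
variable {k : Type*} [Field k]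

/-- The derivation attached to a polynomial vector field. -/
noncomputable def der (μ : Fin 3 → MvPolynomial (Fin 3) k) :
    Derivation k (MvPolynomial (Fin 3) k) (MvPolynomial (Fin 3) k) :=
  mkDerivation k μ

@[simp] lemma der_X (μ : Fin 3 → MvPolynomial (Fin 3) k) (i : Fin 3) : der μ (X i) = μ i :=
  mkDerivation_X k μ i

lemma der_apply (μ : Fin 3 → MvPolynomial (Fin 3) k) (p : MvPolynomial (Fin 3) k) :
    der μ p = ∑ j, pderiv j p * μ j := by
  induction p using MvPolynomial.induction_on with
  | C a => simp [der]
  | add p q hp hq => simp only [map_add, hp, hq, add_mul, Finset.sum_add_distrib]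
  | mul_X p i hp =>
    simp only [Derivation.leibniz, hp, smul_eq_mul, add_mul,
      Finset.sum_add_distrib, Finset.mul_sum, pderiv_X]
    congr 1
    · rw [Finset.sum_eq_single i]
      · simp
      · intro b _ hb
        simp [Pi.single_eq_of_ne' hb]
      · simp
    · exact Finset.sum_congr rfl fun l _ => by ring

@[simp] lemma der_C (μ : Fin 3 → MvPolynomial (Fin 3) k) (a : k) : der μ (C a) = 0 :=
  (der μ).map_algebraMap a

/-- A vector field `ν` lifting `μ` along `F` intertwines the derivations. -/
lemma der_bind₁ {F μ ν : Fin 3 → MvPolynomial (Fin 3) k}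
    (h : jac F *ᵥ ν = fun i => bind₁ F (μ i)) (p : MvPolynomial (Fin 3) k) :
    der ν (bind₁ F p) = bind₁ F (der μ p) := by
  simp only [der_apply, pderiv_bind₁, map_sum, map_mul, Finset.sum_mul]
  rw [Finset.sum_comm]
  refine Finset.sum_congr rfl fun i _ => ?_
  rw [← congrFun h i]
  simp only [mulVec, dotProduct, jac_apply, Finset.mul_sum, mul_assoc]

lemma dvd_mul_det {R : Type*} [CommRing R] {n : ℕ} (N : Matrix (Fin n) (Fin n) R) (w : Fin n → R)
    {g : R} (h : ∀ b, g ∣ (w ᵥ* N) b) (i : Fin n) : g ∣ w i * N.det := by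
  choose t ht using h
  have h1 := det_updateRow_sum N i w
  have h2 : ∑ j, w j • N j = g • t := by
    funext b
    rw [Pi.smul_apply, smul_eq_mul, ← ht]
    simp [vecMul, dotProduct]
  rw [h2, det_updateRow_smul, smul_eq_mul] at h1
  exact ⟨_, h1.symm⟩

lemma pow_dvd_cramer [CharZero k] {F : Fin 3 → MvPolynomial (Fin 3) k} {d : ℕ} (B : FreeBasis F d)
    {p : MvPolynomial (Fin 3) k} (hp : Prime p) {n : ℕ} (hn : p.IsHomogeneous n)
    {c : k} {e : ℕ} (h : bind₁ F p = C c * p ^ e) {μ : Fin 3 → MvPolynomial (Fin 3) k}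
    (hμ : p ∣ der μ p) (a : Fin 3) :
    p ^ (e - 1) ∣ (jac F).cramer (fun i => bind₁ F (μ i)) a := by
  rcases Nat.eq_zero_or_pos e with rfl | he
  · simp
  obtain ⟨i, hi⟩ := exists_not_dvd_pderiv hp hn
  have h1 : IsRelPrime (bind₁ F p) (bind₁ F (pderiv i p)) :=
    B.isRelPrime_bind ((hp.irreducible.isRelPrime_iff_not_dvd).2 hi)
  have h2 : ¬ p ∣ bind₁ F (pderiv i p) := fun h3 =>
    hp.not_isUnit (h1 (h ▸ (dvd_pow_self p he.ne').mul_left _) h3)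
  refine hp.pow_dvd_of_dvd_mul_left _ h2 ?_
  rw [cramer_apply]
  refine dvd_mul_det _ (fun i => bind₁ F (pderiv i p)) (fun b => ?_) i
  by_cases hb : b = a
  · subst hb
    have : ((fun i => bind₁ F (pderiv i p)) ᵥ*
        (jac F).updateCol b fun i => bind₁ F (μ i)) b = bind₁ F (der μ p) := by
      simp [vecMul, dotProduct, der_apply]
    rw [this]
    refine dvd_trans ?_ (map_dvd (bind₁ F) hμ)
    rw [h]
    exact (pow_dvd_pow p (Nat.sub_le e 1)).mul_left _
  · have : ((fun i => bind₁ F (pderiv i p)) ᵥ*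
        (jac F).updateCol a fun i => bind₁ F (μ i)) b = pderiv b (bind₁ F p) := by
      rw [pderiv_bind₁]
      simp [vecMul, dotProduct, updateCol_ne hb]
    rw [this, h]
    simp only [Derivation.leibniz, Derivation.leibniz_pow, pderiv_C, mul_zero, add_zero,
      smul_eq_mul, nsmul_eq_mul]
    exact Dvd.dvd.mul_left (Dvd.dvd.mul_left (dvd_mul_right _ _) _) _

/-- `F` preserves a reduced cubic, given by its prime factors `p i`. -/
structure CubicData (F : Fin 3 → MvPolynomial (Fin 3) k) (D : ℕ) {r : ℕ}
    (p : Fin r → MvPolynomial (Fin 3) k) (c : Fin r → k) : Prop where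
  two_le : 2 ≤ D
  F_hom : ∀ i, (F i).IsHomogeneous D
  prime : ∀ i, Prime (p i)
  eq_of_dvd : ∀ i j, p i ∣ p j → i = j
  hom : ∀ i, (p i).IsHomogeneous (p i).totalDegree
  pullback : ∀ i, bind₁ F (p i) = C (c i) * p i ^ D
  c_ne : ∀ i, c i ≠ 0
  sum_eq : ∑ i, (p i).totalDegree = 3

namespace CubicData
variable {F : Fin 3 → MvPolynomial (Fin 3) k} {D r : ℕ}
    {p : Fin r → MvPolynomial (Fin 3) k} {c : Fin r → k} (S : CubicData F D p c)
include S

lemma prod_ne_zero : ∏ i, p i ≠ 0 := Finset.prod_ne_zero_iff.2 fun i _ => (S.prime i).ne_zero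

lemma isHomogeneous_prod : (∏ i, p i).IsHomogeneous 3 :=
  by
  have := IsHomogeneous.prod Finset.univ p (fun i => (p i).totalDegree) fun i _ => S.hom i
  rwa [S.sum_eq] at this

lemma bind_prod : bind₁ F (∏ i, p i) = C (∏ i, c i) * (∏ i, p i) ^ D := by
  rw [map_prod, map_prod, ← Finset.prod_pow, ← Finset.prod_mul_distrib]
  exact Finset.prod_congr rfl fun i _ => S.pullback i

lemma dvd_der {μ : Fin 3 → MvPolynomial (Fin 3) k} (h : der μ (∏ i, p i) = 0) (i : Fin r) :
    p i ∣ der μ (p i) := by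
  classical
  rw [← Finset.mul_prod_erase _ p (mem_univ i), Derivation.leibniz, smul_eq_mul, smul_eq_mul] at h
  have h1 : p i ∣ (∏ j ∈ univ.erase i, p j) * der μ (p i) :=
    ⟨-der μ (∏ j ∈ univ.erase i, p j), by linear_combination h⟩
  refine ((S.prime i).dvd_or_dvd h1).resolve_left fun h2 => ?_
  obtain ⟨j, hj, hd⟩ := ((S.prime i).dvd_finsetProd_iff _).1 h2
  exact (Finset.ne_of_mem_erase hj) (S.eq_of_dvd i j hd).symm

lemma jdet_eq [CharZero k] (B : FreeBasis F D) :
    ∃ c' : k, c' ≠ 0 ∧ jdet F = C c' * (∏ i, p i) ^ (D - 1) := by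
  have h1 : ∏ i, p i ^ (D - 1) ∣ jdet F := prod_pow_dvd S.prime S.eq_of_dvd fun i =>
    pow_dvd_jdet B (S.prime i) (S.prime i) (S.hom i) (S.pullback i)
  obtain ⟨u, hu⟩ := h1
  have h0 := B.jdet_ne_zero
  have h2 := totalDegree_mul_of_isDomain (left_ne_zero_of_mul (hu ▸ h0))
    (right_ne_zero_of_mul (hu ▸ h0))
  rw [← hu, (isHomogeneous_jdet S.F_hom).totalDegree h0, totalDegree_prod_pow S.prime,
    ← Finset.mul_sum, S.sum_eq] at h2
  have h3 : u.totalDegree = 0 := by omega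
  rw [totalDegree_eq_zero_iff_eq_C] at h3
  refine ⟨coeff 0 u, fun h => ?_, ?_⟩
  · rw [h, map_zero] at h3
    exact h0 (by rw [hu, h3, mul_zero])
  · rw [← h3, hu, Finset.prod_pow, mul_comm]

lemma der_eq_zero [CharZero k] {μ ν : Fin 3 → MvPolynomial (Fin 3) k}
    (h : der μ (∏ i, p i) = 0) (hν : jac F *ᵥ ν = fun i => bind₁ F (μ i)) :
    der ν (∏ i, p i) = 0 := by
  have h1 := der_bind₁ hν (∏ i, p i)
  rw [h, map_zero, S.bind_prod] at h1
  simp only [Derivation.leibniz, Derivation.leibniz_pow, der_C,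
      smul_eq_mul, nsmul_eq_mul, mul_zero, add_zero, mul_eq_zero] at h1
  have hD := S.two_le
  rcases h1 with h1 | h1 | h1 | h1
  · rw [C_eq_zero, Finset.prod_eq_zero_iff] at h1
    obtain ⟨i, _, hi⟩ := h1
    exact absurd hi (S.c_ne i)
  · rw [Nat.cast_eq_zero] at h1; omega
  · exact absurd h1 (pow_ne_zero _ S.prod_ne_zero)
  · exact h1

lemma exists_lift [CharZero k] (B : FreeBasis F D) {μ : Fin 3 → MvPolynomial (Fin 3) k}
    (h : der μ (∏ i, p i) = 0) :
    ∃ ν, jac F *ᵥ ν = (fun i => bind₁ F (μ i)) ∧ der ν (∏ i, p i) = 0 := by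
  obtain ⟨c', hc', hJ⟩ := S.jdet_eq B
  have h1 : ∀ a, jdet F ∣ (jac F).cramer (fun i => bind₁ F (μ i)) a := by
    intro a
    rw [hJ, IsUnit.mul_left_dvd (isUnit_iff_exists_C.2 ⟨c', hc', rfl⟩), ← Finset.prod_pow]
    exact prod_pow_dvd S.prime S.eq_of_dvd fun i =>
      pow_dvd_cramer B (S.prime i) (S.hom i) (S.pullback i) (S.dvd_der h i) a
  choose ν hν using h1
  have h2 : jac F *ᵥ ν = fun i => bind₁ F (μ i) := by
    have h3 := mulVec_cramer (jac F) (fun i => bind₁ F (μ i))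
    have h4 : (jac F).cramer (fun i => bind₁ F (μ i)) = jdet F • ν := by
      funext a
      rw [hν]; rfl
    rw [h4, mulVec_smul] at h3
    exact smul_right_injective _ B.jdet_ne_zero h3
  exact ⟨ν, h2, S.der_eq_zero h h2⟩

end CubicData
end
section
variable {k : Type*} [Field k]

/-- The linear vector field attached to a matrix. -/
noncomputable def lin (A : Matrix (Fin 3) (Fin 3) k) : Fin 3 → MvPolynomial (Fin 3) k :=
  fun i => ∑ j, C (A i j) * X j

lemma isHomogeneous_lin (A : Matrix (Fin 3) (Fin 3) k) (i : Fin 3) :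
    (lin A i).IsHomogeneous 1 :=
  IsHomogeneous.sum _ _ _ fun j _ => by
    simpa using (isHomogeneous_C (Fin 3) (A i j)).mul (isHomogeneous_X k j)

lemma exists_eq_sum_of_isHomogeneous_one {p : MvPolynomial (Fin 3) k} (hp : p.IsHomogeneous 1) :
    ∃ b : Fin 3 → k, p = ∑ j, C (b j) * X j := by
  have h := hp.sum_X_mul_pderiv
  have h1 : ∀ i, ∃ b : k, pderiv i p = C b := fun i =>
    ⟨_, totalDegree_eq_zero_iff_eq_C.1 (Nat.le_zero.1 (hp.pderiv (i := i)).totalDegree_le)⟩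
  choose b hb using h1
  refine ⟨b, ?_⟩
  rw [one_smul] at h
  rw [← h]
  exact Finset.sum_congr rfl fun i _ => by rw [hb, mul_comm]

lemma exists_eq_C_add_sum {p : MvPolynomial (Fin 3) k} (hp : p.totalDegree ≤ 1) :
    ∃ (a : k) (b : Fin 3 → k), p = C a + ∑ j, C (b j) * X j := by
  obtain ⟨b, hb⟩ := exists_eq_sum_of_isHomogeneous_one (homogeneousComponent_isHomogeneous 1 p)
  refine ⟨coeff 0 p, b, ?_⟩
  conv_lhs => rw [← sum_homogeneousComponent p]
  rw [← hb, ← homogeneousComponent_zero]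
  have : p.totalDegree = 0 ∨ p.totalDegree = 1 := by omega
  rcases this with h | h
  · rw [h, Finset.sum_range_one, homogeneousComponent_eq_zero 1 p (by omega), add_zero]
  · rw [h, Finset.sum_range_succ, Finset.sum_range_one]

lemma totalDegree_det_le {N : Matrix (Fin 3) (Fin 3) (MvPolynomial (Fin 3) k)} {δ : Fin 3 → ℕ}
    (h : ∀ a b, (N a b).totalDegree ≤ δ b) : N.det.totalDegree ≤ ∑ b, δ b := by
  rw [det_apply]
  refine totalDegree_finsetSum_le fun σ _ => ?_
  have h1 : (∏ i, N (σ i) i).totalDegree ≤ ∑ b, δ b :=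
    (totalDegree_finsetProd _ _).trans (Finset.sum_le_sum fun i _ => h _ _)
  rcases Int.units_eq_one_or (Equiv.Perm.sign σ) with h2 | h2 <;> rw [h2]
  · rwa [one_smul]
  · rwa [Units.neg_smul, one_smul, totalDegree_neg]

namespace CubicData
variable {F : Fin 3 → MvPolynomial (Fin 3) k} {D r : ℕ}
    {p : Fin r → MvPolynomial (Fin 3) k} {c : Fin r → k} (S : CubicData F D p c)
include S

lemma totalDegree_jac_le (a b : Fin 3) : (jac F a b).totalDegree ≤ D - 1 :=
  (S.F_hom a).pderiv.totalDegree_le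

lemma totalDegree_lift [CharZero k] (B : FreeBasis F D) {μ ν : Fin 3 → MvPolynomial (Fin 3) k}
    {n : ℕ} (hμ : ∀ i, (μ i).totalDegree ≤ n) (h : jac F *ᵥ ν = μ) (i : Fin 3) (hi : ν i ≠ 0) :
    (ν i).totalDegree + (D - 1) ≤ n := by
  have h0 := B.jdet_ne_zero
  have h1 : jdet F * ν i = (jac F).cramer μ i := by
    have h2 : (jac F).adjugate *ᵥ (jac F *ᵥ ν) = jdet F • ν := by
      rw [mulVec_mulVec, adjugate_mul, smul_mulVec, one_mulVec]; rfl
    rw [h, ← cramer_eq_adjugate_mulVec] at h2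
    rw [h2]; rfl
  have h2 := totalDegree_mul_of_isDomain h0 hi
  rw [h1, cramer_apply, (isHomogeneous_jdet S.F_hom).totalDegree h0] at h2
  have h3 := totalDegree_det_le (N := (jac F).updateCol i μ)
    (δ := Function.update (fun _ => D - 1) i n) fun a b => by
      by_cases hb : b = i
      · subst hb; simpa using hμ a
      · simpa [updateCol_ne hb, Function.update_of_ne hb] using S.totalDegree_jac_le a b
  have h4 : ∑ b, Function.update (fun _ : Fin 3 => D - 1) i n b = n + 2 * (D - 1) := by
    rw [Finset.sum_update_of_mem (mem_univ i), Finset.sum_const, smul_eq_mul,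
      Finset.card_sdiff_of_subset (by simp)]
    simp
  omega

/-- Vector fields of degree at most one tangent to the cubic. -/
abbrev affineFields (_ : CubicData F D p c) : Set (Fin 3 → MvPolynomial (Fin 3) k) :=
  {μ | der μ (∏ i, p i) = 0 ∧ ∀ i, (μ i).totalDegree ≤ 1}

lemma exists_lift_affine [CharZero k] (B : FreeBasis F D) {μ : Fin 3 → MvPolynomial (Fin 3) k}
    (h : μ ∈ S.affineFields) :
    ∃ ν ∈ S.affineFields, jac F *ᵥ ν = fun i => bind₁ F (μ i) := by
  obtain ⟨ν, h1, h2⟩ := S.exists_lift B h.1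
  refine ⟨ν, ⟨h2, fun i => ?_⟩, h1⟩
  by_cases hi : ν i = 0
  · rw [hi, totalDegree_zero]; exact Nat.zero_le _
  have hD := S.two_le
  have := S.totalDegree_lift B (n := D) (fun i => ?_) h1 i hi
  · omega
  · obtain ⟨a, b, hab⟩ := exists_eq_C_add_sum (h.2 i)
    rw [hab]
    simp only [map_add, map_sum, map_mul, bind₁_C_right, bind₁_X_right]
    refine (totalDegree_add _ _).trans (max_le (by simp) (totalDegree_finsetSum_le fun j _ => ?_))
    refine (totalDegree_mul _ _).trans ?_
    rw [totalDegree_C, zero_add]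
    exact (S.F_hom j).totalDegree_le

lemma exists_lift_span [CharZero k] (B : FreeBasis F D) {μ : Fin 3 → MvPolynomial (Fin 3) k}
    (h : μ ∈ Submodule.span (MvPolynomial (Fin 3) k) S.affineFields) :
    ∃ ν ∈ Submodule.span (MvPolynomial (Fin 3) k) S.affineFields,
      jac F *ᵥ ν = fun i => bind₁ F (μ i) := by
  induction h using Submodule.span_induction with
  | mem μ hμ =>
    obtain ⟨ν, h1, h2⟩ := S.exists_lift_affine B hμ
    exact ⟨ν, Submodule.subset_span h1, h2⟩
  | zero => exact ⟨0, zero_mem _, by simp; rfl⟩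
  | add x y _ _ hx hy =>
    obtain ⟨u, hu, hu'⟩ := hx
    obtain ⟨v, hv, hv'⟩ := hy
    refine ⟨u + v, add_mem hu hv, ?_⟩
    rw [mulVec_add, hu', hv']
    funext i; simp
  | smul a x _ hx =>
    obtain ⟨u, hu, hu'⟩ := hx
    refine ⟨bind₁ F a • u, Submodule.smul_mem _ _ hu, ?_⟩
    rw [mulVec_smul, hu']
    funext i; simp

lemma mem_span_affineFields [CharZero k] (B : FreeBasis F D) (n : ℕ) :
    ∀ θ : Fin 3 → MvPolynomial (Fin 3) k, der θ (∏ i, p i) = 0 → (∀ i, (θ i).totalDegree ≤ n) →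
      θ ∈ Submodule.span (MvPolynomial (Fin 3) k) S.affineFields := by
  have hD := S.two_le
  induction n with
  | zero => exact fun θ h h' => Submodule.subset_span ⟨h, fun i => (h' i).trans (by norm_num)⟩
  | succ n ih =>
    intro θ h h'
    rcases Nat.eq_zero_or_pos n with rfl | hn
    · exact Submodule.subset_span ⟨h, h'⟩
    have hy : ∀ i, ((jac F *ᵥ θ) i).totalDegree ≤ n + 1 + (D - 1) := fun i => by
      refine totalDegree_finsetSum_le fun j _ => ?_
      refine (totalDegree_mul _ _).trans ?_
      exact (Nat.add_le_add (S.totalDegree_jac_le i j) (h' j)).trans (Nat.add_comm _ _).le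
    choose e he hdeg using fun i => B.span _ _ (hy i)
    have h1 : ∑ i, pderiv i (∏ i, p i) • e i = 0 := by
      refine B.indep _ ?_
      rw [map_sum]
      simp only [combine_smul, he]
      have h2 : der θ (bind₁ F (∏ i, p i)) = 0 := by
        rw [S.bind_prod, Derivation.leibniz, Derivation.leibniz_pow, h, der_C]
        simp
      rw [← h2, der_apply]
      simp only [pderiv_bind₁, Finset.sum_mul, mulVec, dotProduct, jac_apply, Finset.mul_sum]
      rw [Finset.sum_comm]
      simp only [mul_assoc]
    have h2 : ∀ b, der (fun i => e i b) (∏ i, p i) = 0 := fun b => by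
      have := DFunLike.congr_fun h1 b
      rw [der_apply]
      simpa [Finsupp.finsetSum_apply] using this
    have h3 : ∀ b i, (e i b).totalDegree ≤ n := fun b i => by
      have h4 := hdeg i b
      by_contra! h5
      have h6 : D * (n + 1) ≤ D * (e i b).totalDegree := Nat.mul_le_mul_left D h5
      obtain ⟨D', rfl⟩ : ∃ D', D = D' + 2 := ⟨D - 2, by omega⟩
      have h7 : n + 1 + (D' + 1) < (D' + 2) * (n + 1) := by nlinarith
      omega
    choose ν hν hν' using fun b => S.exists_lift_span B (ih _ (h2 b) (h3 b))
    classical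
    have h4 : θ = ∑ b ∈ univ.biUnion (fun i => (e i).support), B.b b • ν b := by
      refine sub_eq_zero.1 (eq_zero_of_mulVec_eq_zero B.jdet_ne_zero ?_)
      rw [mulVec_sub, sub_eq_zero, mulVec_sum]
      simp only [mulVec_smul, hν']
      funext i
      rw [← he, combine_apply, Finset.sum_apply,
        Finsupp.sum_of_support_subset _
            (Finset.subset_biUnion_of_mem (fun i => (e i).support) (mem_univ i)) _ (by simp)]
      exact Finset.sum_congr rfl fun b _ => by simp [mul_comm]
    rw [h4]
    exact Submodule.sum_mem _ fun b _ => Submodule.smul_mem _ _ (hν b)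

lemma affineFields_eq_lin [CharZero k] (B : FreeBasis F D) {μ : Fin 3 → MvPolynomial (Fin 3) k}
    (h : μ ∈ S.affineFields) : ∃ A, μ = lin A := by
  have hD := S.two_le
  choose a b hab using fun i => exists_eq_C_add_sum (h.2 i)
  have h1 : μ = (fun i => C (a i)) + lin (of b) := by
    funext i
    rw [hab i]; rfl
  have h2 : der μ (∏ i, p i) = der (fun i => C (a i)) (∏ i, p i) + der (lin (of b)) (∏ i, p i) := by
    rw [h1]; simp only [der_apply, Pi.add_apply, mul_add, Finset.sum_add_distrib]
  rw [h.1] at h2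
  have h3 : (der (fun i => C (a i)) (∏ i, p i)).IsHomogeneous 2 := by
    rw [der_apply]
    exact IsHomogeneous.sum _ _ _ fun j _ => by
      simpa using (S.isHomogeneous_prod.pderiv (i := j)).mul (isHomogeneous_C (Fin 3) (a j))
  have h4 : (der (lin (of b)) (∏ i, p i)).IsHomogeneous 3 := by
    rw [der_apply]
    exact IsHomogeneous.sum _ _ _ fun j _ => by
      simpa using (S.isHomogeneous_prod.pderiv (i := j)).mul (isHomogeneous_lin (of b) j)
  have h5 : der (fun i => C (a i)) (∏ i, p i) = 0 := by
    by_contra h6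
    have h7 : der (lin (of b)) (∏ i, p i) = - der (fun i => C (a i)) (∏ i, p i) := by
      linear_combination -h2
    rw [h7] at h4
    have := (h3.neg).inj_right h4 (neg_ne_zero.2 h6)
    omega
  obtain ⟨ν, hν, _⟩ := S.exists_lift B h5
  have h6 : ν = 0 := by
    funext i
    by_contra hi
    have := S.totalDegree_lift B (n := 0) (μ := fun i => bind₁ F (C (a i))) (fun i => by simp)
        hν i hi
    omega
  refine ⟨of b, ?_⟩
  rw [h1, add_eq_right]
  rw [h6, mulVec_zero] at hν
  funext i
  have := congrFun hν i
  simpa using this.symm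

lemma exists_linear_lift [CharZero k] (B : FreeBasis F D) {A : Matrix (Fin 3) (Fin 3) k}
    (h : der (lin A) (∏ i, p i) = 0) :
    ∃ A', der (lin A') (∏ i, p i) = 0 ∧ jac F *ᵥ lin A' = fun i => bind₁ F (lin A i) := by
  obtain ⟨ν, h1, h2⟩ := S.exists_lift_affine B
    ⟨h, fun i => (isHomogeneous_lin A i).totalDegree_le⟩
  obtain ⟨A', rfl⟩ := S.affineFields_eq_lin B h1
  exact ⟨A', h1.1, h2⟩

lemma exists_linear_fields [CharZero k] (B : FreeBasis F D) :
    ∃ A A' : Matrix (Fin 3) (Fin 3) k, der (lin A) (∏ i, p i) = 0 ∧ der (lin A') (∏ i, p i) = 0 ∧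
      (of ![X, lin A, lin A']).det ≠ 0 := by
  by_contra! hcon
  have key : ∀ θ θ' : Fin 3 → MvPolynomial (Fin 3) k, der θ (∏ i, p i) = 0 →
      der θ' (∏ i, p i) = 0 → (of ![X, θ, θ']).det = 0 := by
    intro θ θ' h h'
    have h1 := S.mem_span_affineFields B _ θ h
      fun i => Finset.le_sup (f := fun i => (θ i).totalDegree) (mem_univ i)
    have h2 := S.mem_span_affineFields B _ θ' h'
      fun i => Finset.le_sup (f := fun i => (θ' i).totalDegree) (mem_univ i)
    clear h h'
    simp only [det_fin_three, of_apply, Matrix.cons_val]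
    induction h1, h2 using Submodule.span_induction₂ with
    | mem_mem x y hx hy =>
      obtain ⟨A, rfl⟩ := S.affineFields_eq_lin B hx
      obtain ⟨A', rfl⟩ := S.affineFields_eq_lin B hy
      have := hcon A A' hx.1 hy.1
      simpa only [det_fin_three, of_apply, Matrix.cons_val] using this
    | zero_left => simp
    | zero_right => simp
    | add_left x y z _ _ _ h1 h2 => simp only [Pi.add_apply]; linear_combination h1 + h2
    | add_right x y z _ _ _ h1 h2 => simp only [Pi.add_apply]; linear_combination h1 + h2
    | smul_left a x y _ _ h1 => simp only [Pi.smul_apply, smul_eq_mul]; linear_combination a * h1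
    | smul_right a x y _ _ h1 => simp only [Pi.smul_apply, smul_eq_mul]; linear_combination a * h1
  set P := ∏ i, p i with hP
  have hE := S.isHomogeneous_prod.sum_X_mul_pderiv
  rw [← hP, Fin.sum_univ_three] at hE
  have h3 : (3 : MvPolynomial (Fin 3) k) * P ≠ 0 := mul_ne_zero (by norm_num) S.prod_ne_zero
  have e0 : der ![0, pderiv 2 P, - pderiv 1 P] P = 0 := by
    simp [der_apply, Fin.sum_univ_three]; ring
  have e1 : der ![- pderiv 2 P, 0, pderiv 0 P] P = 0 := by
    simp [der_apply, Fin.sum_univ_three]; ring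
  have e2 : der ![pderiv 1 P, - pderiv 0 P, 0] P = 0 := by
    simp [der_apply, Fin.sum_univ_three]; ring
  have d0 := key _ _ e1 e2
  have d1 := key _ _ e2 e0
  have d2 := key _ _ e0 e1
  simp only [det_fin_three, of_apply, Matrix.cons_val] at d0 d1 d2
  rw [nsmul_eq_mul, Nat.cast_ofNat] at hE
  have f0 : pderiv 0 P = 0 := (mul_eq_zero.1 (show 3 * P * pderiv 0 P = 0 by
    rw [← hE]; linear_combination d0)).resolve_left h3
  have f1 : pderiv 1 P = 0 := (mul_eq_zero.1 (show 3 * P * pderiv 1 P = 0 by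
    rw [← hE]; linear_combination d1)).resolve_left h3
  have f2 : pderiv 2 P = 0 := (mul_eq_zero.1 (show 3 * P * pderiv 2 P = 0 by
    rw [← hE]; linear_combination d2)).resolve_left h3
  rw [f0, f1, f2] at hE
  exact h3 (by rw [← hE]; ring)

end CubicData
end
section
variable {k : Type*} [Field k]

lemma exists_common_eigenvector_of_lie_eq_smul [IsAlgClosed k] [CharZero k]
    {A B : Matrix (Fin 3) (Fin 3) k} {γ : k} (h : A * B - B * A = γ • B) :
    ∃ v ≠ 0, ∃ a b : k, A *ᵥ v = a • v ∧ B *ᵥ v = b • v := by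
  obtain ⟨b, hb, w, hw0, hw⟩ : ∃ b : k, b * γ = 0 ∧ ∃ w ≠ 0, B *ᵥ w = b • w := by
    by_cases hγ : γ = 0
    · obtain ⟨b, hb⟩ := Module.End.exists_eigenvalue (toLin' B)
      obtain ⟨w, hw⟩ := hb.exists_hasEigenvector
      exact ⟨b, by rw [hγ, mul_zero], w, hw.2, by simpa using hw.apply_eq_smul⟩
    · have hdet : B.det = 0 := by
        by_contra hdet
        have hB : IsUnit B.det := isUnit_iff_ne_zero.2 hdet
        have h1 : A - B * A * B⁻¹ = γ • (1 : Matrix (Fin 3) (Fin 3) k) := by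
          have := congrArg (· * B⁻¹) h
          simpa [sub_mul, mul_assoc, mul_nonsing_inv _ hB] using this
        have h2 := congrArg trace h1
        rw [trace_sub, trace_mul_cycle, nonsing_inv_mul _ hB, one_mul, sub_self, trace_smul,
          trace_one] at h2
        simp [hγ] at h2
      obtain ⟨w, hw, hw'⟩ := exists_mulVec_eq_zero_iff.2 hdet
      exact ⟨0, zero_mul _, w, hw, by rw [hw', zero_smul]⟩
  let W := Module.End.eigenspace (toLin' B) b
  have hW : ∀ v, v ∈ W ↔ B *ᵥ v = b • v := fun v => by
    simp [W]
  have hA : ∀ v ∈ W, toLin' A v ∈ W := by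
    intro v hv
    rw [hW] at hv ⊢
    have h1 := congrArg (· *ᵥ v) h
    simp only [sub_mulVec, ← mulVec_mulVec, hv, smul_mulVec, mulVec_smul, smul_smul] at h1
    rw [mul_comm, hb, zero_smul, sub_eq_zero] at h1
    rw [toLin'_apply, h1]
  have : Nontrivial W := ⟨⟨w, (hW w).2 hw⟩, 0, fun h => hw0 (congrArg Subtype.val h)⟩
  obtain ⟨a, ha⟩ := Module.End.exists_eigenvalue ((toLin' A).restrict hA)
  obtain ⟨v, hv⟩ := ha.exists_hasEigenvector
  refine ⟨v, fun h => hv.2 (Subtype.ext h), a, b, ?_, (hW _).1 v.2⟩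
  simpa using congrArg Subtype.val hv.apply_eq_smul

lemma exists_common_eigenvector [IsAlgClosed k] [CharZero k]
    {A B : Matrix (Fin 3) (Fin 3) k} {α β : k} (h : A * B - B * A = α • A + β • B) :
    ∃ v ≠ 0, ∃ a b : k, A *ᵥ v = a • v ∧ B *ᵥ v = b • v := by
  by_cases hβ : β = 0
  · subst hβ
    obtain ⟨v, h0, b, a, hb, ha⟩ := exists_common_eigenvector_of_lie_eq_smul (A := B) (B := A)
      (γ := -α) (by rw [neg_smul, ← neg_sub, h]; simp)
    exact ⟨v, h0, a, b, ha, hb⟩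
  · obtain ⟨v, h0, a, b, ha, hb⟩ := exists_common_eigenvector_of_lie_eq_smul (A := A)
      (B := α • A + β • B) (γ := β) (by
        rw [← h, h, ← h, smul_sub, h, mul_add, add_mul]
        simp only [mul_smul_comm, smul_mul_assoc]
        abel)
    refine ⟨v, h0, a, β⁻¹ * (b - α * a), ha, ?_⟩
    rw [add_mulVec, smul_mulVec, smul_mulVec, ha] at hb
    rw [mul_smul, sub_smul, ← hb, mul_smul, add_sub_cancel_left, smul_smul, inv_mul_cancel₀ hβ,
      one_smul]

lemma lin_injective : Function.Injective (lin (k := k)) := by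
  intro A B h
  ext i j
  have h1 := congrArg (coeff (Finsupp.single j 1)) (congrFun h i)
  simpa [lin, coeff_sum, coeff_C_mul, coeff_X, Finsupp.single_left_inj] using h1

lemma lin_add (A B : Matrix (Fin 3) (Fin 3) k) : lin (A + B) = lin A + lin B := by
  funext i; simp [lin, add_mul, Finset.sum_add_distrib]

lemma lin_smul (a : k) (A : Matrix (Fin 3) (Fin 3) k) : lin (a • A) = C (σ := Fin 3) a • lin A := by
  funext i; simp [lin, mul_assoc, Finset.mul_sum]

lemma lin_sub (A B : Matrix (Fin 3) (Fin 3) k) : lin (A - B) = lin A - lin B := by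
  funext i; simp [lin, sub_mul, Finset.sum_sub_distrib]

lemma der_lin_lin (A B : Matrix (Fin 3) (Fin 3) k) (i : Fin 3) :
    der (lin A) (lin B i) = lin (B * A) i := by
  simp only [lin, map_sum, Derivation.leibniz, der_C, der_X, smul_eq_mul, mul_zero, add_zero,
    Matrix.mul_apply, map_sum, map_mul, Finset.sum_mul, Finset.mul_sum]
  rw [Finset.sum_comm]
  simp only [mul_assoc]

lemma der_lin_commutator (A B : Matrix (Fin 3) (Fin 3) k) (p : MvPolynomial (Fin 3) k) :
    der (lin (A * B - B * A)) p = der (lin B) (der (lin A) p) - der (lin A) (der (lin B) p) := by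
  have : der (lin (A * B - B * A)) = ⁅der (lin B), der (lin A)⁆ := by
    refine MvPolynomial.derivation_ext fun i => ?_
    rw [Derivation.commutator_apply, der_X, der_X, der_X, der_lin_lin, der_lin_lin, lin_sub]; rfl
  rw [this, Derivation.commutator_apply]

lemma dot_eq_of_der_eq_zero {u w g X : Fin 3 → MvPolynomial (Fin 3) k} (hu : ∑ i, g i * u i = 0)
    (hw : ∑ i, g i * w i = 0) (i : Fin 3) :
    (of ![X, u, w]).det * g i = (u ⨯₃ w) i * ∑ i, X i * g i := by
  simp only [det_fin_three, of_apply, Matrix.cons_val, cross_apply, Fin.sum_univ_three] at *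
  fin_cases i <;> simp
  · linear_combination (w 1 * X 2 - w 2 * X 1) * hu + (X 1 * u 2 - X 2 * u 1) * hw
  · linear_combination (w 2 * X 0 - w 0 * X 2) * hu + (X 2 * u 0 - X 0 * u 2) * hw
  · linear_combination (w 0 * X 1 - w 1 * X 0) * hu + (X 0 * u 1 - X 1 * u 0) * hw

lemma isHomogeneous_det_lin (A B : Matrix (Fin 3) (Fin 3) k) :
    (of ![X, lin A, lin B]).det.IsHomogeneous 3 := by
  have hX := isHomogeneous_X (σ := Fin 3) k
  have hA := isHomogeneous_lin A
  have hB := isHomogeneous_lin B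
  simp only [det_fin_three, of_apply, Matrix.cons_val]
  have h : ∀ a b c : Fin 3, (X a * lin A b * lin B c : MvPolynomial (Fin 3) k).IsHomogeneous 3 :=
    fun a b c => ((hX a).mul (hA b)).mul (hB c)
  exact (((((h _ _ _).sub (h _ _ _)).sub (h _ _ _)).add (h _ _ _)).add (h _ _ _)).sub (h _ _ _)

lemma exists_det_eq_of_prime [CharZero k] {P : MvPolynomial (Fin 3) k} (hP : Prime P)
    (h3 : P.IsHomogeneous 3) {A B : Matrix (Fin 3) (Fin 3) k} (hA : der (lin A) P = 0)
    (hB : der (lin B) P = 0) : ∃ τ : k, (of ![X, lin A, lin B]).det = C τ * P := by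
  obtain ⟨i, hi⟩ := exists_not_dvd_pderiv hP h3
  have h1 := dot_eq_of_der_eq_zero (X := X) ((der_apply _ _).symm.trans hA)
    ((der_apply _ _).symm.trans hB) i
  rw [h3.sum_X_mul_pderiv, nsmul_eq_mul] at h1
  have h2 : P ∣ (of ![X, lin A, lin B]).det :=
    (hP.dvd_or_dvd ⟨(lin A ⨯₃ lin B) i * 3, by rw [h1]; push_cast; ring⟩).resolve_right hi
  by_cases h0 : (of ![X, lin A, lin B]).det = 0
  · exact ⟨0, by rw [h0]; simp⟩
  obtain ⟨u, hu⟩ := h2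
  have h4 := totalDegree_mul_of_isDomain (left_ne_zero_of_mul (hu ▸ h0))
    (right_ne_zero_of_mul (hu ▸ h0))
  rw [← hu, (isHomogeneous_det_lin A B).totalDegree h0, h3.totalDegree hP.ne_zero] at h4
  have h5 : u.totalDegree = 0 := by omega
  rw [totalDegree_eq_zero_iff_eq_C] at h5
  exact ⟨_, by rw [← h5, hu, mul_comm]⟩

/-- No endomorphism of degree at least two totally preserves an irreducible cubic. -/
theorem CubicData.false_of_prime [IsAlgClosed k] [CharZero k] {F : Fin 3 → MvPolynomial (Fin 3) k}
    {D r : ℕ} {p : Fin r → MvPolynomial (Fin 3) k} {c : Fin r → k} (S : CubicData F D p c)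
    (B : FreeBasis F D) (hP : Prime (∏ i, p i)) : False := by
  obtain ⟨A, A', hA, hA', hT⟩ := S.exists_linear_fields B
  have h3 := S.isHomogeneous_prod
  set P := ∏ i, p i
  obtain ⟨τ, hτ⟩ := exists_det_eq_of_prime hP h3 hA hA'
  have hτ0 : τ ≠ 0 := by rintro rfl; exact hT (by rw [hτ]; simp)
  have hC : der (lin (A * A' - A' * A)) P = 0 := by
    rw [der_lin_commutator, hA, hA', map_zero, map_zero, sub_zero]
  set E := A * A' - A' * A with hE
  obtain ⟨α, hα⟩ := exists_det_eq_of_prime hP h3 hC hA'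
  obtain ⟨β, hβ⟩ := exists_det_eq_of_prime hP h3 hA hC
  have h0 : (of ![lin E, lin A, lin A']).det = 0 := by
    have h1 := fun i => dot_eq_of_der_eq_zero (X := lin E) ((der_apply _ _).symm.trans hA)
      ((der_apply _ _).symm.trans hA') i
    obtain ⟨i, hi⟩ := exists_not_dvd_pderiv hP h3
    have h2 : ∑ i, lin E i * pderiv i P = 0 := by
      rw [← hC, der_apply]
      exact Finset.sum_congr rfl fun i _ => mul_comm _ _
    refine (mul_eq_zero.1 ((h1 i).trans (by rw [h2, mul_zero]))).resolve_right fun h => hi ?_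
    rw [h]; exact dvd_zero _
  have h1 : C (σ := Fin 3) τ • lin E = C (σ := Fin 3) α • lin A + C (σ := Fin 3) β • lin A' := by
    have h4 : (of ![X, lin A, lin A']).det • lin E = (of ![X, lin E, lin A']).det • lin A
        + (of ![X, lin A, lin E]).det • lin A' := by
      have h5 : (of ![X, lin A, lin A']).det • lin E = (of ![lin E, lin A, lin A']).det • X +
          (of ![X, lin E, lin A']).det • lin A + (of ![X, lin A, lin E]).det • lin A' := by
        funext i
        simp only [det_fin_three, of_apply, Matrix.cons_val, Pi.smul_apply, Pi.add_apply,
          smul_eq_mul]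
        fin_cases i <;> simp only [Fin.zero_eta, Fin.mk_one, Fin.reduceFinMk] <;> ring
      rw [h5, h0, zero_smul, zero_add]
    rw [hτ, hα, hβ] at h4
    funext i
    have h6 := congrFun h4 i
    simp only [Pi.smul_apply, Pi.add_apply, smul_eq_mul] at h6 ⊢
    refine mul_right_cancel₀ hP.ne_zero ?_
    linear_combination h6
  have h2 : τ • E = α • A + β • A' := lin_injective (by
    rw [lin_add, lin_smul, lin_smul, lin_smul, h1])
  have h4 : Aᵀ * A'ᵀ - A'ᵀ * Aᵀ = (-(τ⁻¹ * α)) • Aᵀ + (-(τ⁻¹ * β)) • A'ᵀ := by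
    rw [← transpose_mul, ← transpose_mul, ← transpose_sub, ← neg_sub, ← hE,
      show E = τ⁻¹ • (α • A + β • A') by rw [← h2, smul_smul, inv_mul_cancel₀ hτ0, one_smul]]
    simp only [transpose_neg, transpose_smul, transpose_add, neg_smul, smul_add, smul_smul]
    abel
  obtain ⟨ℓ, hℓ, a, a', ha, ha'⟩ := exists_common_eigenvector h4
  rw [mulVec_transpose] at ha ha'
  have key : ∀ (M : Matrix (Fin 3) (Fin 3) k) (a : k), ℓ ᵥ* M = a • ℓ →
      ∑ i, C (ℓ i) * lin M i = C a * ∑ i, C (ℓ i) * X i := by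
    intro M a h
    simp only [lin, Finset.mul_sum]
    rw [Finset.sum_comm]
    refine Finset.sum_congr rfl fun j _ => ?_
    have := congrArg (C (σ := Fin 3)) (congrFun h j)
    simp only [vecMul, dotProduct, Pi.smul_apply, smul_eq_mul, map_sum, map_mul] at this
    rw [← mul_assoc, ← this, Finset.sum_mul]
    exact Finset.sum_congr rfl fun i _ => (mul_assoc _ _ _).symm
  obtain ⟨i, hi⟩ := Function.ne_iff.1 hℓ
  have h5 : (∑ i, C (ℓ i) * X i : MvPolynomial (Fin 3) k) ∣
      C (ℓ i) * (of ![X, lin A, lin A'])ᵀ.det := by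
    refine dvd_mul_det _ (fun i => C (ℓ i)) (fun b => ?_) i
    fin_cases b
    · exact dvd_of_eq rfl
    · exact ⟨_, (key A a ha).trans (mul_comm _ _)⟩
    · exact ⟨_, (key A' a' ha').trans (mul_comm _ _)⟩
  rw [det_transpose, hτ, ← mul_assoc, ← map_mul,
    IsUnit.dvd_mul_left (isUnit_iff_exists_C.2 ⟨_, mul_ne_zero hi hτ0, rfl⟩)] at h5
  have h6 : (∑ i, C (ℓ i) * X i : MvPolynomial (Fin 3) k).IsHomogeneous 1 :=
    isHomogeneous_lin (of fun _ => ℓ) 0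
  have h7 : (∑ i, C (ℓ i) * X i : MvPolynomial (Fin 3) k) ≠ 0 :=
      ne_zero_of_dvd_ne_zero hP.ne_zero h5
  obtain ⟨u, hu⟩ := h5
  rcases hP.irreducible.isUnit_or_isUnit hu with h | h <;>
  · obtain ⟨b, hb, hb'⟩ := isUnit_iff_exists_C.1 h
    have d1 := h6.totalDegree h7
    have d2 := h3.totalDegree hP.ne_zero
    first
    | rw [hb', totalDegree_C] at d1; omega
    | rw [hu, totalDegree_mul_of_isDomain h7 (by rw [hb']; exact (C_ne_zero).2 hb), hb',
        totalDegree_C] at d2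
      omega

end
section
variable {k : Type*} [Field k]

lemma exists_gram {q : MvPolynomial (Fin 3) k} (hq : q.IsHomogeneous 2) :
    ∃ H : Matrix (Fin 3) (Fin 3) k, Hᵀ = H ∧ (∀ j, pderiv j q = lin H j) ∧
      ∀ v, 2 * eval v q = v ⬝ᵥ H *ᵥ v := by
  choose b hb using fun j => exists_eq_sum_of_isHomogeneous_one (hq.pderiv (i := j))
  have h1 : ∀ j, pderiv j q = lin (of b) j := hb
  refine ⟨of b, ?_, h1, fun v => ?_⟩
  · have h2 : ∀ i j, pderiv i (pderiv j q) = C (b j i) := fun i j => by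
      rw [hb j, map_sum, Finset.sum_eq_single i]
      · simp [Derivation.leibniz]
      · intro l _ hl
        simp [Derivation.leibniz, pderiv_X, hl]
      · simp
    ext i j
    have h3 : pderiv i (pderiv j q) = pderiv j (pderiv i q) := by
      have : ⁅(pderiv i : Derivation k (MvPolynomial (Fin 3) k) _), pderiv j⁆ = 0 :=
        MvPolynomial.derivation_ext fun l => by
          rw [Derivation.commutator_apply, pderiv_X, pderiv_X]
          by_cases h : j = l <;> by_cases h' : i = l <;> simp [h, h']
      have h4 := DFunLike.congr_fun this q
      rwa [Derivation.commutator_apply, Derivation.coe_zero, Pi.zero_apply, sub_eq_zero] at h4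
    rw [h2, h2] at h3
    exact C_injective _ _ h3
  · have h2 := congrArg (eval v) hq.sum_X_mul_pderiv
    simp only [h1, lin, map_sum, map_mul, eval_X, eval_C, nsmul_eq_mul, Nat.cast_ofNat, map_ofNat]
        at h2
    rw [← h2]
    simp [dotProduct, mulVec]

lemma isHomogeneous_C_sum (b : Fin 3 → k) :
    (∑ j, C (b j) * X j : MvPolynomial (Fin 3) k).IsHomogeneous 1 :=
  isHomogeneous_lin (of fun _ => b) 0

lemma eval_C_sum (b v : Fin 3 → k) :
    eval v (∑ j, C (b j) * X j : MvPolynomial (Fin 3) k) = b ⬝ᵥ v := by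
  simp [dotProduct]

lemma C_sum_ne_zero {b : Fin 3 → k} (hb : b ≠ 0) :
    (∑ j, C (b j) * X j : MvPolynomial (Fin 3) k) ≠ 0 := by
  intro h
  refine hb (funext fun i => ?_)
  have h1 := congrArg (eval (Pi.single i 1)) h
  rwa [eval_C_sum, dotProduct_single_one, map_zero] at h1

lemma prime_of_isHomogeneous_one {p : MvPolynomial (Fin 3) k} (hp : p.IsHomogeneous 1)
    (h0 : p ≠ 0) : Prime p := by
  rw [← irreducible_iff_prime]
  refine ⟨fun h => ?_, fun {a b} hab => ?_⟩
  · obtain ⟨c, hc, h⟩ := isUnit_iff_exists_C.1 h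
    have := hp.totalDegree h0
    rw [h, totalDegree_C] at this
    omega
  · have ha : a ≠ 0 := by rintro rfl; simp_all
    have hb : b ≠ 0 := by rintro rfl; simp_all
    have h1 := totalDegree_mul_of_isDomain ha hb
    rw [← hab, hp.totalDegree h0] at h1
    have : a.totalDegree = 0 ∨ b.totalDegree = 0 := by omega
    rcases this with h | h
    · exact Or.inl (isUnit_iff_exists_C.2 ⟨_, fun hc => ha (by
        rw [totalDegree_eq_zero_iff_eq_C.1 h, hc, map_zero]), totalDegree_eq_zero_iff_eq_C.1 h⟩)
    · exact Or.inr (isUnit_iff_exists_C.2 ⟨_, fun hc => hb (by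
        rw [totalDegree_eq_zero_iff_eq_C.1 h, hc, map_zero]), totalDegree_eq_zero_iff_eq_C.1 h⟩)

/-- Associated homogeneous polynomials have the same degree. -/
lemma eq_of_prime_dvd_prime {p q : MvPolynomial (Fin 3) k} (hp : Prime p) (hq : Prime q) {m n : ℕ}
    (hpm : p.IsHomogeneous m) (hqn : q.IsHomogeneous n) (h : p ∣ q) : m = n := by
  obtain ⟨u, hu⟩ := h
  have hu' : IsUnit u := (hq.irreducible.isUnit_or_isUnit hu).resolve_left hp.not_isUnit
  obtain ⟨c, hc, rfl⟩ := isUnit_iff_exists_C.1 hu'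
  have h1 := totalDegree_mul_of_isDomain hp.ne_zero hu'.ne_zero
  rw [← hu, totalDegree_C, hpm.totalDegree hp.ne_zero, hqn.totalDegree hq.ne_zero] at h1
  omega

lemma eval_smul_add_smul {q : MvPolynomial (Fin 3) k} [CharZero k]
    {H : Matrix (Fin 3) (Fin 3) k} (hH : Hᵀ = H) (hv : ∀ v, 2 * eval v q = v ⬝ᵥ H *ᵥ v)
    (a b : k) (u v : Fin 3 → k) :
    eval (a • u + b • v) q = a ^ 2 * eval u q + b ^ 2 * eval v q + a * b * (u ⬝ᵥ H *ᵥ v) := by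
  have h2 : (2 : k) ≠ 0 := two_ne_zero
  have h3 : v ⬝ᵥ H *ᵥ u = u ⬝ᵥ H *ᵥ v := by
    rw [dotProduct_mulVec, ← mulVec_transpose, hH, dotProduct_comm]
  refine mul_left_cancel₀ h2 ?_
  rw [hv]
  simp only [mulVec_add, mulVec_smul, dotProduct_add, add_dotProduct, dotProduct_smul,
    smul_dotProduct, smul_eq_mul, h3]
  linear_combination -a ^ 2 * hv u - b ^ 2 * hv v

/-- An irreducible conic contains no line. -/
lemma false_of_eval_span_eq_zero [IsAlgClosed k] {q : MvPolynomial (Fin 3) k} (hq : Prime q)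
    (hq2 : q.IsHomogeneous 2) {w u : Fin 3 → k} (hwu : w ⨯₃ u ≠ 0)
    (h : ∀ a b : k, eval (a • w + b • u) q = 0) : False := by
  have hp := prime_of_isHomogeneous_one (isHomogeneous_C_sum (w ⨯₃ u)) (C_sum_ne_zero hwu)
  have h1 : (∑ j, C ((w ⨯₃ u) j) * X j) ∣ q := by
    refine dvd_of_forall_eval_eq_zero hp fun v hv => ?_
    rw [eval_C_sum] at hv
    obtain ⟨i, hi⟩ := Function.ne_iff.1 hwu
    simp only [Pi.zero_apply] at hi
    have h2 : ∃ a b : k, (w ⨯₃ u) i • v = a • w + b • u := by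
      simp only [cross_apply, dotProduct, Fin.sum_univ_three, Matrix.cons_val] at hv hi ⊢
      fin_cases i <;> simp only [Fin.zero_eta, Fin.mk_one, Fin.reduceFinMk, Matrix.cons_val] at hi ⊢
      · refine ⟨v 1 * u 2 - v 2 * u 1, w 1 * v 2 - w 2 * v 1, funext fun j => ?_⟩
        fin_cases j <;> simp
        · linear_combination hv
        · ring
        · ring
      · refine ⟨v 2 * u 0 - v 0 * u 2, w 2 * v 0 - w 0 * v 2, funext fun j => ?_⟩
        fin_cases j <;> simp
        · ring
        · linear_combination hv
        · ring
      · refine ⟨v 0 * u 1 - v 1 * u 0, w 0 * v 1 - w 1 * v 0, funext fun j => ?_⟩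
        fin_cases j <;> simp
        · ring
        · ring
        · linear_combination hv
    obtain ⟨a, b, hab⟩ := h2
    have h3 := h a b
    rw [← hab, eval_smul_of_isHomogeneous hq2] at h3
    exact (mul_eq_zero.1 h3).resolve_left (pow_ne_zero _ hi)
  have := eq_of_prime_dvd_prime hp hq (isHomogeneous_C_sum _) hq2 h1
  omega

lemma exists_mul_add_eq_zero [IsAlgClosed k] [CharZero k] (a b c : k) :
    ∃ s t : k, (s ≠ 0 ∨ t ≠ 0) ∧ s ^ 2 * a + t ^ 2 * c + s * t * b = 0 := by
  by_cases ha : a = 0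
  · exact ⟨1, 0, Or.inl one_ne_zero, by rw [ha]; ring⟩
  · obtain ⟨d, hd⟩ := IsAlgClosed.exists_eq_mul_self (discrim a b c)
    refine ⟨(-b + d) / (2 * a), 1, Or.inr one_ne_zero, ?_⟩
    have := (quadratic_eq_zero_iff ha hd ((-b + d) / (2 * a))).2 (Or.inl rfl)
    linear_combination this

lemma det_gram_ne_zero [IsAlgClosed k] [CharZero k] {q : MvPolynomial (Fin 3) k} (hq : Prime q)
    (hq2 : q.IsHomogeneous 2) {H : Matrix (Fin 3) (Fin 3) k} (hH : Hᵀ = H)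
    (hv : ∀ v, 2 * eval v q = v ⬝ᵥ H *ᵥ v) : H.det ≠ 0 := by
  intro h0
  obtain ⟨w, hw, hw0⟩ := exists_mulVec_eq_zero_iff.2 h0
  have hqw : eval w q = 0 := by
    have := hv w
    rw [hw0, dotProduct_zero] at this
    exact (mul_eq_zero.1 this).resolve_left two_ne_zero
  have key : ∀ u, eval u q = 0 → w ⨯₃ u ≠ 0 → False := fun u hu hwu =>
    false_of_eval_span_eq_zero hq hq2 hwu fun a b => by
      have h3 : w ⬝ᵥ H *ᵥ u = 0 := by
        rw [dotProduct_mulVec, ← mulVec_transpose, hH, hw0, zero_dotProduct]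
      rw [eval_smul_add_smul hH hv, hqw, hu, h3]; ring
  obtain ⟨i, hi⟩ := Function.ne_iff.1 hw
  simp only [Pi.zero_apply] at hi
  obtain ⟨s, t, hst, h⟩ := exists_mul_add_eq_zero
    (eval (Pi.single (i + 1) 1) q) (Pi.single (i + 1) 1 ⬝ᵥ H *ᵥ (Pi.single (i + 2) 1))
    (eval (Pi.single (i + 2) 1) q)
  rw [← eval_smul_add_smul hH hv] at h
  refine key _ h fun h1 => ?_
  have hs : s = 0 := by
    have := congrFun h1 (i + 2)
    fin_cases i <;> simp only [Fin.zero_eta, Fin.mk_one, Fin.reduceFinMk] at hi <;>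
      simpa [cross_apply, hi, Pi.single_apply] using this
  have ht : t = 0 := by
    have := congrFun h1 (i + 1)
    fin_cases i <;> simp only [Fin.zero_eta, Fin.mk_one, Fin.reduceFinMk] at hi <;>
      simpa [cross_apply, hi, Pi.single_apply] using this
  tauto

/-- A linear vector field scaling an irreducible conic by `s` has trace `3 * s / 2`. -/
lemma two_mul_trace_of_der_eq [IsAlgClosed k] [CharZero k] {q : MvPolynomial (Fin 3) k}
    (hq : Prime q) (hq2 : q.IsHomogeneous 2) {A : Matrix (Fin 3) (Fin 3) k} {s : k}
    (h : der (lin A) q = C s * q) : 2 * A.trace = 3 * s := by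
  obtain ⟨H, hH, hd, hv⟩ := exists_gram hq2
  have h1 : H * A + Aᵀ * H = s • H := by
    apply lin_injective
    rw [lin_smul, lin_add]
    funext n
    have h2 := congrArg (pderiv n) h
    have h3 : pderiv n (der (lin A) q) = der (lin A) (pderiv n q) + ∑ j,
        C (A j n) * pderiv j q := by
      have h4 : ⁅(pderiv n : Derivation k (MvPolynomial (Fin 3) k) _), der (lin A)⁆ =
          der (fun j => C (A j n)) := by
        refine MvPolynomial.derivation_ext fun l => ?_
        rw [Derivation.commutator_apply, der_X, der_X]
        have h5 : der (lin A) (pderiv n (X l : MvPolynomial (Fin 3) k)) = 0 := by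
          rw [pderiv_X]
          by_cases hl : n = l <;> simp [hl]
        rw [h5, sub_zero, lin, map_sum, Finset.sum_eq_single n]
        · simp [Derivation.leibniz]
        · intro m _ hm
          simp [Derivation.leibniz, pderiv_X, hm]
        · simp
      have h6 := DFunLike.congr_fun h4 q
      rw [Derivation.commutator_apply, der_apply (fun j => C (A j n)) q] at h6
      rw [sub_eq_iff_eq_add'.1 h6]
      simp only [mul_comm]
    rw [h3, hd, der_lin_lin] at h2
    simp only [Pi.add_apply, Pi.smul_apply, smul_eq_mul]
    rw [Derivation.leibniz, pderiv_C, smul_zero, add_zero, smul_eq_mul, hd] at h2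
    rw [← h2]
    congr 1
    simp only [hd, lin, Matrix.mul_apply, transpose_apply, map_sum, map_mul, Finset.sum_mul,
      Finset.mul_sum]
    rw [Finset.sum_comm]
    simp only [mul_assoc]
  have hdet : IsUnit H.det := isUnit_iff_ne_zero.2 (det_gram_ne_zero hq hq2 hH hv)
  have h2 := congrArg (fun N => trace (H⁻¹ * N)) h1
  simp only [mul_add, trace_add, mul_smul_comm, trace_smul, nonsing_inv_mul _ hdet, trace_one,
    ← mul_assoc, one_mul, smul_eq_mul] at h2
  rw [trace_mul_comm, ← mul_assoc, mul_nonsing_inv _ hdet, one_mul, trace_transpose] at h2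
  simp at h2
  linear_combination h2

end
section
variable {k : Type*} [Field k]

lemma der_det_of_apply_eq {J : Matrix (Fin 3) (Fin 3) (MvPolynomial (Fin 3) k)}
    {A B : Matrix (Fin 3) (Fin 3) (MvPolynomial (Fin 3) k)}
    {μ : Fin 3 → MvPolynomial (Fin 3) k} (h : ∀ i j, der μ (J i j) = (A * J - J * B) i j) :
    der μ J.det = J.det * (A.trace - B.trace) := by
  simp only [Matrix.sub_apply, Matrix.mul_apply, Fin.sum_univ_three] at h
  simp only [det_fin_three, trace_fin_three, map_sub, map_add, Derivation.leibniz, smul_eq_mul, h]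
  ring

namespace CubicData
variable {F : Fin 3 → MvPolynomial (Fin 3) k} {D r : ℕ}
    {p : Fin r → MvPolynomial (Fin 3) k} {c : Fin r → k} (S : CubicData F D p c)
include S

lemma trace_eq_of_lift [CharZero k] (B : FreeBasis F D) {A A' : Matrix (Fin 3) (Fin 3) k}
    (hA' : der (lin A') (∏ i, p i) = 0) (h : jac F *ᵥ lin A' = fun i => bind₁ F (lin A i)) :
    A.trace = A'.trace := by
  have h1 : ∀ i j, der (lin A') (jac F i j) =
      (A.map (C (σ := Fin 3)) * jac F - jac F * A'.map (C (σ := Fin 3))) i j := by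
    intro i j
    have h2 := congrArg (pderiv j) (congrFun h i)
    have h3 : ∀ i, (jac F *ᵥ lin A') i = der (lin A') (F i) := fun i => (der_apply _ _).symm
    have h4 : ⁅(pderiv j : Derivation k (MvPolynomial (Fin 3) k) (MvPolynomial (Fin 3) k)),
        der (lin A')⁆ = der (fun l => C (A' l j)) := by
      refine MvPolynomial.derivation_ext fun l => ?_
      rw [Derivation.commutator_apply, der_X, der_X]
      have h5 : der (lin A') (pderiv j (X l : MvPolynomial (Fin 3) k)) = 0 := by
        rw [pderiv_X]
        by_cases hl : j = l <;> simp [hl]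
      rw [h5, sub_zero, lin, map_sum, Finset.sum_eq_single j]
      · simp [Derivation.leibniz]
      · intro m _ hm
        simp [Derivation.leibniz, pderiv_X, hm]
      · simp
    have h6 := DFunLike.congr_fun h4 (F i)
    rw [Derivation.commutator_apply, ← h3, h2] at h6
    have h7 : pderiv j (bind₁ F (lin A i)) = (A.map (C (σ := Fin 3)) * jac F) i j := by
      simp [lin, Matrix.mul_apply, Derivation.leibniz]
    have h8 : der (fun l => C (A' l j)) (F i) = (jac F * A'.map (C (σ := Fin 3))) i j := by
      simp [der_apply, Matrix.mul_apply]
    rw [h7, h8] at h6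
    rw [jac_apply, Matrix.sub_apply, ← h6, sub_sub_cancel]
  have h2 := der_det_of_apply_eq h1
  obtain ⟨c', hc', hJ⟩ := S.jdet_eq B
  have h3 : der (lin A') (jdet F) = 0 := by
    rw [hJ, Derivation.leibniz, Derivation.leibniz_pow, hA', der_C]; simp
  rw [show (jac F).det = jdet F from rfl, h3] at h2
  have h4 := (mul_eq_zero.1 h2.symm).resolve_left B.jdet_ne_zero
  rw [sub_eq_zero, trace_fin_three, trace_fin_three] at h4
  simp only [map_apply, ← map_add] at h4
  rw [trace_fin_three, trace_fin_three]
  exact C_injective _ _ h4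

/-- No endomorphism of degree at least two totally preserves a line and a conic. -/
theorem false_of_line_conic [IsAlgClosed k] [CharZero k] (B : FreeBasis F D) {i j : Fin r}
    (hij : ∏ i, p i = p i * p j) (hi : (p i).totalDegree = 1) (hj : (p j).totalDegree = 2) :
    False := by
  have hℓ := S.prime i
  have hq := S.prime j
  have hℓ1 := S.hom i
  have hq2 := S.hom j
  rw [hi] at hℓ1
  rw [hj] at hq2
  have hℓq : ¬ p i ∣ p j := fun h => by
    have := eq_of_prime_dvd_prime hℓ hq hℓ1 hq2 h
    omega
  have weight : ∀ A, der (lin A) (∏ i, p i) = 0 →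
      ∃ a : k, der (lin A) (p i) = C a * p i ∧ der (lin A) (p j) = C (-a) * p j := by
    intro A hA
    obtain ⟨u, hu⟩ := S.dvd_der hA i
    have h1 : (der (lin A) (p i)).IsHomogeneous 1 := by
      rw [der_apply]
      refine IsHomogeneous.sum _ _ _ fun l _ => ?_
      simpa using (hℓ1.pderiv (i := l)).mul (isHomogeneous_lin A l)
    have h2 : u.totalDegree = 0 := by
      by_cases hu0 : u = 0
      · rw [hu0, totalDegree_zero]
      have h3 := totalDegree_mul_of_isDomain hℓ.ne_zero hu0
      rw [← hu, hi] at h3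
      have := h1.totalDegree_le
      omega
    rw [totalDegree_eq_zero_iff_eq_C] at h2
    have h4 : der (lin A) (p i) = C (coeff 0 u) * p i := by rw [hu, ← h2, mul_comm]
    refine ⟨_, h4, mul_left_cancel₀ hℓ.ne_zero ?_⟩
    rw [hij, Derivation.leibniz, h4, smul_eq_mul, smul_eq_mul] at hA
    rw [map_neg]
    linear_combination hA
  obtain ⟨A, hA, a, ha0, ha⟩ : ∃ A, der (lin A) (∏ i, p i) = 0 ∧ ∃ a : k, a ≠ 0 ∧
      der (lin A) (p i) = C a * p i ∧ der (lin A) (p j) = C (-a) * p j := by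
    obtain ⟨A, A', hA, hA', hdet⟩ := S.exists_linear_fields B
    obtain ⟨a, ha⟩ := weight A hA
    obtain ⟨a', ha'⟩ := weight A' hA'
    by_cases h0 : a = 0
    · by_cases h0' : a' = 0
      · exfalso
        subst h0 h0'
        simp only [neg_zero, map_zero, zero_mul] at ha ha'
        have h1 : (of ![X, lin A, lin A']) *ᵥ
            (fun l => 2 * p j * pderiv l (p i) - p i * pderiv l (p j)) = 0 := by
          have e1 := hℓ1.sum_X_mul_pderiv
          have e2 := hq2.sum_X_mul_pderiv
          obtain ⟨e3, e4⟩ := ha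
          obtain ⟨e5, e6⟩ := ha'
          simp only [der_apply, Fin.sum_univ_three, nsmul_eq_mul] at e1 e2 e3 e4 e5 e6
          push_cast at e1 e2
          funext l
          fin_cases l <;> simp [mulVec, dotProduct, Fin.sum_univ_three]
          · linear_combination 2 * p j * e1 - p i * e2
          · linear_combination 2 * p j * e3 - p i * e4
          · linear_combination 2 * p j * e5 - p i * e6
        have h2 := eq_zero_of_mulVec_eq_zero hdet h1
        obtain ⟨l, hl⟩ := exists_not_dvd_pderiv hℓ hℓ1
        have h3 := congrFun h2 l
        rw [Pi.zero_apply, sub_eq_zero] at h3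
        have h4 : p i ∣ C 2 * (p j * pderiv l (p i)) := ⟨pderiv l (p j), by
          rw [← h3, map_ofNat]; ring⟩
        rw [IsUnit.dvd_mul_left (isUnit_iff_exists_C.2 ⟨2, two_ne_zero, rfl⟩)] at h4
        exact (hℓ.dvd_or_dvd h4).elim hℓq hl
      · exact ⟨A', hA', a', h0', ha'⟩
    · exact ⟨A, hA, a, h0, ha⟩
  obtain ⟨A', hA', hlift⟩ := S.exists_linear_lift B hA
  obtain ⟨a', ha'⟩ := weight A' hA'
  have t1 := two_mul_trace_of_der_eq hq hq2 ha.2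
  have t2 := two_mul_trace_of_der_eq hq hq2 ha'.2
  rw [S.trace_eq_of_lift B hA' hlift] at t1
  have haa : a = a' := by
    have : (3 : k) * (a - a') = 0 := by linear_combination t1 - t2
    exact sub_eq_zero.1 ((mul_eq_zero.1 this).resolve_left three_ne_zero)
  subst haa
  have h1 := der_bind₁ hlift (p i)
  have hD := S.two_le
  obtain ⟨D', rfl⟩ : ∃ D', D = D' + 1 := ⟨D - 1, by omega⟩
  rw [ha.1, map_mul, S.pullback, Derivation.leibniz, der_C, Derivation.leibniz_pow, ha'.1,
    bind₁_C_right] at h1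
  simp only [smul_eq_mul, nsmul_eq_mul, mul_zero, add_zero, Nat.add_sub_cancel] at h1
  have h2 : C (c i) * (C a * ((D' : MvPolynomial (Fin 3) k) * p i ^ (D' + 1))) = 0 := by
    push_cast at h1
    linear_combination h1
  rw [mul_eq_zero, mul_eq_zero, mul_eq_zero, C_eq_zero, C_eq_zero, Nat.cast_eq_zero] at h2
  have := pow_ne_zero (D' + 1) hℓ.ne_zero
  have := S.c_ne i
  have : D' ≠ 0 := by omega
  tauto

end CubicData
end
section
variable {k : Type*} [Field k]

lemma exists_eq_smul_of_cross_eq_zero {w n : Fin 3 → k} (hw : w ≠ 0)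
    (h : w ⨯₃ n = 0) : ∃ a : k, n = a • w := by
  obtain ⟨i, hi⟩ := Function.ne_iff.1 hw
  simp only [Pi.zero_apply] at hi
  have h0 := congrFun h 0
  have h1 := congrFun h 1
  have h2 := congrFun h 2
  simp only [cross_apply, Matrix.cons_val, Pi.zero_apply] at h0 h1 h2
  refine ⟨n i / w i, ?_⟩
  funext j
  simp only [Pi.smul_apply, smul_eq_mul]
  rw [div_mul_eq_mul_div, eq_div_iff hi]
  fin_cases i <;> fin_cases j <;> simp only [Fin.zero_eta, Fin.mk_one, Fin.reduceFinMk] <;>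
    grind

/-- The matrix with columns `a`, `b`, `c`. -/
def colMatrix (a b c : Fin 3 → k) : Matrix (Fin 3) (Fin 3) k := (of ![a, b, c])ᵀ

lemma colMatrix_mulVec (a b c v : Fin 3 → k) :
    colMatrix a b c *ᵥ v = v 0 • a + v 1 • b + v 2 • c := by
  funext i
  simp [colMatrix, mulVec, dotProduct, Fin.sum_univ_three]
  ring

lemma det_ne_zero_of_mulVec {M : Matrix (Fin 3) (Fin 3) k} (h : ∀ v, M *ᵥ v = 0 → v = 0) :
    M.det ≠ 0 := fun h0 => by
  obtain ⟨v, hv, hv'⟩ := exists_mulVec_eq_zero_iff.2 h0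
  exact hv (h v hv')

lemma exists_ne_zero_dotProduct_eq_zero (f g : Fin 3 → k) :
    ∃ n ≠ 0, f ⬝ᵥ n = 0 ∧ g ⬝ᵥ n = 0 := by
  obtain ⟨n, hn, h⟩ := exists_mulVec_eq_zero_iff.2
    (show (of ![f, g, 0]).det = 0 by simp [det_fin_three])
  exact ⟨n, hn, congrFun h 0, congrFun h 1⟩

/-- Coordinates in which a line is `z = 0` and a given point of it is `[0:1:0]`. -/
lemma exists_line_coordinates {p : MvPolynomial (Fin 3) k} (hp : p.IsHomogeneous 1) (h0 : p ≠ 0)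
    {w : Fin 3 → k} (hw : w ≠ 0) (hpw : eval w p = 0) :
    ∃ M : Matrix (Fin 3) (Fin 3) k, M.det ≠ 0 ∧ M *ᵥ ![0, 1, 0] = w ∧
      ∃ c ≠ 0, ∀ v, eval (M *ᵥ v) p = c * v 2 := by
  obtain ⟨b, rfl⟩ := exists_eq_sum_of_isHomogeneous_one hp
  simp only [eval_C_sum] at hpw ⊢
  have hb : b ≠ 0 := by rintro rfl; exact h0 (by simp)
  obtain ⟨i, hi⟩ := Function.ne_iff.1 hw
  obtain ⟨j, hj⟩ := Function.ne_iff.1 hb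
  simp only [Pi.zero_apply] at hi hj
  obtain ⟨n, hn, hn1, hn2⟩ := exists_ne_zero_dotProduct_eq_zero (Pi.single i 1) b
  rw [single_one_dotProduct] at hn1
  have key : ∀ v : Fin 3 → k, b ⬝ᵥ (colMatrix n w (Pi.single j 1) *ᵥ v) = b j * v 2 := fun v => by
    rw [colMatrix_mulVec, dotProduct_add, dotProduct_add, dotProduct_smul, dotProduct_smul,
      dotProduct_smul, hn2, hpw, dotProduct_single_one]
    simp [mul_comm]
  refine ⟨colMatrix n w (Pi.single j 1), det_ne_zero_of_mulVec fun v hv => ?_, ?_, b j, hj, key⟩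
  · have h2 : v 2 = 0 := by
      have := key v
      rw [hv, dotProduct_zero] at this
      exact (mul_eq_zero.1 this.symm).resolve_left hj
    rw [colMatrix_mulVec, h2, zero_smul, add_zero] at hv
    have h1 : v 1 = 0 := by
      have := congrFun hv i
      simpa [hn1, hi] using this
    rw [h1, zero_smul, add_zero] at hv
    have h3 := (smul_eq_zero.1 hv).resolve_right hn
    funext l
    fin_cases l <;> assumption
  · rw [colMatrix_mulVec]; simp

/-- Coordinates in which an irreducible conic is `y² = xz` and a given point of it is
`[1:0:0]`. -/
lemma exists_conic_coordinates [IsAlgClosed k] [CharZero k] {q : MvPolynomial (Fin 3) k}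
    (hq : Prime q) (hq2 : q.IsHomogeneous 2) {w : Fin 3 → k} (hw : w ≠ 0) (hqw : eval w q = 0) :
    ∃ M : Matrix (Fin 3) (Fin 3) k, M.det ≠ 0 ∧ M *ᵥ ![1, 0, 0] = w ∧
      ∃ c ≠ 0, ∀ v, eval (M *ᵥ v) q = c * (v 1 ^ 2 - v 0 * v 2) := by
  obtain ⟨H, hH, -, hv⟩ := exists_gram hq2
  have hdet := det_gram_ne_zero hq hq2 hH hv
  have hsymm : ∀ u v, u ⬝ᵥ H *ᵥ v = v ⬝ᵥ H *ᵥ u := fun u v => by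
    rw [dotProduct_mulVec, ← mulVec_transpose, hH, dotProduct_comm]
  have hHw : H *ᵥ w ≠ 0 := fun h => hw (eq_zero_of_mulVec_eq_zero hdet h)
  obtain ⟨i, hi⟩ := Function.ne_iff.1 hHw
  set v0 : Fin 3 → k := Pi.single i 1
  have hb : w ⬝ᵥ H *ᵥ v0 ≠ 0 := by
    rw [hsymm, single_one_dotProduct]; exact hi
  set b := w ⬝ᵥ H *ᵥ v0
  set u := (-(eval v0 q / b)) • w + (1 : k) • v0 with hu
  have hqu : eval u q = 0 := by
    rw [hu, eval_smul_add_smul hH hv, hqw]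
    field_simp
    ring
  have hww : w ⬝ᵥ H *ᵥ w = 0 := by rw [← hv, hqw, mul_zero]
  have huu : u ⬝ᵥ H *ᵥ u = 0 := by rw [← hv, hqu, mul_zero]
  have hwu : w ⬝ᵥ H *ᵥ u = b := by
    rw [hu, mulVec_add, mulVec_smul, mulVec_smul, dotProduct_add, dotProduct_smul,
      dotProduct_smul, hww]
    simp [b]
  obtain ⟨n, hn, hn1, hn2⟩ := exists_ne_zero_dotProduct_eq_zero (H *ᵥ w) (H *ᵥ u)
  rw [dotProduct_comm, hsymm] at hn1 hn2
  have hqn : eval n q ≠ 0 := fun h => by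
    refine false_of_eval_span_eq_zero hq hq2 (w := w) (u := n) (fun hx => ?_) fun s t => by
      rw [eval_smul_add_smul hH hv, hqw, h, hn1]; ring
    obtain ⟨a, ha⟩ := exists_eq_smul_of_cross_eq_zero hw hx
    rw [ha, mulVec_smul, dotProduct_smul, hsymm, hwu, smul_eq_mul] at hn2
    refine hn ?_
    rw [ha, (mul_eq_zero.1 hn2).resolve_right hb, zero_smul]
  have hr : eval n q / b ≠ 0 := div_ne_zero hqn hb
  have key : ∀ v : Fin 3 → k, eval (colMatrix w n ((-(eval n q / b)) • u) *ᵥ v) q =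
      eval n q * (v 1 ^ 2 - v 0 * v 2) := fun v => by
    rw [colMatrix_mulVec, show v 0 • w + v 1 • n + v 2 • (-(eval n q / b)) • u =
      (1 : k) • (v 0 • w + v 1 • n) + (v 2 * (-(eval n q / b))) • u by module]
    rw [eval_smul_add_smul hH hv, eval_smul_add_smul hH hv, hqw, hqu, hn1, add_dotProduct,
      smul_dotProduct, smul_dotProduct, hwu, hsymm n u, hn2]
    simp only [smul_eq_mul]
    field_simp
    ring
  refine ⟨colMatrix w n ((-(eval n q / b)) • u), det_ne_zero_of_mulVec fun v h => ?_, ?_,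
    eval n q, hqn, key⟩
  · rw [colMatrix_mulVec] at h
    have h2 : v 2 = 0 := by
      have := congrArg (fun x => w ⬝ᵥ H *ᵥ x) h
      simp only [mulVec_add, mulVec_smul, dotProduct_add, dotProduct_smul, hww, hn1, hwu,
        mulVec_zero, dotProduct_zero, smul_eq_mul] at this
      simpa [hb, hqn] using this
    have h3 : v 0 = 0 := by
      have := congrArg (fun x => u ⬝ᵥ H *ᵥ x) h
      simp only [mulVec_add, mulVec_smul, dotProduct_add, dotProduct_smul, huu, hn2,
        mulVec_zero, dotProduct_zero, smul_eq_mul, hsymm u w, hwu] at this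
      simpa [hb] using this
    rw [h2, h3, zero_smul, zero_smul, zero_add, add_zero] at h
    have h1 := (smul_eq_zero.1 h).resolve_right hn
    funext l
    fin_cases l <;> assumption
  · rw [colMatrix_mulVec]; simp

end
section
variable {k : Type*} [Field k]

namespace Conj
variable {d m m' : ℕ} {F G H H' : Fin 3 → MvPolynomial (Fin 3) k}
    {Q Q' : MvPolynomial (Fin 3) k} {c c' : k} (S : Conj d m m' F G H H' Q Q' c c')
include S

lemma bind_H'_bind_H {u : MvPolynomial (Fin 3) k} {n : ℕ} (hu : u.IsHomogeneous n) :
    bind₁ H' (bind₁ H u) = Q' ^ n * u := by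
  have h1 : bind₁ H' (bind₁ H u) = bind₁ (fun i => Q' * X i) u := by
    rw [bind₁_bind₁]
    congr 1
    congr 1
    funext i
    exact S.H_H' i
  rw [h1, bind₁_mul_of_isHomogeneous hu, bind₁_X_left]
  rfl

lemma eq_of_bind_H_eq {u v : MvPolynomial (Fin 3) k} {n : ℕ} (hu : u.IsHomogeneous n)
    (hv : v.IsHomogeneous n) (h : bind₁ H u = bind₁ H v) : u = v := by
  have h1 := congrArg (bind₁ H') h
  rw [S.bind_H'_bind_H hu, S.bind_H'_bind_H hv] at h1
  exact mul_left_cancel₀ (pow_ne_zero _ S.Q'_ne) h1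

variable {r r' : ℕ} {p : Fin r → MvPolynomial (Fin 3) k} {σ : Equiv.Perm (Fin r)} {e : Fin r → ℕ}
    {γ : Fin r → k} (D : PrimeData F d Q p σ γ e)
include D

lemma exists_jdet_eq [CharZero k] : ∃ (a : k) (n : Fin r → ℕ), a ≠ 0 ∧
    jdet H = C a * ∏ j, p j ^ n j ∧ 3 * (m - 1) = ∑ j, n j * (p j).totalDegree := by
  obtain ⟨a, n, ha, h⟩ := D.factor 3 _ S.jdet_dvd
  refine ⟨a, n, ha, h, ?_⟩
  have h2 := isHomogeneous_jdet S.H_hom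
  have h0 : (∏ j, p j ^ n j) ≠ 0 :=
    Finset.prod_ne_zero_iff.2 fun j _ => pow_ne_zero _ (D.prime j).ne_zero
  have hC : (C a : MvPolynomial (Fin 3) k) ≠ 0 := fun h => ha (C_eq_zero.1 h)
  rw [← totalDegree_prod_pow D.prime, ← h2.totalDegree S.jdet_ne_zero, h,
    totalDegree_mul_of_isDomain hC h0, totalDegree_C, zero_add]

variable {p' : Fin r' → MvPolynomial (Fin 3) k} {σ' : Equiv.Perm (Fin r')} {e' : Fin r' → ℕ}
    {γ' : Fin r' → k} (D' : PrimeData G d Q' p' σ' γ' e')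
include D'

lemma exists_bind_H_prime (i : Fin r') : ∃ (a : k) (n : Fin r → ℕ), a ≠ 0 ∧
    bind₁ H (p' i) = C a * ∏ j, p j ^ n j ∧
    m * (p' i).totalDegree = ∑ j, n j * (p j).totalDegree := by
  have h1 : bind₁ H (p' i) ∣ Q ^ m := by
    rw [← S.Q'_comp_H]
    obtain ⟨u, hu⟩ := D'.dvd i
    exact ⟨bind₁ H u, by rw [← map_mul, ← hu]⟩
  obtain ⟨a, n, ha, h⟩ := D.factor m _ h1
  refine ⟨a, n, ha, h, ?_⟩
  have h2 : (bind₁ H (p' i)).IsHomogeneous (m * (p' i).totalDegree) := (D'.hom i).aeval H S.H_hom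
  have h0 : (∏ j, p j ^ n j) ≠ 0 :=
    Finset.prod_ne_zero_iff.2 fun j _ => pow_ne_zero _ (D.prime j).ne_zero
  have hC : (C a : MvPolynomial (Fin 3) k) ≠ 0 := fun h => ha (C_eq_zero.1 h)
  rw [← totalDegree_prod_pow D.prime, ← h2.totalDegree (by rw [h]; exact mul_ne_zero hC h0), h,
    totalDegree_mul_of_isDomain hC h0, totalDegree_C, zero_add]

end Conj

namespace Conj
variable {d m m' : ℕ} {F G H H' : Fin 3 → MvPolynomial (Fin 3) k}
    {Q Q' : MvPolynomial (Fin 3) k} {c c' : k} (S : Conj d m m' F G H H' Q Q' c c')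
    {r : ℕ} {p : Fin 1 → MvPolynomial (Fin 3) k} {σ : Equiv.Perm (Fin 1)} {e : Fin 1 → ℕ}
    {γ : Fin 1 → k}
include S

lemma eq_one_of_eq_one {p' : Fin r → MvPolynomial (Fin 3) k} {σ' : Equiv.Perm (Fin r)}
    {e' : Fin r → ℕ} {γ' : Fin r → k}
    (D : PrimeData F d Q p σ γ e) (D' : PrimeData G d Q' p' σ' γ' e') : r = 1 := by
  have key : ∀ i j : Fin r, i = j := fun i j => by
    obtain ⟨a, n, ha, h, hn⟩ := S.exists_bind_H_prime D D' i
    obtain ⟨b, l, hb, h', hl⟩ := S.exists_bind_H_prime D D' j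
    simp only [univ_unique, prod_singleton, sum_singleton] at h h' hn hl
    set N := n default
    set L := l default
    have hs := D.degree_pos default
    have hm := S.pos.1
    have hL : L ≠ 0 := by
      intro h0
      rw [h0, zero_mul] at hl
      exact absurd hl (Nat.mul_pos hm (D'.degree_pos j)).ne'
    have hN : N ≠ 0 := by
      intro h0
      rw [h0, zero_mul] at hn
      exact absurd hn (Nat.mul_pos hm (D'.degree_pos i)).ne'
    have hdeg : (p' i).totalDegree * L = (p' j).totalDegree * N := by
      apply Nat.eq_of_mul_eq_mul_right (Nat.mul_pos hs hm)
      calc (p' i).totalDegree * L * ((p default).totalDegree * m)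
          = (m * (p' i).totalDegree) * (L * (p default).totalDegree) := by ring
        _ = (m * (p' j).totalDegree) * (N * (p default).totalDegree) := by rw [hn, ← hl]; ring
        _ = _ := by ring
    have h1 : (C (b ^ N) * p' i ^ L).IsHomogeneous ((p' i).totalDegree * L) := by
      rw [← zero_add (_ * L)]
      exact (isHomogeneous_C _ _).mul ((D'.hom i).pow L)
    have h2 : (C (a ^ L) * p' j ^ N).IsHomogeneous ((p' i).totalDegree * L) := by
      rw [hdeg, ← zero_add (_ * N)]
      exact (isHomogeneous_C _ _).mul ((D'.hom j).pow N)
    have h3 := S.eq_of_bind_H_eq h1 h2 (by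
      simp only [map_mul, map_pow, bind₁_C_right, h, h']
      ring)
    refine D'.eq_of_dvd i j ((D'.prime i).dvd_of_dvd_pow (n := N) ?_)
    have h4 : p' i ∣ C (a ^ L) * p' j ^ N := by
      rw [← h3]
      exact dvd_mul_of_dvd_right (dvd_pow_self _ hL) _
    exact (IsUnit.dvd_mul_left (isUnit_iff_exists_C.2 ⟨_, pow_ne_zero _ ha, rfl⟩)).1 h4
  have hr := D'.pos
  by_contra hne
  have := key ⟨0, by omega⟩ ⟨1, by omega⟩
  simp at this

lemma totalDegree_dvd {p' : Fin 1 → MvPolynomial (Fin 3) k} {σ' : Equiv.Perm (Fin 1)}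
    {e' : Fin 1 → ℕ} {γ' : Fin 1 → k}
    (D : PrimeData F d Q p σ γ e) (D' : PrimeData G d Q' p' σ' γ' e') :
    (p 0).totalDegree ∣ (p' 0).totalDegree := by
  obtain ⟨a, n, ha, h, hn⟩ := S.exists_bind_H_prime D D' 0
  obtain ⟨b, l, hb, h'⟩ := D.factor 1 Q (by rw [pow_one])
  simp only [univ_unique, prod_singleton, sum_singleton, Fin.default_eq_zero] at h h' hn
  have hC : (C b : MvPolynomial (Fin 3) k) ≠ 0 := fun h => hb (C_eq_zero.1 h)
  have h1 : m * m' - 1 = l 0 * (p 0).totalDegree := by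
    rw [← S.Q_hom.totalDegree S.Q_ne, h', totalDegree_mul_of_isDomain hC
      (pow_ne_zero _ (D.prime 0).ne_zero), totalDegree_C, zero_add,
      (((D.hom 0).pow (l 0)).totalDegree (pow_ne_zero _ (D.prime 0).ne_zero)), mul_comm]
  have hco : Nat.Coprime (p 0).totalDegree m := by
    have h2 : (p 0).totalDegree.gcd m ∣ 1 := by
      have h3 : (p 0).totalDegree.gcd m ∣ m * m' - 1 := by
        rw [h1]; exact Dvd.dvd.mul_left (Nat.gcd_dvd_left _ _) _
      have h4 : (p 0).totalDegree.gcd m ∣ m * m' := Dvd.dvd.mul_right (Nat.gcd_dvd_right _ _) _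
      have h5 := Nat.dvd_sub h4 h3
      have h6 := Nat.mul_pos S.pos.1 S.pos.2
      rwa [show m * m' - (m * m' - 1) = 1 by omega] at h5
    exact Nat.dvd_one.1 h2
  exact hco.dvd_of_dvd_mul_left ⟨n 0, by rw [hn]; ring⟩

end Conj

lemma PrimeData.pullback_single {F : Fin 3 → MvPolynomial (Fin 3) k} {d : ℕ}
    {Q : MvPolynomial (Fin 3) k} {p : Fin 1 → MvPolynomial (Fin 3) k}
    {σ : Equiv.Perm (Fin 1)} {e : Fin 1 → ℕ} {γ : Fin 1 → k} (D : PrimeData F d Q p σ γ e) :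
    ∃ a ≠ 0, bind₁ F (p 0) = C a * p 0 ^ d := by
  have h := D.degree 0
  have hσ : σ 0 = 0 := Subsingleton.elim _ _
  rw [hσ] at h
  refine ⟨γ 0, D.c_ne 0, ?_⟩
  rw [D.pullback, hσ, Nat.eq_of_mul_eq_mul_right (D.degree_pos 0) h]

/-- Both exceptional loci are irreducible: they have the same degree. -/
theorem Conj.exists_single [CharZero k] {d m m' : ℕ} {F G H H' : Fin 3 → MvPolynomial (Fin 3) k}
    {Q Q' : MvPolynomial (Fin 3) k} {c c' : k} (S : Conj d m m' F G H H' Q Q' c c')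
    {r' : ℕ} {p : Fin 1 → MvPolynomial (Fin 3) k} {σ : Equiv.Perm (Fin 1)} {e : Fin 1 → ℕ}
    {γ : Fin 1 → k} {p' : Fin r' → MvPolynomial (Fin 3) k} {σ' : Equiv.Perm (Fin r')}
    {e' : Fin r' → ℕ} {γ' : Fin r' → k}
    (D : PrimeData F d Q p σ γ e) (D' : PrimeData G d Q' p' σ' γ' e') :
    ∃ P', Prime P' ∧ P'.IsHomogeneous (p 0).totalDegree ∧
      (∃ a ≠ 0, bind₁ G P' = C a * P' ^ d) ∧ (∃ a ≠ 0, bind₁ H P' = C a * p 0 ^ m) ∧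
      (∃ a ≠ 0, ∃ j, jdet H = C a * p 0 ^ j ∧ 3 * (m - 1) = j * (p 0).totalDegree) ∧
      ∃ a ≠ 0, ∃ n, Q' = C a * P' ^ n := by
  obtain rfl : r' = 1 := S.eq_one_of_eq_one D D'
  have hs : (p' 0).totalDegree = (p 0).totalDegree :=
    Nat.dvd_antisymm (S.symm.totalDegree_dvd D' D) (S.totalDegree_dvd D D')
  refine ⟨p' 0, D'.prime 0, hs ▸ D'.hom 0, D'.pullback_single, ?_, ?_, ?_⟩
  · obtain ⟨a, n, ha, h, hn⟩ := S.exists_bind_H_prime D D' 0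
    simp only [univ_unique, prod_singleton, sum_singleton, Fin.default_eq_zero] at h hn
    rw [hs] at hn
    refine ⟨a, ha, ?_⟩
    rw [h, Nat.eq_of_mul_eq_mul_right (D.degree_pos 0) hn]
  · obtain ⟨a, n, ha, h, hn⟩ := S.exists_jdet_eq D
    simp only [univ_unique, prod_singleton, sum_singleton, Fin.default_eq_zero] at h hn
    exact ⟨a, ha, n 0, h, hn⟩
  · obtain ⟨b, l, hb, h'⟩ := D'.factor 1 Q' (by rw [pow_one])
    simp only [univ_unique, prod_singleton, Fin.default_eq_zero] at h'
    exact ⟨b, hb, l 0, h'⟩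

end
section
variable {k : Type*} [Field k]

lemma subsingleton_rep_eq_smul (u : Fin 3 → k) :
    {x : Projectivization k (Fin 3 → k) | ∃ a : k, a ≠ 0 ∧ x.rep = a • u}.Subsingleton := by
  rintro x ⟨a, ha, hx⟩ y ⟨b, hb, hy⟩
  rw [← x.mk_rep, ← y.mk_rep, Projectivization.mk_eq_mk_iff']
  refine ⟨a / b, ?_⟩
  rw [hx, hy, smul_smul, div_mul_cancel₀ _ hb]

lemma eval_polynomial_aeval (γ : Fin 3 → Polynomial k) (h : MvPolynomial (Fin 3) k) (t : k) :
    (aeval γ h).eval t = eval (fun i => (γ i).eval t) h := by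
  induction h using MvPolynomial.induction_on with
  | C a => simp
  | add p q hp hq => simp [hp, hq]
  | mul_X p i hp => simp [hp]

/-- A parametrized irreducible plane curve meets a curve not containing it in finitely many
points. -/
lemma finite_common_zeros [IsAlgClosed k] {P h : MvPolynomial (Fin 3) k} (hP : Prime P) {n : ℕ}
    (hh : h.IsHomogeneous n) (hPh : ¬ P ∣ h) (γ δ : Fin 3 → Polynomial k)
    (hγ : ∀ v, v ≠ 0 → eval v P = 0 → ∃ a : k, a ≠ 0 ∧
      ((∃ t, v = a • fun i => (γ i).eval t) ∨ v = a • fun i => (δ i).eval 0))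
    (hδ : ∀ t ≠ 0, ∃ a : k, (fun i => (δ i).eval t) = a • fun i => (γ i).eval t⁻¹) :
    {x : Projectivization k (Fin 3 → k) | eval x.rep P = 0 ∧ eval x.rep h = 0}.Finite := by
  classical
  have hφ : aeval γ h ≠ 0 := by
    intro h0
    have h1 : ∀ (a t : k), eval (a • fun i => (γ i).eval t) h = 0 := fun a t => by
      rw [eval_smul_of_isHomogeneous hh, ← eval_polynomial_aeval, h0, Polynomial.eval_zero,
        mul_zero]
    have h2 : aeval δ h = 0 := by
      have h3 : Polynomial.X * aeval δ h = 0 := Polynomial.funext fun t => by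
        rw [Polynomial.eval_mul, Polynomial.eval_X, Polynomial.eval_zero]
        rcases eq_or_ne t 0 with rfl | ht
        · rw [zero_mul]
        · obtain ⟨a, ha⟩ := hδ t ht
          rw [eval_polynomial_aeval, ha, h1, mul_zero]
      exact (mul_eq_zero.1 h3).resolve_left Polynomial.X_ne_zero
    refine hPh (dvd_of_forall_eval_eq_zero hP fun v hv => ?_)
    rcases eq_or_ne v 0 with rfl | hv0
    · simpa using h1 0 0
    · obtain ⟨a, -, ⟨t, rfl⟩ | rfl⟩ := hγ v hv0 hv
      · exact h1 a t
      · rw [eval_smul_of_isHomogeneous hh, ← eval_polynomial_aeval, h2, Polynomial.eval_zero,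
          mul_zero]
  refine Set.Finite.subset (Set.Finite.union
    (Set.Finite.biUnion (aeval γ h).roots.toFinset.finite_toSet fun t _ =>
      (subsingleton_rep_eq_smul fun i => (γ i).eval t).finite)
    (subsingleton_rep_eq_smul fun i => (δ i).eval 0).finite) ?_
  rintro x ⟨hx1, hx2⟩
  obtain ⟨a, ha, ⟨t, ht⟩ | hx⟩ := hγ _ x.rep_nonzero hx1
  · refine Or.inl (Set.mem_biUnion (x := t) ?_ ⟨a, ha, ht⟩)
    rw [ht, eval_smul_of_isHomogeneous hh] at hx2
    simp only [Finset.mem_coe, Multiset.mem_toFinset, Polynomial.mem_roots hφ,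
      Polynomial.IsRoot.def, eval_polynomial_aeval]
    exact (mul_eq_zero.1 hx2).resolve_left (pow_ne_zero _ ha)
  · exact Or.inr ⟨a, ha, hx⟩

lemma exists_dotProduct_eq_zero (b : Fin 3 → k) : ∃ w ≠ 0, b ⬝ᵥ w = 0 := by
  obtain ⟨n, hn, h, -⟩ := exists_ne_zero_dotProduct_eq_zero b 0
  exact ⟨n, hn, h⟩

lemma finite_common_zeros_line [IsAlgClosed k] {P h : MvPolynomial (Fin 3) k}
    (hP : P.IsHomogeneous 1) (hP0 : P ≠ 0) {n : ℕ} (hh : h.IsHomogeneous n) (hPh : ¬ P ∣ h) :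
    {x : Projectivization k (Fin 3 → k) | eval x.rep P = 0 ∧ eval x.rep h = 0}.Finite := by
  obtain ⟨w, hw, hPw⟩ : ∃ w ≠ 0, eval w P = 0 := by
    obtain ⟨b, rfl⟩ := exists_eq_sum_of_isHomogeneous_one hP
    simp only [eval_C_sum]
    exact exists_dotProduct_eq_zero b
  obtain ⟨M, hM, -, c, hc, hMP⟩ := exists_line_coordinates hP hP0 hw hPw
  have hMM : M * M⁻¹ = 1 := mul_nonsing_inv _ (Ne.isUnit hM)
  refine finite_common_zeros (prime_of_isHomogeneous_one hP hP0) hh hPh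
    (fun i => ∑ j, Polynomial.C (M i j) * (![Polynomial.X, 1, 0] : Fin 3 → Polynomial k) j)
    (fun i => ∑ j, Polynomial.C (M i j) * (![1, Polynomial.X, 0] : Fin 3 → Polynomial k) j) ?_ ?_
  · intro v hv hv0
    obtain ⟨u, rfl⟩ : ∃ u, v = M *ᵥ u := ⟨M⁻¹ *ᵥ v, by rw [mulVec_mulVec, hMM, one_mulVec]⟩
    rw [hMP] at hv0
    have h2 := (mul_eq_zero.1 hv0).resolve_left hc
    rcases eq_or_ne (u 1) 0 with h1 | h1
    · refine ⟨u 0, fun h0 => hv ?_, Or.inr ?_⟩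
      · rw [show u = 0 by funext i; fin_cases i <;> assumption, mulVec_zero]
      · funext i
        simp [mulVec, dotProduct, Fin.sum_univ_three, h1, h2]
        try ring
    · refine ⟨u 1, h1, Or.inl ⟨u 0 / u 1, ?_⟩⟩
      funext i
      simp [mulVec, dotProduct, Fin.sum_univ_three, h2]
      field_simp
  · intro t ht
    refine ⟨t, ?_⟩
    funext i
    simp [Fin.sum_univ_three]
    field_simp

lemma finite_common_zeros_conic [IsAlgClosed k] [CharZero k] {P h : MvPolynomial (Fin 3) k}
    (hP : Prime P) (hP2 : P.IsHomogeneous 2) {n : ℕ} (hh : h.IsHomogeneous n) (hPh : ¬ P ∣ h)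
    {w : Fin 3 → k} (hw : w ≠ 0) (hPw : eval w P = 0) :
    {x : Projectivization k (Fin 3 → k) | eval x.rep P = 0 ∧ eval x.rep h = 0}.Finite := by
  obtain ⟨M, hM, -, c, hc, hMP⟩ := exists_conic_coordinates hP hP2 hw hPw
  have hMM : M * M⁻¹ = 1 := mul_nonsing_inv _ (Ne.isUnit hM)
  refine finite_common_zeros hP hh hPh
    (fun i => ∑ j, Polynomial.C (M i j) * (![1, Polynomial.X, Polynomial.X ^ 2] :
      Fin 3 → Polynomial k) j)
    (fun i => ∑ j, Polynomial.C (M i j) * (![Polynomial.X ^ 2, Polynomial.X, 1] :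
      Fin 3 → Polynomial k) j) ?_ ?_
  · intro v hv hv0
    obtain ⟨u, rfl⟩ : ∃ u, v = M *ᵥ u := ⟨M⁻¹ *ᵥ v, by rw [mulVec_mulVec, hMM, one_mulVec]⟩
    rw [hMP] at hv0
    have h2 := (mul_eq_zero.1 hv0).resolve_left hc
    rcases eq_or_ne (u 0) 0 with h0 | h0
    · have h1 : u 1 = 0 := by simpa [h0] using h2
      refine ⟨u 2, fun h2 => hv ?_, Or.inr ?_⟩
      · rw [show u = 0 by funext i; fin_cases i <;> assumption, mulVec_zero]
      · funext i
        simp [mulVec, dotProduct, Fin.sum_univ_three, h1, h0]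
        try ring
    · refine ⟨u 0, h0, Or.inl ⟨u 1 / u 0, ?_⟩⟩
      funext i
      simp [mulVec, dotProduct, Fin.sum_univ_three]
      field_simp
      linear_combination (-M i 2) * h2
  · intro t ht
    refine ⟨t ^ 2, ?_⟩
    funext i
    simp [Fin.sum_univ_three]
    field_simp

end
section
variable {k : Type*} [Field k]

lemma eval_zero_of_isHomogeneous {p : MvPolynomial (Fin 3) k} {n : ℕ} (hp : p.IsHomogeneous n)
    (hn : n ≠ 0) : eval 0 p = 0 := by
  have := eval_smul_of_isHomogeneous hp 0 0
  rwa [zero_pow hn, zero_mul, smul_zero] at this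

lemma exists_eq_smul_of_minors {a w : Fin 3 → k} (hw : w ≠ 0)
    (h : ∀ i j, a i * w j = a j * w i) : ∃ b : k, a = b • w := by
  obtain ⟨l, hl⟩ := Function.ne_iff.1 hw
  simp only [Pi.zero_apply] at hl
  refine ⟨a l / w l, funext fun i => ?_⟩
  rw [Pi.smul_apply, smul_eq_mul, div_mul_eq_mul_div, eq_div_iff hl, h]

/-- An endomorphism acts injectively on a finite set of points it maps onto itself. -/
lemma eq_smul_of_eval_eq_smul {G : Fin 3 → MvPolynomial (Fin 3) k} {d : ℕ} (hd : 1 ≤ d)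
    (hG : ∀ i, (G i).IsHomogeneous d) (hGnz : ∀ v : Fin 3 → k, v ≠ 0 → ∃ i, eval v (G i) ≠ 0)
    (hsurj : ∀ w : Fin 3 → k, ∃ v, ∀ i, eval v (G i) = w i)
    {Z : (Fin 3 → k) → Prop} (hZ : ∀ (a : k) v, a ≠ 0 → Z v → Z (a • v))
    (hfin : {x : Projectivization k (Fin 3 → k) | Z x.rep}.Finite)
    (hmaps : ∀ v, Z v → Z fun i => eval v (G i))
    (hrefl : ∀ v, v ≠ 0 → (Z fun i => eval v (G i)) → Z v)
    {u v : Fin 3 → k} (hu : u ≠ 0) (hv : v ≠ 0) (hZv : Z v) {a : k}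
    (h : ∀ i, eval u (G i) = a * eval v (G i)) : ∃ b : k, u = b • v := by
  have hne : ∀ v : Fin 3 → k, v ≠ 0 → (fun i => eval v (G i)) ≠ 0 := fun v hv h0 => by
    obtain ⟨i, hi⟩ := hGnz v hv
    exact hi (congrFun h0 i)
  have hsm : ∀ (b : k) (v : Fin 3 → k), (fun i => eval (b • v) (G i)) =
      b ^ d • fun i => eval v (G i) := fun b v => by
    funext i
    rw [eval_smul_of_isHomogeneous (hG i), Pi.smul_apply, smul_eq_mul]
  let g : Projectivization k (Fin 3 → k) → Projectivization k (Fin 3 → k) :=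
    fun x => Projectivization.mk k (fun i => eval x.rep (G i)) (hne _ x.rep_nonzero)
  have hrep : ∀ (v : Fin 3 → k) (hv : v ≠ 0), ∃ b : k, b ≠ 0 ∧
      (Projectivization.mk k v hv).rep = b • v := fun v hv => by
    obtain ⟨b, hb⟩ := Projectivization.exists_smul_eq_mk_rep k v hv
    exact ⟨b, b.ne_zero, hb.symm⟩
  have hmk : ∀ (v : Fin 3 → k) (hv : v ≠ 0), Z (Projectivization.mk k v hv).rep ↔ Z v := by
    intro v hv
    obtain ⟨b, hb, h1⟩ := hrep v hv
    rw [h1]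
    refine ⟨fun h2 => ?_, hZ b v hb⟩
    simpa [smul_smul, inv_mul_cancel₀ hb] using hZ b⁻¹ _ (inv_ne_zero hb) h2
  have hgmk : ∀ (v : Fin 3 → k) (hv : v ≠ 0), g (Projectivization.mk k v hv) =
      Projectivization.mk k (fun i => eval v (G i)) (hne v hv) := fun v hv => by
    obtain ⟨b, hb, h1⟩ := hrep v hv
    rw [Projectivization.mk_eq_mk_iff']
    exact ⟨b ^ d, by rw [← hsm, h1]⟩
  have hmapsZ : Set.MapsTo g {x | Z x.rep} {x | Z x.rep} := fun x hx =>
    (hmk _ _).2 (hmaps _ hx)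
  have hsurjZ : Set.SurjOn g {x | Z x.rep} {x | Z x.rep} := fun x hx => by
    obtain ⟨v, hv⟩ := hsurj x.rep
    have hv' : (fun i => eval v (G i)) = x.rep := funext hv
    have hv0 : v ≠ 0 := by
      rintro rfl
      refine x.rep_nonzero ?_
      rw [← hv']
      funext i
      exact eval_zero_of_isHomogeneous (hG i) (by omega)
    refine ⟨Projectivization.mk k v hv0, (hmk _ _).2 (hrefl v hv0 (hv' ▸ hx)), ?_⟩
    rw [hgmk, ← x.mk_rep, Projectivization.mk_eq_mk_iff']
    exact ⟨1, by rw [one_smul]; exact hv'.symm⟩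
  have hinj : Set.InjOn g {x | Z x.rep} := by
    have := hfin.to_subtype
    rw [← hmapsZ.restrict_inj]
    exact Finite.injective_iff_surjective.2 ((hmapsZ.restrict_surjective_iff).2 hsurjZ)
  have ha : a ≠ 0 := by
    rintro rfl
    obtain ⟨i, hi⟩ := hGnz u hu
    exact hi (by rw [h, zero_mul])
  have hu' : (fun i => eval u (G i)) = a • fun i => eval v (G i) := funext h
  have hZu : Z u := hrefl u hu (hu' ▸ hZ a _ ha (hmaps v hZv))
  have := hinj ((hmk u hu).2 hZu) ((hmk v hv).2 hZv) (by
    rw [hgmk, hgmk, Projectivization.mk_eq_mk_iff']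
    exact ⟨a, hu'.symm⟩)
  rw [Projectivization.mk_eq_mk_iff'] at this
  obtain ⟨b, hb⟩ := this
  exact ⟨b, hb.symm⟩

/-- `H` contracts the exceptional curve to a point which is totally invariant under `G`. -/
theorem Conj.exists_contraction [IsAlgClosed k] [CharZero k] {d m m' : ℕ}
    {F G H H' : Fin 3 → MvPolynomial (Fin 3) k}
    {Q Q' : MvPolynomial (Fin 3) k} {c c' : k} (S : Conj d m m' F G H H' Q Q' c c') (hd : 1 ≤ d)
    {P P' : MvPolynomial (Fin 3) k} (hP : Prime P) (hPQ : P ∣ Q)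
    (hPF : P ∣ bind₁ F P) (hP' : Prime P') (hP's : P'.IsHomogeneous 1 ∨ P'.IsHomogeneous 2)
    {n : ℕ} (hQP : Q' ∣ P' ^ n) :
    ∃ w ≠ 0, eval w P' = 0 ∧ (∃ h, ∀ i, P ∣ H i - C (w i) * h) ∧
      ∀ v ≠ 0, ∀ a, (∀ i, eval v (G i) = a * w i) → ∃ b : k, v = b • w := by
  classical
  set Z : (Fin 3 → k) → Prop := fun v => ∀ i, eval v (H' i) = 0 with hZdef
  have hZP' : ∀ v, v ≠ 0 → Z v → eval v P' = 0 := fun v hv hZ => by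
    obtain ⟨i, hi⟩ := Function.ne_iff.1 hv
    have h1 := congrArg (eval v) (S.H_H' i)
    rw [eval_bind₁, show (fun i => eval v (H' i)) = 0 from funext hZ,
      eval_zero_of_isHomogeneous (S.H_hom i) (by have := S.pos.1; omega), map_mul, eval_X] at h1
    have h2 := (mul_eq_zero.1 h1.symm).resolve_right hi
    obtain ⟨u, hu⟩ := hQP
    have h3 := congrArg (eval v) hu
    rw [map_mul, h2, zero_mul, map_pow] at h3
    by_contra hne
    exact pow_ne_zero n hne h3
  obtain ⟨l, hl⟩ := S.H'_prim P' hP'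
  have hfin : {x : Projectivization k (Fin 3 → k) | Z x.rep}.Finite := by
    by_cases hne : ∃ x : Projectivization k (Fin 3 → k), Z x.rep
    · have h1 : {x : Projectivization k (Fin 3 → k) |
          eval x.rep P' = 0 ∧ eval x.rep (H' l) = 0}.Finite := by
        rcases hP's with h | h
        · exact finite_common_zeros_line h hP'.ne_zero (S.H'_hom l) hl
        · obtain ⟨x, hx⟩ := hne
          exact finite_common_zeros_conic hP' h (S.H'_hom l) hl x.rep_nonzero
            (hZP' _ x.rep_nonzero hx)
      exact h1.subset fun x hx => ⟨hZP' _ x.rep_nonzero hx, hx l⟩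
    · convert Set.finite_empty
      ext x
      exact ⟨fun h => hne ⟨x, h⟩, fun h => h.elim⟩
  have hHZ : ∀ v, eval v P = 0 → Z fun i => eval v (H i) := fun v hv i => by
    have h1 := congrArg (eval v) (S.H'_H i)
    obtain ⟨u, hu⟩ := hPQ
    rwa [eval_bind₁, map_mul, hu, map_mul, hv, zero_mul, zero_mul] at h1
  have hZsmul : ∀ (a : k) v, a ≠ 0 → Z v → Z (a • v) := fun a v ha hv i => by
    rw [eval_smul_of_isHomogeneous (S.H'_hom i), hv i, mul_zero]
  obtain ⟨i₀, hi₀⟩ := S.H_prim P hP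
  -- some point of `Z` receives the whole curve
  obtain ⟨x, hxZ, hx⟩ : ∃ x : Projectivization k (Fin 3 → k), Z x.rep ∧
      ∀ i j, P ∣ H i * C (x.rep j) - H j * C (x.rep i) := by
    by_contra! hcon
    have hch : ∀ x : Projectivization k (Fin 3 → k), ∃ ij : Fin 3 × Fin 3, Z x.rep →
        ¬ P ∣ H ij.1 * C (x.rep ij.2) - H ij.2 * C (x.rep ij.1) := fun x => by
      by_cases hx : Z x.rep
      · obtain ⟨i, j, h⟩ := hcon x hx
        exact ⟨(i, j), fun _ => h⟩
      · exact ⟨(0, 0), fun h => (hx h).elim⟩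
    choose f hf using hch
    have hdvd : P ∣ H i₀ * ∏ x ∈ hfin.toFinset,
        (H (f x).1 * C (x.rep (f x).2) - H (f x).2 * C (x.rep (f x).1)) := by
      refine dvd_of_forall_eval_eq_zero hP fun v hv => ?_
      rw [map_mul, map_prod, mul_eq_zero]
      by_cases h0 : (fun i => eval v (H i)) = 0
      · exact Or.inl (congrFun h0 i₀)
      · right
        obtain ⟨b, hb⟩ := Projectivization.exists_smul_eq_mk_rep k _ h0
        refine Finset.prod_eq_zero (i := Projectivization.mk k _ h0) ?_ ?_
        · rw [Set.Finite.mem_toFinset, Set.mem_ofPred_eq, ← hb]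
          exact hZsmul _ _ b.ne_zero (hHZ v hv)
        · rw [← hb]
          simp only [map_sub, map_mul, eval_C, Pi.smul_apply, Units.smul_def, smul_eq_mul]
          ring
    rcases hP.dvd_or_dvd hdvd with h | h
    · exact hi₀ h
    · obtain ⟨x, hx, h⟩ := (hP.dvd_finsetProd_iff _).1 h
      exact hf x ((Set.Finite.mem_toFinset _).1 hx) h
  set w := x.rep with hw
  have hw0 : w ≠ 0 := x.rep_nonzero
  obtain ⟨t, ht⟩ := Function.ne_iff.1 hw0
  simp only [Pi.zero_apply] at ht
  have hpar : ∀ v, eval v P = 0 → ∃ b : k, (fun i => eval v (H i)) = b • w := fun v hv => by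
    refine exists_eq_smul_of_minors hw0 fun i j => ?_
    obtain ⟨u, hu⟩ := hx i j
    have h1 := congrArg (eval v) hu
    simp only [map_sub, map_mul, eval_C, hv, zero_mul] at h1
    exact sub_eq_zero.1 h1
  refine ⟨w, hw0, hZP' w hw0 hxZ, ⟨C (w t)⁻¹ * H t, fun i => ?_⟩, ?_⟩
  · have h1 : H i - C (w i) * (C (w t)⁻¹ * H t) =
        C (w t)⁻¹ * (H i * C (w t) - H t * C (w i)) := by
      have : (C (w t)⁻¹ * C (w t) : MvPolynomial (Fin 3) k) = 1 := by
        rw [← C_mul, inv_mul_cancel₀ ht, C_1]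
      linear_combination (-H i) * this
    rw [h1]
    exact dvd_mul_of_dvd_right (hx i t) _
  · intro v hv a ha
    obtain ⟨s, hs, hsH⟩ : ∃ s, eval s P = 0 ∧ eval s (H i₀) ≠ 0 := by
      by_contra! hcon
      exact hi₀ (dvd_of_forall_eval_eq_zero hP hcon)
    obtain ⟨b, hb⟩ := hpar s hs
    have hb0 : b ≠ 0 := by
      rintro rfl
      rw [zero_smul] at hb
      exact hsH (congrFun hb i₀)
    obtain ⟨b', hb'⟩ := hpar (fun i => eval s (F i)) (by
      obtain ⟨u, hu⟩ := hPF
      rw [← eval_bind₁, hu, map_mul, hs, zero_mul])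
    have hGw : ∀ i, c * b ^ d * eval w (G i) = b' * w i := fun i => by
      have h1 := congrArg (eval s) (S.H_F i)
      rw [eval_bind₁, map_mul, eval_C, eval_bind₁, hb, eval_smul_of_isHomogeneous (S.G_hom i)] at h1
      have h2 := congrFun hb' i
      simp only [Pi.smul_apply, smul_eq_mul] at h2
      rw [← h2, h1]
      ring
    have hb'0 : b' ≠ 0 := by
      rintro rfl
      obtain ⟨i, hi⟩ := S.G_nz w hw0
      have := hGw i
      rw [zero_mul] at this
      exact (mul_ne_zero (mul_ne_zero S.c_ne (pow_ne_zero _ hb0)) hi) this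
    obtain ⟨B⟩ := exists_freeBasis hd S.G_hom S.G_nz
    refine eq_smul_of_eval_eq_smul (a := a * (c * b ^ d / b')) hd S.G_hom S.G_nz
      (fun w => B.surjective_eval w) hZsmul hfin ?_ ?_ hv hw0 hxZ fun i => ?_
    · intro v hv i
      have h1 := congrArg (eval v) (S.H'_G i)
      rw [eval_bind₁, map_mul, eval_bind₁, show (fun i => eval v (H' i)) = 0 from funext hv,
        eval_zero_of_isHomogeneous (S.F_hom i) (by omega), mul_zero] at h1
      exact h1
    · intro v _ hv
      by_contra hne
      obtain ⟨i, hi⟩ := S.F_nz (fun i => eval v (H' i)) fun h => hne (congrFun h)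
      have h1 := congrArg (eval v) (S.H'_G i)
      rw [eval_bind₁, map_mul, eval_bind₁, eval_C, hv i] at h1
      exact mul_ne_zero S.c'_ne hi h1.symm
    · rw [ha, mul_assoc, div_mul_eq_mul_div, hGw, mul_div_cancel_left₀ _ hb'0]

end
section
variable {k : Type*} [Field k]

lemma bind₁_comp (A B : Fin 3 → MvPolynomial (Fin 3) k) (u : MvPolynomial (Fin 3) k) :
    bind₁ (comp A B) u = bind₁ B (bind₁ A u) :=
  (bind₁_bind₁ A B u).symm

lemma bind₁_lin (A : Fin 3 → MvPolynomial (Fin 3) k) (N : Matrix (Fin 3) (Fin 3) k) (i : Fin 3) :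
    bind₁ A (lin N i) = ∑ j, C (N i j) * A j := by
  simp [lin, map_sum]

lemma bind₁_lin_bind₁_lin {M N : Matrix (Fin 3) (Fin 3) k} (h : M * N = 1)
    (u : MvPolynomial (Fin 3) k) : bind₁ (lin N) (bind₁ (lin M) u) = u := by
  rw [bind₁_bind₁]
  have : (fun i => bind₁ (lin N) (lin M i)) = X := by
    funext i
    rw [bind₁_lin]
    simp only [lin, Finset.mul_sum]
    rw [Finset.sum_comm]
    have h1 : ∀ l, ∑ j, C (M i j) * (C (N j l) * X l) =
        C ((1 : Matrix (Fin 3) (Fin 3) k) i l) * (X l : MvPolynomial (Fin 3) k) := fun l => by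
      rw [← h, mul_apply, map_sum, Finset.sum_mul]
      exact Finset.sum_congr rfl fun j _ => by rw [C_mul, mul_assoc]
    simp_rw [h1, one_apply]
    simp [apply_ite C, ite_mul]
  rw [this, bind₁_X_left]
  rfl

lemma eval_lin (N : Matrix (Fin 3) (Fin 3) k) (v : Fin 3 → k) (i : Fin 3) :
    eval v (lin N i) = (N *ᵥ v) i := by
  simp [lin, mulVec, dotProduct]

lemma jdet_lin (N : Matrix (Fin 3) (Fin 3) k) : jdet (lin N) = C N.det := by
  have : jac (lin N) = N.map (C : k → MvPolynomial (Fin 3) k) := by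
    ext1 i j
    simp [jac_apply, lin, Derivation.leibniz, Pi.single_apply]
  rw [jdet, this]
  exact (RingHom.map_det C N).symm

/-- Data of a birational map contracting a curve `P = 0` to a point `w` of the curve `T = 0`. -/
structure Core (d m δ : ℕ) (G H : Fin 3 → MvPolynomial (Fin 3) k)
    (P T R : MvPolynomial (Fin 3) k) (w : Fin 3 → k) : Prop where
  G_hom : ∀ i, (G i).IsHomogeneous d
  G_nz : ∀ v : Fin 3 → k, v ≠ 0 → ∃ i, eval v (G i) ≠ 0
  H_hom : ∀ i, (H i).IsHomogeneous m
  prime : Prime P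
  T_H : ∃ a ≠ 0, bind₁ H T = C a * P ^ m
  J_H : ∃ a ≠ 0, jdet H = C a * P ^ (m - 1 + δ)
  T_G : ∃ a ≠ 0, bind₁ G T = C a * T ^ d
  J_G : jdet G = T ^ (d - 1) * R
  R_H : P ^ ((d - 1) * δ) ∣ bind₁ H R
  contract : ∃ h, ∀ i, P ∣ H i - C (w i) * h
  H_prim : ∃ i, ¬ P ∣ H i
  G_w : ∀ v ≠ 0, ∀ a, (∀ i, eval v (G i) = a * w i) → ∃ b : k, v = b • w

lemma Core.transport {d m δ : ℕ} {G H : Fin 3 → MvPolynomial (Fin 3) k}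
    {P T R : MvPolynomial (Fin 3) k} {w : Fin 3 → k} (K : Core d m δ G H P T R w)
    {M : Matrix (Fin 3) (Fin 3) k} (hM : M.det ≠ 0) {w₁ : Fin 3 → k} (hw : M *ᵥ w₁ = w)
    {T₁ : MvPolynomial (Fin 3) k} {a : k} (ha : a ≠ 0) (hT : ∀ v, eval (M *ᵥ v) T = a * eval v T₁)
    [Infinite k] : ∃ G₁ H₁ R₁, Core d m δ G₁ H₁ P T₁ R₁ w₁ := by
  set N := M⁻¹
  have hMN : M * N = 1 := mul_nonsing_inv _ (Ne.isUnit hM)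
  have hNM : N * M = 1 := nonsing_inv_mul _ (Ne.isUnit hM)
  have hNdet : N.det * M.det = 1 := by rw [← det_mul, hNM, det_one]
  have hN : N.det ≠ 0 := left_ne_zero_of_mul (hNdet ▸ one_ne_zero)
  have hC : ∀ {x : k}, x ≠ 0 → (C x : MvPolynomial (Fin 3) k) ≠ 0 := fun h h0 =>
    h (C_eq_zero.1 h0)
  have hTM : bind₁ (lin M) T = C a * T₁ := MvPolynomial.funext fun v => by
    rw [eval_bind₁, map_mul, eval_C, ← hT,
      show (fun i => eval v (lin M i)) = M *ᵥ v from funext (eval_lin M v)]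
  set H₁ := comp (lin N) H with hH₁
  set G₁ := comp (lin N) (comp G (lin M)) with hG₁
  have hbH : ∀ u, bind₁ H₁ (bind₁ (lin M) u) = bind₁ H u := fun u => by
    rw [hH₁, bind₁_comp, bind₁_lin_bind₁_lin hMN]
  have hbG : ∀ u, bind₁ G₁ (bind₁ (lin M) u) = bind₁ (lin M) (bind₁ G u) := fun u => by
    rw [hG₁, bind₁_comp, bind₁_comp, bind₁_lin_bind₁_lin hMN]
  have hGe : ∀ v, (fun i => eval v (G₁ i)) = N *ᵥ fun i => eval (M *ᵥ v) (G i) := fun v => by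
    funext i
    rw [hG₁, comp, eval_bind₁, eval_lin]
    congr 2
    funext j
    rw [comp, eval_bind₁]
    rw [show (fun i => eval v (lin M i)) = M *ᵥ v from funext (eval_lin M v)]
  have hMG : ∀ v, M *ᵥ (fun i => eval v (G₁ i)) = fun i => eval (M *ᵥ v) (G i) := fun v => by
    rw [hGe, mulVec_mulVec, hMN, one_mulVec]
  have hMv : ∀ v : Fin 3 → k, v ≠ 0 → M *ᵥ v ≠ 0 := fun v hv h => hv <| by
    rw [← one_mulVec v, ← hNM, ← mulVec_mulVec, h, mulVec_zero]
  have hMH : ∀ i, H i = ∑ j, C (M i j) * H₁ j := fun i => by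
    rw [← bind₁_lin, ← bind₁_X_right H i, ← hbH, bind₁_X_right]
  refine ⟨G₁, H₁, C (a ^ (d - 1)) * bind₁ (lin M) R, ?_, ?_, ?_, K.prime, ?_, ?_, ?_, ?_, ?_, ?_,
    ?_, ?_⟩
  · intro i
    have h1 : ∀ j, (comp G (lin M) j).IsHomogeneous (1 * d) := fun j =>
      (K.G_hom j).aeval _ (isHomogeneous_lin M)
    have := (isHomogeneous_lin N i).aeval _ h1
    rwa [one_mul, mul_one] at this
  · intro v hv
    by_contra! hcon
    obtain ⟨i, hi⟩ := K.G_nz _ (hMv v hv)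
    apply hi
    have := congrFun (hMG v) i
    rw [← this, show (fun i => eval v (G₁ i)) = 0 from funext hcon, mulVec_zero, Pi.zero_apply]
  · intro i
    have := (isHomogeneous_lin N i).aeval _ K.H_hom
    rwa [mul_one] at this
  · obtain ⟨b, hb, h⟩ := K.T_H
    refine ⟨b / a, div_ne_zero hb ha, mul_left_cancel₀ (hC ha) ?_⟩
    have h1 := hbH T
    rw [hTM, map_mul, bind₁_C_right, h] at h1
    rw [h1, ← mul_assoc, ← C_mul, mul_div_cancel₀ _ ha]
  · obtain ⟨b, hb, h⟩ := K.J_H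
    refine ⟨N.det * b, mul_ne_zero hN hb, ?_⟩
    rw [hH₁, jdet_comp, jdet_lin, bind₁_C_right, h, C_mul, mul_assoc]
  · obtain ⟨b, hb, h⟩ := K.T_G
    refine ⟨b * a ^ d / a, div_ne_zero (mul_ne_zero hb (pow_ne_zero _ ha)) ha,
      mul_left_cancel₀ (hC ha) ?_⟩
    have h1 := hbG T
    rw [hTM, map_mul, bind₁_C_right, h, map_mul, map_pow, hTM, bind₁_C_right, mul_pow] at h1
    rw [h1, ← mul_assoc, ← mul_assoc, ← C_pow, ← C_mul, ← C_mul, mul_div_cancel₀ _ ha]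
  · rw [hG₁, jdet_comp, jdet_comp, jdet_lin, jdet_lin, bind₁_C_right, K.J_G, map_mul, map_pow, hTM]
    rw [mul_pow, C_pow]
    have : (C N.det * C M.det : MvPolynomial (Fin 3) k) = 1 := by rw [← C_mul, hNdet, C_1]
    linear_combination (C a ^ (d - 1) * T₁ ^ (d - 1) * bind₁ (lin M) R) * this
  · rw [map_mul, hbH]
    exact dvd_mul_of_dvd_right K.R_H _
  · obtain ⟨h, hh⟩ := K.contract
    refine ⟨h, fun i => ?_⟩
    have h1 : H₁ i - C (w₁ i) * h = ∑ j, C (N i j) * (H j - C (w j) * h) := by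
      have hw' : w₁ i = ∑ j, N i j * w j := by
        have : N *ᵥ w = w₁ := by rw [← hw, mulVec_mulVec, hNM, one_mulVec]
        rw [← this]; rfl
      rw [hw', map_sum, Finset.sum_mul, hH₁, comp, bind₁_lin, ← Finset.sum_sub_distrib]
      exact Finset.sum_congr rfl fun j _ => by rw [C_mul]; ring
    rw [h1]
    exact Finset.dvd_sum fun j _ => dvd_mul_of_dvd_right (hh j) _
  · by_contra! hcon
    obtain ⟨i, hi⟩ := K.H_prim
    rw [hMH] at hi
    exact hi (Finset.dvd_sum fun j _ => dvd_mul_of_dvd_right (hcon j) _)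
  · intro v hv b hb
    obtain ⟨c, hc⟩ := K.G_w (M *ᵥ v) (hMv v hv) b fun i => by
      have := congrFun (hMG v) i
      rw [← this, show (fun i => eval v (G₁ i)) = b • w₁ from funext hb, mulVec_smul, hw]
      rfl
    refine ⟨c, ?_⟩
    rw [← one_mulVec v, ← hNM, ← mulVec_mulVec, hc, mulVec_smul, ← hw, mulVec_mulVec, hNM,
      one_mulVec]

/-- The data attached to a conjugacy with a single exceptional curve of degree at most two. -/
theorem Conj.exists_core [IsAlgClosed k] [CharZero k] {d m m' : ℕ}
    {F G H H' : Fin 3 → MvPolynomial (Fin 3) k}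
    {Q Q' : MvPolynomial (Fin 3) k} {c c' : k} (S : Conj d m m' F G H H' Q Q' c c') (hd : 2 ≤ d)
    {r' : ℕ} {p : Fin 1 → MvPolynomial (Fin 3) k} {σ : Equiv.Perm (Fin 1)} {e : Fin 1 → ℕ}
    {γ : Fin 1 → k} {p' : Fin r' → MvPolynomial (Fin 3) k} {σ' : Equiv.Perm (Fin r')}
    {e' : Fin r' → ℕ} {γ' : Fin r' → k}
    (D : PrimeData F d Q p σ γ e) (D' : PrimeData G d Q' p' σ' γ' e')
    (hs : (p 0).totalDegree = 1 ∨ (p 0).totalDegree = 2) :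
    ∃ T R w δ, Prime T ∧ T.IsHomogeneous (p 0).totalDegree ∧ w ≠ 0 ∧ eval w T = 0 ∧
      3 * (m - 1) = (m - 1 + δ) * (p 0).totalDegree ∧ Core d m δ G H (p 0) T R w := by
  obtain ⟨T, hT, hTs, ⟨a, ha, hTG⟩, ⟨b, hb, hTH⟩, ⟨l, hl, j, hJ, hj⟩, ⟨t, ht, n, hQ'⟩⟩ :=
    S.exists_single D D'
  obtain ⟨x, hx, hPF⟩ := D.pullback_single
  have hm := S.pos.1
  obtain ⟨w, hw, hwT, hcon, hGw⟩ := S.exists_contraction (by omega) (D.prime 0) (D.dvd 0)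
    (by rw [hPF]; exact dvd_mul_of_dvd_right (dvd_pow_self _ (by omega)) _) hT
    (by rcases hs with h | h <;> rw [h] at hTs <;> simp [hTs]) (n := n) (by
      rw [hQ', (isUnit_iff_exists_C.2 ⟨t, ht, rfl⟩).mul_left_dvd])
  obtain ⟨BF⟩ := exists_freeBasis (by omega) S.F_hom S.F_nz
  obtain ⟨BG⟩ := exists_freeBasis (by omega) S.G_hom S.G_nz
  obtain ⟨RF, hRF⟩ := pow_dvd_jdet BF (D.prime 0) (D.prime 0) (D.hom 0) hPF
  obtain ⟨R, hR⟩ := pow_dvd_jdet BG hT hT hTs hTG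
  obtain ⟨δ, rfl⟩ : ∃ δ, j = m - 1 + δ := Nat.exists_eq_add_of_le (by
    rcases hs with h | h <;> rw [h] at hj <;> omega)
  have hC : ∀ {x : k}, x ≠ 0 → (C x : MvPolynomial (Fin 3) k) ≠ 0 := fun h h0 =>
    h (C_eq_zero.1 h0)
  refine ⟨T, R, w, δ, hT, hTs, hw, hwT, hj, S.G_hom, S.G_nz, S.H_hom, D.prime 0, ⟨b, hb, hTH⟩,
    ⟨l, hl, hJ⟩, ⟨a, ha, hTG⟩, hR, ?_, hcon, S.H_prim _ (D.prime 0), hGw⟩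
  have h1 : jdet (comp H F) = C (c ^ 3) * jdet (comp G H) := by
    have : comp H F = comp (lin (c • (1 : Matrix (Fin 3) (Fin 3) k))) (comp G H) := by
      funext i
      rw [comp, S.H_F, comp, bind₁_lin]
      simp [one_apply, apply_ite C, ite_mul, comp]
    rw [this, jdet_comp, jdet_lin, bind₁_C_right]
    simp
  have hP0 := (D.prime 0).ne_zero
  rw [jdet_comp, jdet_comp, hJ, hRF, hR, map_mul, map_pow, hPF, bind₁_C_right, map_mul, map_pow,
    map_pow, hTH] at h1
  refine ⟨C (x ^ (m - 1 + δ) * (c ^ 3)⁻¹ * (b ^ (d - 1))⁻¹) * RF, ?_⟩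
  have hc3 := pow_ne_zero 3 S.c_ne
  have hbd := pow_ne_zero (d - 1) hb
  apply mul_left_cancel₀ (mul_ne_zero (mul_ne_zero (hC hc3) (hC hbd))
    (mul_ne_zero (hC hl) (pow_ne_zero (m * (d - 1) + (m - 1 + δ)) hP0)))
  have h2 : (C (x ^ (m - 1 + δ) * (c ^ 3)⁻¹ * (b ^ (d - 1))⁻¹) : MvPolynomial (Fin 3) k) *
      (C (c ^ 3) * C (b ^ (d - 1))) = C x ^ (m - 1 + δ) := by
    rw [← C_mul, ← C_mul, ← C_pow]
    have := S.c_ne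
    congr 1
    field_simp
  have h3 : p 0 ^ (m * (d - 1) + (m - 1 + δ)) * p 0 ^ ((d - 1) * δ) =
      p 0 ^ (d * (m - 1 + δ)) * p 0 ^ (d - 1) := by
    rw [← pow_add, ← pow_add]
    congr 1
    obtain ⟨d, rfl⟩ := Nat.exists_eq_add_of_le hd
    obtain ⟨m, rfl⟩ := Nat.exists_eq_add_of_le hm
    simp only [Nat.add_sub_cancel_left, show 2 + d - 1 = d + 1 by omega]
    ring
  calc _ = C c ^ 3 * ((C b * p 0 ^ m) ^ (d - 1) * bind₁ H R * (C l * p 0 ^ (m - 1 + δ))) := by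
        rw [mul_pow, C_pow b, C_pow c, pow_add, pow_mul]; ring
    _ = C l * (C x * p 0 ^ d) ^ (m - 1 + δ) * (p 0 ^ (d - 1) * RF) := h1.symm
    _ = (C x ^ (m - 1 + δ)) * C l * (p 0 ^ (d * (m - 1 + δ)) * p 0 ^ (d - 1)) * RF := by
        rw [mul_pow, pow_mul]; ring
    _ = _ := by rw [← h2, ← h3]; ring

end
section
variable {k : Type*} [Field k]

lemma jdet_pow_mul (P U v : MvPolynomial (Fin 3) k) (κ : k) (a m : ℕ) (hm : 1 ≤ m) :
    jdet ![P ^ a * U, v, C κ * P ^ m] =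
      P ^ (a + (m - 1)) * (C κ * (m : MvPolynomial (Fin 3) k) * jdet ![U, v, P]) := by
  obtain ⟨m, rfl⟩ := Nat.exists_eq_add_of_le' hm
  simp only [jdet, det_fin_three, jac_apply, Matrix.cons_val, Derivation.leibniz,
    Derivation.leibniz_pow, pderiv_C, smul_eq_mul, nsmul_eq_mul]
  rcases a with _ | a
  · simp
    ring
  · simp only [Nat.add_sub_cancel]
    push_cast
    ring

lemma Core.pow_dvd_jdet [CharZero k] {d m δ : ℕ} {G H : Fin 3 → MvPolynomial (Fin 3) k}
    {P T R : MvPolynomial (Fin 3) k} {w : Fin 3 → k} (K : Core d m δ G H P T R w) (hm : 1 ≤ m)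
    (v : MvPolynomial (Fin 3) k) {u : MvPolynomial (Fin 3) k} {a : ℕ} (hu : P ^ a ∣ bind₁ H u) :
    P ^ (a - δ) ∣ bind₁ H (jdet ![u, v, T]) := by
  obtain ⟨U, hU⟩ := hu
  obtain ⟨κ, hκ, hT⟩ := K.T_H
  obtain ⟨l, hl, hJ⟩ := K.J_H
  have h1 : bind₁ H (jdet ![u, v, T]) * jdet H = jdet ![P ^ a * U, bind₁ H v, C κ * P ^ m] := by
    rw [← jdet_comp]
    congr 1
    funext i
    fin_cases i
    · exact hU
    · rfl
    · exact hT
  rw [jdet_pow_mul _ _ _ _ _ _ hm, hJ] at h1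
  have h2 : P ^ (m - 1) * (P ^ δ * (C l * bind₁ H (jdet ![u, v, T]))) =
      P ^ (m - 1) * (P ^ a * (C κ * (m : MvPolynomial (Fin 3) k) * jdet ![U, bind₁ H v, P])) := by
    rw [pow_add, pow_add] at h1
    linear_combination h1
  have h3 := mul_left_cancel₀ (pow_ne_zero _ K.prime.ne_zero) h2
  rcases le_total a δ with h | h
  · rw [Nat.sub_eq_zero_of_le h, pow_zero]
    exact one_dvd _
  · obtain ⟨b, rfl⟩ := Nat.exists_eq_add_of_le h
    rw [pow_add, mul_assoc] at h3
    have h4 := mul_left_cancel₀ (pow_ne_zero _ K.prime.ne_zero) h3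
    rw [Nat.add_sub_cancel_left, ← (isUnit_iff_exists_C.2 ⟨l, hl, rfl⟩).dvd_mul_left, h4]
    exact Dvd.intro _ rfl

lemma Core.pow_dvd_iterate [CharZero k] {d m δ : ℕ} {G H : Fin 3 → MvPolynomial (Fin 3) k}
    {P T R : MvPolynomial (Fin 3) k} {w : Fin 3 → k} (K : Core d m δ G H P T R w) (hm : 1 ≤ m)
    (v : MvPolynomial (Fin 3) k) {u : MvPolynomial (Fin 3) k} {a : ℕ} (hu : P ^ a ∣ bind₁ H u)
    (n : ℕ) : P ^ (a - n * δ) ∣ bind₁ H ((fun u => jdet ![u, v, T])^[n] u) := by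
  induction n with
  | zero => simpa using hu
  | succ n ih =>
    rw [Function.iterate_succ_apply', show a - (n + 1) * δ = a - n * δ - δ by
      rw [add_mul, one_mul, Nat.sub_sub]]
    exact K.pow_dvd_jdet hm v ih

lemma derivative_aeval (γ : Fin 3 → Polynomial k) (u : MvPolynomial (Fin 3) k) :
    Polynomial.derivative (aeval γ u) =
      ∑ i, aeval γ (pderiv i u) * Polynomial.derivative (γ i) := by
  induction u using MvPolynomial.induction_on with
  | C a => simp
  | add p q hp hq => simp [hp, hq, add_mul, Finset.sum_add_distrib]
  | mul_X p j hp =>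
    have h1 : ∀ i, aeval γ (pderiv i (p * X j)) =
        aeval γ p * aeval γ (pderiv i (X j : MvPolynomial (Fin 3) k)) +
        γ j * aeval γ (pderiv i p) := fun i => by
      rw [Derivation.leibniz, smul_eq_mul, smul_eq_mul, map_add, map_mul, map_mul, aeval_X]
    have h2 : ∑ i, aeval γ (pderiv i (X j : MvPolynomial (Fin 3) k)) * Polynomial.derivative (γ i) =
        Polynomial.derivative (γ j) := by
      rw [Finset.sum_eq_single j]
      · rw [pderiv_X_self, map_one, one_mul]
      · intro i _ hij
        rw [pderiv_X_of_ne hij.symm, map_zero, zero_mul]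
      · simp
    rw [map_mul, aeval_X, Polynomial.derivative_mul, hp, ← h2, Finset.sum_mul, Finset.mul_sum,
      ← Finset.sum_add_distrib]
    exact Finset.sum_congr rfl fun i _ => by rw [h1]; ring

lemma sum_mul_aeval_pderiv {u : MvPolynomial (Fin 3) k} {n : ℕ} (hu : u.IsHomogeneous n)
    (γ : Fin 3 → Polynomial k) :
    ∑ i, γ i * aeval γ (pderiv i u) = (n : Polynomial k) * aeval γ u := by
  have := congrArg (aeval γ) hu.sum_X_mul_pderiv
  simpa [map_sum, nsmul_eq_mul] using this

lemma dvd_bind₁_sub_bind₁ {P : MvPolynomial (Fin 3) k} {A B : Fin 3 → MvPolynomial (Fin 3) k}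
    (h : ∀ i, P ∣ A i - B i) (u : MvPolynomial (Fin 3) k) : P ∣ bind₁ A u - bind₁ B u := by
  induction u using MvPolynomial.induction_on with
  | C a => simp
  | add p q hp hq =>
    rw [map_add, map_add, add_sub_add_comm]
    exact dvd_add hp hq
  | mul_X p i hp =>
    rw [map_mul, map_mul, bind₁_X_right, bind₁_X_right,
      show bind₁ A p * A i - bind₁ B p * B i =
        (bind₁ A p - bind₁ B p) * A i + bind₁ B p * (A i - B i) by ring]
    exact dvd_add (Dvd.dvd.mul_right hp _) (Dvd.dvd.mul_left (h i) _)

lemma bind₁_C_eq (w : Fin 3 → k) (u : MvPolynomial (Fin 3) k) :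
    bind₁ (fun i => C (σ := Fin 3) (w i)) u = C (eval w u) := by
  induction u using MvPolynomial.induction_on with
  | C a => simp
  | add p q hp hq => simp [hp, hq]
  | mul_X p i hp => simp [hp]

/-- Modulo `P`, the value of a form on `h • w` is its value at `w` times a power of `h`. -/
lemma dvd_bind₁_sub {P h : MvPolynomial (Fin 3) k} {A : Fin 3 → MvPolynomial (Fin 3) k}
    {w : Fin 3 → k} (hA : ∀ i, P ∣ A i - C (w i) * h) {u : MvPolynomial (Fin 3) k} {n : ℕ}
    (hu : u.IsHomogeneous n) : P ∣ bind₁ A u - h ^ n * C (eval w u) := by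
  rw [← bind₁_C_eq, ← bind₁_mul_of_isHomogeneous hu]
  exact dvd_bind₁_sub_bind₁ (fun i => by rw [mul_comm h]; exact hA i) u

lemma exists_decomposition {i j l : Fin 3} (hijl : ∀ x, x = i ∨ x = j ∨ x = l) (hij : i ≠ j)
    (hlj : l ≠ j)
    {W : MvPolynomial (Fin 3) k} {n : ℕ} (hW : W.IsHomogeneous (n + 1)) :
    ∃ a b : MvPolynomial (Fin 3) k, a.IsHomogeneous n ∧ b.IsHomogeneous n ∧
      W = C (eval (Pi.single j 1) W) * X j ^ (n + 1) + X i * a + X l * b := by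
  have h1 : ∀ u : MvPolynomial (Fin 3) k, ∃ a b, u =
      bind₁ (fun x => X j * C (σ := Fin 3) ((Pi.single j 1 : Fin 3 → k) x)) u + X i * a +
          X l * b := fun u => by
    induction u using MvPolynomial.induction_on with
    | C a => exact ⟨0, 0, by simp⟩
    | add p q hp hq =>
      obtain ⟨a, b, h⟩ := hp
      obtain ⟨a', b', h'⟩ := hq
      refine ⟨a + a', b + b', ?_⟩
      rw [map_add]
      linear_combination h + h'
    | mul_X p x hp =>
      obtain ⟨a, b, h⟩ := hp
      rw [map_mul, bind₁_X_right]
      set y := bind₁ (fun x => X j * C (σ := Fin 3) ((Pi.single j 1 : Fin 3 → k) x)) p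
      rcases hijl x with rfl | rfl | rfl
      · refine ⟨p, 0, ?_⟩
        simp [Pi.single_eq_of_ne hij]
        ring
      · refine ⟨a * X x, b * X x, ?_⟩
        simp
        linear_combination X x * h
      · refine ⟨0, p, ?_⟩
        simp [Pi.single_eq_of_ne hlj]
        ring
  obtain ⟨a, b, h⟩ := h1 W
  rw [bind₁_mul_of_isHomogeneous hW, bind₁_C_eq] at h
  refine ⟨homogeneousComponent n a, homogeneousComponent n b,
      homogeneousComponent_isHomogeneous _ _,
    homogeneousComponent_isHomogeneous _ _, ?_⟩
  have h2 := congrArg (homogeneousComponent (n + 1)) h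
  have h3 : (X j ^ (n + 1) * C (eval (Pi.single j 1) W) :
      MvPolynomial (Fin 3) k).IsHomogeneous (n + 1) := by
    simpa using (isHomogeneous_X_pow j (n + 1)).mul (isHomogeneous_C (Fin 3)
      (eval (Pi.single j 1) W))
  have h4 : ∀ i (q : MvPolynomial (Fin 3) k), homogeneousComponent (n + 1) (X i * q) =
      X i * homogeneousComponent n q := fun i q => by
    rw [homogeneousComponent_mul_of_isHomogeneous (isHomogeneous_X k i), if_pos (by omega),
      Nat.add_sub_cancel]
  rw [map_add, map_add, h4, h4, homogeneousComponent_eq_self hW, homogeneousComponent_eq_self h3]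
    at h2
  linear_combination h2

end
section
variable {k : Type*} [Field k]

lemma exists_eq_C_mul_X_pow [IsAlgClosed k] {f h : Polynomial k} {D : ℕ}
    (hf : ∀ t, f.eval t = 0 → t = 0) (hfh : ∀ s, s ≠ 0 → h.eval s = s ^ D * f.eval s⁻¹)
    (h0 : h.eval 0 ≠ 0) : ∃ c : k, c ≠ 0 ∧ f = Polynomial.C c * Polynomial.X ^ D := by
  have hf0 : f ≠ 0 := by
    rintro rfl
    exact one_ne_zero (hf 1 (by simp))
  have h1 : f.roots = Multiset.replicate f.natDegree 0 := by
    rw [Multiset.eq_replicate]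
    refine ⟨(IsAlgClosed.splits f).natDegree_eq_card_roots.symm, fun b hb => hf b ?_⟩
    exact (Polynomial.mem_roots hf0).1 hb
  have h2 := (IsAlgClosed.splits f).eq_prod_roots
  rw [h1] at h2
  simp only [Multiset.map_replicate, Polynomial.C_0, sub_zero, Multiset.prod_replicate] at h2
  set c := f.leadingCoeff
  have hc : c ≠ 0 := Polynomial.leadingCoeff_ne_zero.2 hf0
  set N := f.natDegree
  have h3 : Polynomial.X ^ N * h = Polynomial.C c * Polynomial.X ^ D := by
    refine Polynomial.eq_of_infinite_eval_eq _ _ (Set.Infinite.mono (s := {0}ᶜ) ?_ ?_)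
    · intro s hs
      have hs : s ≠ 0 := hs
      simp only [Set.mem_ofPred_eq, Polynomial.eval_mul, Polynomial.eval_pow, Polynomial.eval_X,
        Polynomial.eval_C, hfh s hs]
      rw [h2]
      simp only [Polynomial.eval_mul, Polynomial.eval_pow, Polynomial.eval_X, Polynomial.eval_C]
      have := pow_ne_zero N hs
      rw [inv_pow]
      field_simp
    · have : Infinite k := IsAlgClosed.instInfinite
      exact (Set.finite_singleton 0).infinite_compl
  have h4 : N = D := by
    rcases lt_trichotomy N D with h | h | h
    · obtain ⟨e, rfl⟩ := Nat.exists_eq_add_of_lt h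
      rw [show N + e + 1 = N + (e + 1) by ring, pow_add, mul_left_comm] at h3
      have h5 := mul_left_cancel₀ (pow_ne_zero _ Polynomial.X_ne_zero) h3
      rw [h5] at h0
      simp at h0
    · exact h
    · obtain ⟨e, he⟩ := Nat.exists_eq_add_of_lt h
      rw [he, show D + e + 1 = D + (e + 1) by ring, pow_add, mul_assoc, mul_comm (Polynomial.C c)]
        at h3
      have h5 := congrArg (Polynomial.eval 0)
        (mul_left_cancel₀ (pow_ne_zero _ Polynomial.X_ne_zero) h3)
      simp at h5
      exact absurd h5.symm hc
  exact ⟨c, hc, by rw [← h4]; exact h2⟩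

lemma coeff_iterate_derivative_X_pow_mul [CharZero k] {n : ℕ} {r : Polynomial k}
    (hr : r.coeff 0 ≠ 0) :
    (Polynomial.derivative^[n] (Polynomial.X ^ (n + 1) * r)).coeff 0 = 0 ∧
      (Polynomial.derivative^[n] (Polynomial.X ^ (n + 1) * r)).coeff 1 ≠ 0 := by
  rw [Polynomial.coeff_iterate_derivative, Polynomial.coeff_iterate_derivative]
  constructor
  · rw [Polynomial.coeff_X_pow_mul', if_neg (by omega), smul_zero]
  · rw [Polynomial.coeff_X_pow_mul', if_pos (by omega), show 1 + n - (n + 1) = 0 by omega,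
      nsmul_eq_mul]
    refine mul_ne_zero (Nat.cast_ne_zero.2 ?_) hr
    rw [Ne, Nat.descFactorial_eq_zero_iff_lt]
    omega

lemma Core.exists_step [CharZero k] {d m δ : ℕ} {G H : Fin 3 → MvPolynomial (Fin 3) k}
    {P T R v : MvPolynomial (Fin 3) k} {i j l : Fin 3} (K : Core d m δ G H P T R (Pi.single j 1))
    (hm : 1 ≤ m) (hd : 2 ≤ d)
    (hijl : ∀ x, x = i ∨ x = j ∨ x = l) (hij : i ≠ j) (hlj : l ≠ j)
    {γ : Fin 3 → Polynomial k} (hγi : γ i = Polynomial.X) (hγj : γ j = 1)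
    (hγl : Polynomial.X ^ 2 ∣ γ l)
    (hD : ∀ u, aeval γ (jdet ![u, v, T]) = Polynomial.derivative (aeval γ u)) {r : Polynomial k}
    (hθ : aeval γ R = Polynomial.X ^ (d - 1) * r) (hr : r.coeff 0 ≠ 0) {n : ℕ}
    (hW : ((fun u => jdet ![u, v, T])^[d - 2] R).IsHomogeneous (n + 1)) :
    P ∣ H i ∧ P ∣ H l ∧ ∃ a b, ¬ P ∣ bind₁ H a ∧ P ^ δ ∣ H i * bind₁ H a + H l * bind₁ H b := by
  obtain ⟨h, hh⟩ := K.contract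
  have hi : P ∣ H i := by simpa [Pi.single_eq_of_ne hij] using hh i
  have hl : P ∣ H l := by simpa [Pi.single_eq_of_ne hlj] using hh l
  have hj : ¬ P ∣ h := fun hP => by
    obtain ⟨x, hx⟩ := K.H_prim
    apply hx
    rcases hijl x with rfl | rfl | rfl
    · exact hi
    · exact (dvd_sub_left (Dvd.dvd.mul_left hP _)).1 (hh x)
    · exact hl
  set W := (fun u => jdet ![u, v, T])^[d - 2] R
  have hθW : aeval γ W = Polynomial.derivative^[d - 2] (aeval γ R) :=
    Function.Semiconj.iterate_right (f := aeval γ) (fun u => hD u) (d - 2) R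
  rw [hθ, show d - 1 = d - 2 + 1 by omega] at hθW
  obtain ⟨c0, c1⟩ := coeff_iterate_derivative_X_pow_mul (n := d - 2) hr
  rw [← hθW] at c0 c1
  obtain ⟨a, b, ha, hb, hWab⟩ := exists_decomposition hijl hij hlj hW
  have hγ0 : (fun x => (γ x).eval 0) = Pi.single j 1 := by
    funext x
    rcases hijl x with rfl | rfl | rfl
    · simp [hγi, Pi.single_eq_of_ne hij]
    · simp [hγj]
    · obtain ⟨q, hq⟩ := hγl
      simp [hq, Pi.single_eq_of_ne hlj]
  have h0 : ∀ u, (aeval γ u).coeff 0 = eval (Pi.single j 1) u := fun u => by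
    rw [Polynomial.coeff_zero_eq_eval_zero, eval_polynomial_aeval, hγ0]
  rw [h0] at c0
  rw [c0, C_0, zero_mul, zero_add] at hWab
  have ha0 : eval (Pi.single j 1) a ≠ 0 := by
    obtain ⟨q, hq⟩ := hγl
    rw [hWab, map_add, map_mul, map_mul, aeval_X, aeval_X, hγi, hq, Polynomial.coeff_add,
      Polynomial.coeff_X_mul, h0, mul_assoc, Polynomial.coeff_X_pow_mul', if_neg (by omega),
      add_zero] at c1
    exact c1
  refine ⟨hi, hl, a, b, fun hPa => ?_, ?_⟩
  · have h2 := (dvd_sub_right hPa).1 (dvd_bind₁_sub hh ha)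
    rcases K.prime.dvd_or_dvd h2 with h3 | h3
    · exact hj (K.prime.dvd_of_dvd_pow h3)
    · exact K.prime.not_isUnit (isUnit_of_dvd_unit h3 (isUnit_iff_exists_C.2 ⟨_, ha0, rfl⟩))
  · have h2 := K.pow_dvd_iterate hm v (a := (d - 1) * δ) K.R_H (d - 2)
    have h3 : (d - 1) * δ - (d - 2) * δ = δ := by
      rw [← Nat.sub_mul, show d - 1 - (d - 2) = 1 by omega, one_mul]
    rw [h3] at h2
    change P ^ δ ∣ bind₁ H W at h2
    rwa [hWab, map_add, map_mul, map_mul, bind₁_X_right, bind₁_X_right] at h2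

end
section
variable {k : Type*} [Field k]

lemma jdet_eq_zero_of_proportional {A : Fin 3 → MvPolynomial (Fin 3) k} {Q : MvPolynomial (Fin 3) k}
    {a b : k} (h0 : A 0 = C a * Q) (h2 : A 2 = C b * Q) : jdet A = 0 := by
  simp only [jdet, det_fin_three, jac_apply, h0, h2, Derivation.leibniz, pderiv_C,
    smul_eq_mul]
  ring

lemma isHomogeneous_iterate {D : MvPolynomial (Fin 3) k → MvPolynomial (Fin 3) k} {e : ℕ}
    (hD : ∀ u n, u.IsHomogeneous n → (D u).IsHomogeneous (n - e)) {u : MvPolynomial (Fin 3) k}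
    {n : ℕ} (hu : u.IsHomogeneous n) (j : ℕ) : (D^[j] u).IsHomogeneous (n - j * e) := by
  induction j with
  | zero => simpa using hu
  | succ j ih =>
    rw [Function.iterate_succ_apply', add_mul, one_mul, ← Nat.sub_sub]
    exact hD _ _ ih

lemma Core.shape_of_line [IsAlgClosed k] [CharZero k] {d m δ : ℕ}
    {G H : Fin 3 → MvPolynomial (Fin 3) k} {P R : MvPolynomial (Fin 3) k}
    (K : Core d m δ G H P (X 2) R (Pi.single 1 1)) (hd : 2 ≤ d) :
    ∃ r, aeval ![(Polynomial.X : Polynomial k), 1, 0] R = Polynomial.X ^ (d - 1) * r ∧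
      r.coeff 0 ≠ 0 := by
  set γ : Fin 3 → Polynomial k := ![Polynomial.X, 1, 0] with hγ
  have d0 : Polynomial.derivative (γ 0) = 1 := by simp [hγ]
  have d1 : Polynomial.derivative (γ 1) = 0 := by simp [hγ]
  have d2 : Polynomial.derivative (γ 2) = 0 := by simp [hγ]
  obtain ⟨c, hc, hT⟩ := K.T_G
  rw [bind₁_X_right] at hT
  have hder : ∀ u, Polynomial.derivative (aeval γ u) = aeval γ (pderiv 0 u) := fun u => by
    rw [derivative_aeval, Fin.sum_univ_three, d0, d1, d2]
    ring
  have heuler : ∀ i, Polynomial.X * aeval γ (pderiv 0 (G i)) + aeval γ (pderiv 1 (G i)) =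
      (d : Polynomial k) * aeval γ (G i) := fun i => by
    rw [← sum_mul_aeval_pderiv (K.G_hom i), Fin.sum_univ_three]
    simp only [hγ, Matrix.cons_val]
    ring
  have hG2 : ∀ v, v 2 = 0 → eval v (G 2) = 0 := fun v hv => by
    rw [hT, map_mul, map_pow, eval_X, hv, zero_pow (by omega), mul_zero]
  have hGw : ∀ v, v ≠ 0 → v 2 = 0 → eval v (G 0) = 0 → v 0 = 0 := fun v hv hv2 hv0 => by
    obtain ⟨b, hb⟩ := K.G_w v hv (eval v (G 1)) (fun i => by
      fin_cases i
      · simp [hv0]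
      · simp
      · simp [hG2 v hv2])
    rw [hb]
    simp
  have heval : ∀ t u, (aeval γ u).eval t = eval ![t, 1, 0] u := fun t u => by
    rw [eval_polynomial_aeval]
    congr 2
    funext i
    fin_cases i <;> simp [hγ]
  obtain ⟨g, hg, hg0⟩ := exists_eq_C_mul_X_pow (f := aeval γ (G 0))
    (h := aeval ![1, Polynomial.X, 0] (G 0)) (D := d)
    (fun t ht => hGw ![t, 1, 0] (fun h => one_ne_zero (congrFun h 1)) rfl (by rwa [heval] at ht))
    (fun s hs => by
      rw [heval, eval_polynomial_aeval, ← eval_smul_of_isHomogeneous (K.G_hom 0)]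
      congr 2
      funext i
      fin_cases i <;> simp [hs])
    (fun h => by
      rw [eval_polynomial_aeval] at h
      have h1 := hGw _ (fun h => ?_) ?_ h
      · simp at h1
      · simpa using congrFun h 0
      · simp)
  have hR : R = C (c * d) * (pderiv 0 (G 0) * pderiv 1 (G 1) - pderiv 1 (G 0) * pderiv 0 (G 1))
      := by
    refine mul_left_cancel₀ (pow_ne_zero (d - 1) (X_ne_zero (R := k) (2 : Fin 3))) ?_
    rw [← K.J_G]
    simp only [jdet, det_fin_three, jac_apply, hT, Derivation.leibniz, Derivation.leibniz_pow,
      pderiv_C, pderiv_X_self, smul_eq_mul, nsmul_eq_mul, C_mul,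
      pderiv_X_of_ne (show (2 : Fin 3) ≠ 0 by decide),
      pderiv_X_of_ne (show (2 : Fin 3) ≠ 1 by decide), C_eq_coe_nat]
    ring
  set g₁ := aeval γ (G 1)
  refine ⟨Polynomial.C (c * d ^ 2 * g) *
    ((d : Polynomial k) * g₁ - Polynomial.X * Polynomial.derivative g₁), ?_, ?_⟩
  · have e0 := heuler 0
    have e1 := heuler 1
    have f0 := hder (G 0)
    rw [← hder] at e0 e1
    have f1 : Polynomial.derivative (aeval γ (G 0)) =
        Polynomial.C (g * d) * Polynomial.X ^ (d - 1) := by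
      rw [hg0, Polynomial.derivative_C_mul, Polynomial.derivative_X_pow, ← mul_assoc,
        ← Polynomial.C_mul]
    have f2 : (Polynomial.X : Polynomial k) ^ d = Polynomial.X ^ (d - 1) * Polynomial.X := by
      rw [← pow_succ]
      congr 1
      omega
    have e0' : aeval γ (pderiv 1 (G 0)) = 0 := by
      rw [f1, hg0] at e0
      have h3 : (Polynomial.C (g * d) : Polynomial k) = Polynomial.C g * d := by simp
      rw [h3] at e0
      linear_combination e0 + (d : Polynomial k) * Polynomial.C g * f2
    rw [hR, map_mul, map_sub, map_mul (aeval γ) (pderiv 0 (G 0)),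
      map_mul (aeval γ) (pderiv 1 (G 0)), ← hder, f1, e0', zero_mul, sub_zero, algHom_C]
    have h5 : aeval γ (pderiv 1 (G 1)) = (d : Polynomial k) * g₁ -
        Polynomial.X * Polynomial.derivative g₁ := by linear_combination e1
    rw [h5]
    simp only [Polynomial.C_mul, Polynomial.C_pow, Polynomial.algebraMap_eq,
      Polynomial.C_eq_natCast]
    ring
  · rw [Polynomial.coeff_zero_eq_eval_zero]
    have hd0 : (d : k) ≠ 0 := Nat.cast_ne_zero.2 (by omega)
    simp only [Polynomial.eval_mul, Polynomial.eval_C, Polynomial.eval_sub,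
      Polynomial.eval_natCast, Polynomial.eval_X, zero_mul, sub_zero]
    refine mul_ne_zero (mul_ne_zero (mul_ne_zero hc (pow_ne_zero 2 hd0)) hg)
        (mul_ne_zero hd0 fun h => ?_)
    rw [heval] at h
    have hv : (![0, 1, 0] : Fin 3 → k) ≠ 0 := fun h => one_ne_zero (congrFun h 1)
    obtain ⟨i, hi⟩ := K.G_nz _ hv
    have h0 : eval ![0, 1, 0] (G 0) = 0 := by
      rw [← heval, hg0]
      simp [show d ≠ 0 by omega]
    fin_cases i
    · exact hi h0
    · exact hi h
    · exact hi (hG2 _ rfl)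

lemma Core.false_of_line [IsAlgClosed k] [CharZero k] {d m δ : ℕ}
    {G H : Fin 3 → MvPolynomial (Fin 3) k} {P R : MvPolynomial (Fin 3) k}
    (K : Core d m δ G H P (X 2) R (Pi.single 1 1)) (hd : 2 ≤ d) (hm : 1 ≤ m) (hδ : m ≤ δ)
    (hP : P.IsHomogeneous 1) : False := by
  have hPX : (X 2 : MvPolynomial (Fin 3) k) ^ (d - 1) ≠ 0 := pow_ne_zero _ (X_ne_zero _)
  have hJ := isHomogeneous_jdet K.G_hom
  rw [K.J_G] at hJ
  have hR := isHomogeneous_of_mul_left (isHomogeneous_X_pow 2 (d - 1)) hPX hJ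
  have hD : ∀ u : MvPolynomial (Fin 3) k, jdet ![u, X 1, X 2] = pderiv 0 u := fun u => by
    simp [jdet, det_fin_three, jac_apply,
      pderiv_X_of_ne (show (2 : Fin 3) ≠ 1 by decide),
      pderiv_X_of_ne (show (1 : Fin 3) ≠ 2 by decide)]
  obtain ⟨r, hr, hr0⟩ := K.shape_of_line hd
  have hW := isHomogeneous_iterate (D := fun u => jdet ![u, X 1, X 2]) (e := 1)
    (fun u n hu => by rw [hD]; exact hu.pderiv) hR (d - 2)
  rw [show 3 * (d - 1) - (d - 1) - (d - 2) * 1 = d - 1 + 1 by omega] at hW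
  obtain ⟨⟨u, hu⟩, -, a, b, ha, hab⟩ := K.exists_step (i := 0) (l := 2) (j := 1)
    (γ := ![Polynomial.X, 1, 0]) (v := X 1) hm hd (by decide) (by decide) (by decide) rfl rfl
    (dvd_zero _) (fun u => by
      rw [hD, derivative_aeval, Fin.sum_univ_three]
      simp) hr hr0 hW
  obtain ⟨c, hc, hT⟩ := K.T_H
  rw [bind₁_X_right] at hT
  obtain ⟨l, hl, hJH⟩ := K.J_H
  have h1 : P ^ m ∣ H 0 * bind₁ H a := by
    refine (dvd_add_left ?_).1 ((pow_dvd_pow P hδ).trans hab)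
    rw [hT]
    exact (Dvd.intro_left _ rfl).mul_right _
  have hPm : P ^ m ≠ 0 := pow_ne_zero _ K.prime.ne_zero
  obtain ⟨q, hq⟩ := K.prime.pow_dvd_of_dvd_mul_right m ha h1
  have hH := K.H_hom 0
  rw [hq] at hH
  have hPm' : (P ^ m).IsHomogeneous m := by simpa using hP.pow m
  have hq0 := isHomogeneous_of_mul_left hPm' hPm hH
  rw [Nat.sub_self] at hq0
  have h2 := totalDegree_eq_zero_iff_eq_C.1 (Nat.le_zero.1 hq0.totalDegree_le)
  rw [h2, mul_comm] at hq
  rw [jdet_eq_zero_of_proportional hq hT] at hJH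
  exact mul_ne_zero (C_ne_zero.2 hl) (pow_ne_zero _ K.prime.ne_zero) hJH.symm

end
section
variable {k : Type*} [Field k]

lemma Core.shape_of_conic [IsAlgClosed k] [CharZero k] {d m δ : ℕ}
    {G H : Fin 3 → MvPolynomial (Fin 3) k} {P R : MvPolynomial (Fin 3) k}
    (K : Core d m δ G H P (X 1 ^ 2 - X 0 * X 2) R (Pi.single 0 1)) (hd : 2 ≤ d) :
    ∃ r, aeval ![1, (Polynomial.X : Polynomial k), Polynomial.X ^ 2] R =
      Polynomial.X ^ (d - 1) * r ∧ r.coeff 0 ≠ 0 := by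
  set γ : Fin 3 → Polynomial k := ![1, Polynomial.X, Polynomial.X ^ 2] with hγ
  have g0 : γ 0 = 1 := rfl
  have g1 : γ 1 = Polynomial.X := rfl
  have g2 : γ 2 = Polynomial.X ^ 2 := rfl
  obtain ⟨c, hc, hT⟩ := K.T_G
  rw [map_sub, map_mul, map_pow, bind₁_X_right, bind₁_X_right, bind₁_X_right] at hT
  have hder : ∀ u, Polynomial.derivative (aeval γ u) =
      aeval γ (pderiv 1 u) + 2 * Polynomial.X * aeval γ (pderiv 2 u) := fun u => by
    rw [derivative_aeval, Fin.sum_univ_three, g0, g1, g2]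
    simp
    ring
  have heuler : ∀ i, aeval γ (pderiv 0 (G i)) + Polynomial.X * aeval γ (pderiv 1 (G i)) +
      Polynomial.X ^ 2 * aeval γ (pderiv 2 (G i)) = (d : Polynomial k) * aeval γ (G i) :=
          fun i => by
    rw [← sum_mul_aeval_pderiv (K.G_hom i), Fin.sum_univ_three, g0, g1, g2]
    ring
  have hGT : ∀ v : Fin 3 → k, v 1 ^ 2 = v 0 * v 2 →
      eval v (G 1) ^ 2 = eval v (G 0) * eval v (G 2) := fun v hv => by
    have h1 := congrArg (eval v) hT
    simp only [map_sub, map_mul, map_pow, eval_X, eval_C, hv, sub_self] at h1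
    rw [zero_pow (by omega), mul_zero] at h1
    exact sub_eq_zero.1 h1
  have hGw : ∀ v : Fin 3 → k, v ≠ 0 → v 1 ^ 2 = v 0 * v 2 → eval v (G 2) = 0 →
      v 1 = 0 ∧ v 2 = 0 := fun v hv hvT hv2 => by
    have h1 := hGT v hvT
    rw [hv2, mul_zero, sq_eq_zero_iff] at h1
    obtain ⟨b, hb⟩ := K.G_w v hv (eval v (G 0)) (fun i => by
      fin_cases i
      · simp
      · simp [h1]
      · simp [hv2])
    rw [hb]
    simp
  have heval : ∀ t u, (aeval γ u).eval t = eval ![1, t, t ^ 2] u := fun t u => by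
    rw [eval_polynomial_aeval]
    congr 2
    funext i
    fin_cases i <;> simp [hγ]
  obtain ⟨g, hg, hg2⟩ := exists_eq_C_mul_X_pow (f := aeval γ (G 2))
    (h := aeval ![Polynomial.X ^ 2, Polynomial.X, 1] (G 2)) (D := 2 * d)
    (fun t ht => (hGw ![1, t, t ^ 2] (fun h => one_ne_zero (congrFun h 0)) (by simp)
      (by rwa [heval] at ht)).1)
    (fun s hs => by
      rw [heval, eval_polynomial_aeval, pow_mul, ← eval_smul_of_isHomogeneous (K.G_hom 2)]
      congr 2
      funext i
      fin_cases i
      · simp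
      · simp [pow_two, hs]
      · simp [hs])
    (fun h => by
      rw [eval_polynomial_aeval] at h
      have h1 := (hGw _ (fun h => ?_) ?_ h).2
      · simp at h1
      · simpa using congrFun h 2
      · simp)
  have hgT : aeval γ (G 1) ^ 2 = aeval γ (G 0) * aeval γ (G 2) := by
    have h1 := congrArg (aeval γ) hT
    simp only [map_sub, map_mul, map_pow, aeval_X, g0, g1, g2] at h1
    rw [one_mul, sub_self, zero_pow (by omega), mul_zero] at h1
    exact sub_eq_zero.1 h1
  obtain ⟨h, hh⟩ : Polynomial.X ^ d ∣ aeval γ (G 1) := by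
    rw [← IsIntegrallyClosed.pow_dvd_pow_iff two_ne_zero, ← pow_mul, hgT, hg2, mul_comm d]
    exact (Dvd.intro_left _ rfl).mul_left _
  have hh2 : h ^ 2 = Polynomial.C g * aeval γ (G 0) := by
    rw [hh, hg2, mul_pow, ← pow_mul, mul_comm d] at hgT
    apply mul_left_cancel₀ (pow_ne_zero (2 * d) (Polynomial.X_ne_zero (R := k)))
    rw [hgT]
    ring
  have hv : (![1, 0, 0] : Fin 3 → k) ≠ 0 := fun h => one_ne_zero (congrFun h 0)
  have hg0 : (aeval γ (G 0)).eval 0 ≠ 0 := fun h0 => by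
    have h1 : (aeval γ (G 1)).eval 0 = 0 := by rw [hh]; simp [show d ≠ 0 by omega]
    have h2 : (aeval γ (G 2)).eval 0 = 0 := by rw [hg2]; simp [show d ≠ 0 by omega]
    rw [heval, zero_pow two_ne_zero] at h0 h1 h2
    obtain ⟨i, hi⟩ := K.G_nz _ hv
    fin_cases i
    · exact hi h0
    · exact hi h1
    · exact hi h2
  have hR : G 0 * R = - C (c * d) * jdet ![G 0, G 1, X 1 ^ 2 - X 0 * X 2] := by
    have hTne : (X 1 ^ 2 - X 0 * X 2 : MvPolynomial (Fin 3) k) ≠ 0 := fun h => by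
      have := congrArg (eval ![0, 1, 0]) h
      simp at this
    refine mul_left_cancel₀ (pow_ne_zero (d - 1) hTne) ?_
    have h1 : jdet ![G 0, G 1, G 1 ^ 2 - G 0 * G 2] = - (G 0 * jdet G) := by
      simp only [jdet, det_fin_three, jac_apply, Matrix.cons_val, map_sub, Derivation.leibniz,
        Derivation.leibniz_pow, smul_eq_mul, nsmul_eq_mul]
      ring
    have h3 : jdet ![G 0, G 1, C c * (X 1 ^ 2 - X 0 * X 2) ^ d] =
        (X 1 ^ 2 - X 0 * X 2) ^ (d - 1) *
          (C c * (d : MvPolynomial (Fin 3) k) * jdet ![G 0, G 1, X 1 ^ 2 - X 0 * X 2]) := by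
      have := jdet_pow_mul (X 1 ^ 2 - X 0 * X 2) (G 0) (G 1) c 0 d (by omega)
      rwa [pow_zero, one_mul, zero_add] at this
    rw [hT, h3, K.J_G] at h1
    rw [C_mul, C_eq_coe_nat]
    linear_combination h1
  have hJ : aeval γ (jdet ![G 0, G 1, X 1 ^ 2 - X 0 * X 2]) = (d : Polynomial k) *
      (Polynomial.derivative (aeval γ (G 0)) * aeval γ (G 1) -
        aeval γ (G 0) * Polynomial.derivative (aeval γ (G 1))) := by
    have p0 : pderiv 0 (X 1 ^ 2 - X 0 * X 2 : MvPolynomial (Fin 3) k) = - X 2 := by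
      simp [Derivation.leibniz_pow, pderiv_X_of_ne (show (2 : Fin 3) ≠ 0 by decide)]
    have p1 : pderiv 1 (X 1 ^ 2 - X 0 * X 2 : MvPolynomial (Fin 3) k) = 2 * X 1 := by
      simp [Derivation.leibniz_pow, pderiv_X_of_ne (show (2 : Fin 3) ≠ 1 by decide)]
    have p2 : pderiv 2 (X 1 ^ 2 - X 0 * X 2 : MvPolynomial (Fin 3) k) = - X 0 := by
      simp [Derivation.leibniz_pow, pderiv_X_of_ne (show (0 : Fin 3) ≠ 2 by decide),
        pderiv_X_of_ne (show (1 : Fin 3) ≠ 2 by decide)]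
    have e0 := heuler 0
    have e1 := heuler 1
    have f0 := hder (G 0)
    have f1 := hder (G 1)
    simp only [jdet, det_fin_three, jac_apply, Matrix.cons_val, p0, p1, p2, map_sub, map_add,
      map_mul, map_neg, aeval_X, g0, g1, g2, map_ofNat]
    rw [f0, f1]
    linear_combination -(aeval γ (pderiv 1 (G 1)) + 2 * Polynomial.X * aeval γ (pderiv 2 (G 1)))
        * e0 +
      (aeval γ (pderiv 1 (G 0)) + 2 * Polynomial.X * aeval γ (pderiv 2 (G 0))) * e1
  set A := aeval γ (G 0)
  have hAR : A * aeval γ R = Polynomial.X ^ (d - 1) * (Polynomial.C (c * d ^ 2) *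
      ((d : Polynomial k) * A * h +
        Polynomial.X * (A * Polynomial.derivative h - Polynomial.derivative A * h))) := by
    rw [← map_mul, hR, map_mul, map_neg, algHom_C, hJ, hh, Polynomial.derivative_mul,
      Polynomial.derivative_X_pow]
    have f2 : (Polynomial.X : Polynomial k) ^ d = Polynomial.X ^ (d - 1) * Polynomial.X := by
      rw [← pow_succ]
      congr 1
      omega
    rw [f2]
    simp only [Polynomial.C_mul, Polynomial.C_pow, Polynomial.algebraMap_eq,
      Polynomial.C_eq_natCast]
    ring
  have hXA : ¬ (Polynomial.X ∣ A) := by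
    rwa [Polynomial.X_dvd_iff, Polynomial.coeff_zero_eq_eval_zero]
  obtain ⟨r, hr⟩ := Polynomial.prime_X.pow_dvd_of_dvd_mul_left (d - 1) hXA (Dvd.intro _ hAR.symm)
  refine ⟨r, hr, fun hr0 => ?_⟩
  rw [hr, mul_left_comm] at hAR
  have h1 := congrArg (Polynomial.eval 0)
    (mul_left_cancel₀ (pow_ne_zero _ Polynomial.X_ne_zero) hAR)
  rw [Polynomial.coeff_zero_eq_eval_zero] at hr0
  simp only [Polynomial.eval_mul, Polynomial.eval_add, Polynomial.eval_C, Polynomial.eval_natCast,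
    Polynomial.eval_X, zero_mul, add_zero, hr0, mul_zero] at h1
  have hd0 : (d : k) ≠ 0 := Nat.cast_ne_zero.2 (by omega)
  have hh0 : h.eval 0 ≠ 0 := fun h0 => by
    have h2 := congrArg (Polynomial.eval 0) hh2
    rw [Polynomial.eval_pow, h0, Polynomial.eval_mul, Polynomial.eval_C, zero_pow two_ne_zero]
      at h2
    exact mul_ne_zero hg hg0 h2.symm
  exact mul_ne_zero (mul_ne_zero hc (pow_ne_zero 2 hd0)) (mul_ne_zero (mul_ne_zero hd0 hg0) hh0)
    h1.symm

lemma Core.false_of_conic [IsAlgClosed k] [CharZero k] {d m δ : ℕ}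
    {G H : Fin 3 → MvPolynomial (Fin 3) k} {P R : MvPolynomial (Fin 3) k}
    (K : Core d m δ G H P (X 1 ^ 2 - X 0 * X 2) R (Pi.single 0 1)) (hd : 2 ≤ d)
    (hm : m = 2 * δ + 1) (hδ : 1 ≤ δ) (hP : P.IsHomogeneous 2) : False := by
  set T : MvPolynomial (Fin 3) k := X 1 ^ 2 - X 0 * X 2 with hTdef
  have hT2 : T.IsHomogeneous 2 :=
    (isHomogeneous_X_pow 1 2).sub ((isHomogeneous_X k 0).mul (isHomogeneous_X k 2))
  have hTne : T ≠ 0 := fun h => by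
    have := congrArg (eval ![0, 1, 0]) h
    simp [hTdef] at this
  have hJ := isHomogeneous_jdet K.G_hom
  rw [K.J_G] at hJ
  have hR := isHomogeneous_of_mul_left (hT2.pow (d - 1)) (pow_ne_zero _ hTne) hJ
  have hD : ∀ u : MvPolynomial (Fin 3) k, jdet ![u, X 0, T] =
      X 0 * pderiv 1 u + 2 * (X 1 * pderiv 2 u) := fun u => by
    simp only [hTdef, jdet, det_fin_three, jac_apply, Matrix.cons_val, map_sub, Derivation.leibniz,
      Derivation.leibniz_pow, smul_eq_mul, nsmul_eq_mul, pderiv_X_self,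
      pderiv_X_of_ne (show (0 : Fin 3) ≠ 1 by decide),
      pderiv_X_of_ne (show (0 : Fin 3) ≠ 2 by decide),
      pderiv_X_of_ne (show (1 : Fin 3) ≠ 0 by decide),
      pderiv_X_of_ne (show (1 : Fin 3) ≠ 2 by decide),
      pderiv_X_of_ne (show (2 : Fin 3) ≠ 0 by decide),
      pderiv_X_of_ne (show (2 : Fin 3) ≠ 1 by decide)]
    push_cast
    ring
  obtain ⟨r, hr, hr0⟩ := K.shape_of_conic hd
  have hW := isHomogeneous_iterate (D := fun u => jdet ![u, X 0, T]) (e := 0)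
    (fun u n hu => by
      rw [hD, Nat.sub_zero]
      rcases n with _ | n
      · rw [totalDegree_eq_zero_iff_eq_C.1 (Nat.le_zero.1 hu.totalDegree_le)]
        simpa using isHomogeneous_zero (Fin 3) k 0
      · have h1 : (pderiv 1 u).IsHomogeneous n := hu.pderiv
        have h2 : (pderiv 2 u).IsHomogeneous n := hu.pderiv
        have h3 := (isHomogeneous_X k (0 : Fin 3)).mul h1
        have h4 := (isHomogeneous_X k (1 : Fin 3)).mul h2
        rw [two_mul, add_comm n]
        exact h3.add (h4.add h4)) hR (d - 2)
  rw [show 3 * (d - 1) - 2 * (d - 1) - (d - 2) * 0 = d - 2 + 1 by omega] at hW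
  obtain ⟨h1, h2, a, b, ha, hab⟩ := K.exists_step (i := 1) (l := 2) (j := 0)
    (γ := ![1, Polynomial.X, Polynomial.X ^ 2]) (v := X 0) (by omega) hd (by decide) (by decide)
    (by decide) rfl rfl dvd_rfl (fun u => by
      rw [hD, derivative_aeval, Fin.sum_univ_three]
      simp
      ring) hr hr0 hW
  obtain ⟨c, hc, hT⟩ := K.T_H
  rw [hTdef, map_sub, map_mul, map_pow, bind₁_X_right, bind₁_X_right, bind₁_X_right] at hT
  obtain ⟨l, hl, hJH⟩ := K.J_H
  have hH0 : ¬ P ∣ H 0 := fun h0 => by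
    obtain ⟨i, hi⟩ := K.H_prim
    fin_cases i
    · exact hi h0
    · exact hi h1
    · exact hi h2
  have hsq : ∀ n, 2 * n ≤ m → P ^ n ∣ H 1 → P ^ (2 * n) ∣ H 2 := fun n hn h => by
    refine K.prime.pow_dvd_of_dvd_mul_left _ hH0 ?_
    rw [show H 0 * H 2 = H 1 ^ 2 - C c * P ^ m by rw [← hT]; ring, mul_comm 2, pow_mul]
    refine dvd_sub (pow_dvd_pow_of_dvd h 2) ?_
    rw [← pow_mul]
    exact (pow_dvd_pow P (by omega)).mul_left _
  have hind : ∀ n, n + 1 ≤ δ → P ^ (n + 1) ∣ H 1 := fun n => by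
    induction n with
    | zero => exact fun _ => by simpa using h1
    | succ n ih =>
      intro hn
      have h3 := hsq (n + 1) (by omega) (ih (by omega))
      refine K.prime.pow_dvd_of_dvd_mul_right _ ha ((dvd_add_left ?_).1
        ((pow_dvd_pow P hn).trans hab))
      exact ((pow_dvd_pow P (by omega)).trans h3).mul_right _
  have h3 := hsq δ (by omega) (by simpa [show δ - 1 + 1 = δ by omega] using hind (δ - 1) (by omega))
  have hH2 : H 2 = 0 := by
    by_contra h0
    have h4 := totalDegree_le_of_dvd_of_isDomain h3 h0
    rw [(hP.pow _).totalDegree (pow_ne_zero _ K.prime.ne_zero), (K.H_hom 2).totalDegree h0] at h4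
    omega
  rw [jdet_eq_zero_of_proportional (Q := H 0) (a := 1) (b := 0) (by simp) (by simp [hH2])] at hJH
  exact mul_ne_zero (C_ne_zero.2 hl) (pow_ne_zero _ K.prime.ne_zero) hJH.symm

end
section
variable {k : Type*} [Field k]

lemma comp_nonvanishing {F G : Fin 3 → MvPolynomial (Fin 3) k}
    (hF : ∀ v : Fin 3 → k, v ≠ 0 → ∃ i, eval v (F i) ≠ 0)
    (hG : ∀ v : Fin 3 → k, v ≠ 0 → ∃ i, eval v (G i) ≠ 0) (v : Fin 3 → k) (hv : v ≠ 0) :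
    ∃ i, eval v (comp F G i) ≠ 0 := by
  simp only [comp, eval_bind₁]
  refine hF _ fun h => ?_
  obtain ⟨i, hi⟩ := hG v hv
  exact hi (congrFun h i)

variable [IsAlgClosed k] [CharZero k]

/-- The exceptional locus of a nonlinear conjugacy is not irreducible. -/
theorem Conj.false_of_single {d m m' : ℕ} {F G H H' : Fin 3 → MvPolynomial (Fin 3) k}
    {Q Q' : MvPolynomial (Fin 3) k} {c c' : k} (S : Conj d m m' F G H H' Q Q' c c') (hd : 2 ≤ d)
    (hm : 2 ≤ m) {r' : ℕ} {p : Fin 1 → MvPolynomial (Fin 3) k} {σ : Equiv.Perm (Fin 1)}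
    {e : Fin 1 → ℕ} {γ : Fin 1 → k} {p' : Fin r' → MvPolynomial (Fin 3) k}
    {σ' : Equiv.Perm (Fin r')} {e' : Fin r' → ℕ} {γ' : Fin r' → k}
    (D : PrimeData F d Q p σ γ e) (D' : PrimeData G d Q' p' σ' γ' e') : False := by
  have : Infinite k := IsAlgClosed.instInfinite
  have h1 := D.sum_le
  have h2 := D.degree_pos 0
  rw [univ_unique, sum_singleton, Fin.default_eq_zero] at h1
  obtain h3 | h12 : (p 0).totalDegree = 3 ∨ ((p 0).totalDegree = 1 ∨ (p 0).totalDegree = 2) := by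
    omega
  · obtain ⟨a, ha, hp⟩ := D.pullback_single
    obtain ⟨B⟩ := exists_freeBasis (by omega) S.F_hom S.F_nz
    have K : CubicData F d p (fun _ => a) :=
      { two_le := hd
        F_hom := S.F_hom
        prime := D.prime
        eq_of_dvd := D.eq_of_dvd
        hom := D.hom
        pullback := fun i => by rw [Subsingleton.elim i 0]; exact hp
        c_ne := fun _ => ha
        sum_eq := by rw [univ_unique, sum_singleton, Fin.default_eq_zero, h3] }
    refine K.false_of_prime B ?_
    rw [univ_unique, prod_singleton]
    exact D.prime _
  · obtain ⟨T, R, w, δ, hT, hTs, hw, hwT, hmδ, K⟩ := S.exists_core hd D D' h12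
    have hP := D.hom 0
    rcases h12 with h | h <;> rw [h] at hTs hmδ hP
    · obtain ⟨M, hM, hMw, a, ha, hMT⟩ := exists_line_coordinates hTs hT.ne_zero hw hwT
      obtain ⟨G₁, H₁, R₁, K₁⟩ := K.transport hM hMw (T₁ := X 2) ha (fun v => by rw [hMT, eval_X])
      rw [show (![0, 1, 0] : Fin 3 → k) = Pi.single 1 1 by
        funext i; fin_cases i <;> simp] at K₁
      exact K₁.false_of_line hd (by omega) (by omega) hP
    · obtain ⟨M, hM, hMw, a, ha, hMT⟩ := exists_conic_coordinates hT hTs hw hwT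
      obtain ⟨G₁, H₁, R₁, K₁⟩ := K.transport hM hMw (T₁ := X 1 ^ 2 - X 0 * X 2) ha
        (fun v => by rw [hMT]; simp)
      rw [show (![1, 0, 0] : Fin 3 → k) = Pi.single 0 1 by
        funext i; fin_cases i <;> simp] at K₁
      exact K₁.false_of_conic hd (by omega) (by omega) hP

lemma PrimeData.totalDegree_eq_one {F : Fin 3 → MvPolynomial (Fin 3) k} {d : ℕ}
    {Q : MvPolynomial (Fin 3) k} {p : Fin 2 → MvPolynomial (Fin 3) k} {σ : Equiv.Perm (Fin 2)}
    {e : Fin 2 → ℕ} {γ : Fin 2 → k} (D : PrimeData F d Q p σ γ e) (hd : 2 ≤ d)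
    (hF : ∀ i, (F i).IsHomogeneous d) (hFnz : ∀ v : Fin 3 → k, v ≠ 0 → ∃ i, eval v (F i) ≠ 0)
    (i : Fin 2) : (p i).totalDegree = 1 := by
  by_contra hi
  have h1 := D.sum_le
  have h2 := D.degree_pos
  rw [Fin.sum_univ_two] at h1
  have h3 : (p 0).totalDegree + (p 1).totalDegree = 3 := by
    have := h2 0
    have := h2 1
    fin_cases i <;> simp only [Fin.zero_eta, Fin.mk_one] at hi <;> omega
  have hinv : ∀ i, σ (σ i) = i := by
    have : ∀ (σ : Equiv.Perm (Fin 2)) i, σ (σ i) = i := by decide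
    exact this σ
  have hhom : ∀ i, (comp F F i).IsHomogeneous (d * d) := fun i => (hF i).aeval F hF
  obtain ⟨B⟩ := exists_freeBasis (by nlinarith) hhom (comp_nonvanishing hFnz hFnz)
  have K : CubicData (comp F F) (d * d) p (fun i => γ i * γ (σ i) ^ e i) :=
    { two_le := by nlinarith
      F_hom := hhom
      prime := D.prime
      eq_of_dvd := D.eq_of_dvd
      hom := D.hom
      pullback := fun i => by
        have he : e (σ i) * e i = d * d := by
          have e1 := D.degree i
          have e2 := D.degree (σ i)
          rw [hinv] at e2
          refine Nat.eq_of_mul_eq_mul_right (h2 i) ?_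
          rw [mul_right_comm, e2, mul_assoc, mul_comm _ (e i), e1, mul_assoc]
        rw [bind₁_comp, D.pullback, map_mul, map_pow, D.pullback, bind₁_C_right, hinv, mul_pow,
          ← pow_mul, he, C_mul, C_pow]
        ring
      c_ne := fun i => mul_ne_zero (D.c_ne i) (pow_ne_zero _ (D.c_ne _))
      sum_eq := by rw [Fin.sum_univ_two, h3] }
  have h4 : ((p 0).totalDegree = 1 ∧ (p 1).totalDegree = 2) ∨
      ((p 1).totalDegree = 1 ∧ (p 0).totalDegree = 2) := by
    have := h2 0
    have := h2 1
    omega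
  rcases h4 with ⟨h, h'⟩ | ⟨h, h'⟩
  · exact K.false_of_line_conic B (i := 0) (j := 1) (by rw [Fin.prod_univ_two]) h h'
  · exact K.false_of_line_conic B (i := 1) (j := 0) (by rw [Fin.prod_univ_two, mul_comm]) h h'

end
section
variable {k : Type*} [Field k]

/-- Scaling factors which normalize a monomial map twisted by a permutation. -/
lemma exists_twisted_root [IsAlgClosed k] {d : ℕ} (hd : 2 ≤ d) (σ : Equiv.Perm (Fin 3))
    {c : Fin 3 → k} (hc : ∀ i, c i ≠ 0) :
    ∃ m : Fin 3 → k, (∀ i, m i ≠ 0) ∧ ∀ i, m (σ i) ^ d = c i * m i := by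
  have hd6 : 1 < d ^ 6 := Nat.one_lt_pow (by norm_num) (by omega)
  choose n hn using fun i => IsAlgClosed.exists_pow_nat_eq (c i) (n := d ^ 6 - 1) (by omega)
  have hn0 : ∀ i, n i ≠ 0 := fun i h => by
    have := hn i
    rw [h, zero_pow (by omega)] at this
    exact hc i this.symm
  have hσ : σ ^ 6 = 1 := by
    have := pow_card_eq_one (x := σ)
    rwa [Fintype.card_perm, Fintype.card_fin] at this
  refine ⟨fun i => ∏ j ∈ range 6, n ((σ ^ j) i) ^ d ^ j,
    fun i => prod_ne_zero_iff.2 fun j _ => pow_ne_zero _ (hn0 _), fun i => ?_⟩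
  apply mul_right_cancel₀ (hn0 i)
  have h1 := prod_range_succ (fun j => n ((σ ^ j) i) ^ d ^ j) 6
  rw [prod_range_succ', hσ] at h1
  simp only [pow_zero, Equiv.Perm.one_apply, pow_one] at h1
  have h2 : n i ^ d ^ 6 = c i * n i := by
    rw [← hn i, ← pow_succ]
    congr 1
    omega
  rw [h2] at h1
  rw [← prod_pow]
  have h3 : ∏ j ∈ range 6, (n ((σ ^ j) (σ i)) ^ d ^ j) ^ d =
      ∏ j ∈ range 6, n ((σ ^ (j + 1)) i) ^ d ^ (j + 1) :=
    prod_congr rfl fun j _ => by rw [← pow_mul, ← pow_succ, pow_succ σ, Equiv.Perm.mul_apply]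
  rw [h3, h1]
  ring

lemma PrimeData.exists_rows {F : Fin 3 → MvPolynomial (Fin 3) k} {d : ℕ}
    {Q : MvPolynomial (Fin 3) k} {r : ℕ} {p : Fin r → MvPolynomial (Fin 3) k}
    {σ : Equiv.Perm (Fin r)} {e : Fin r → ℕ} {γ : Fin r → k} (D : PrimeData F d Q p σ γ e)
    (h1 : ∀ i, (p i).totalDegree = 1) :
    ∃ b : Matrix (Fin r) (Fin 3) k, (∀ i, p i = ∑ j, C (b i j) * X j) ∧
      ∀ i, bind₁ F (p i) = C (γ i) * p (σ i) ^ d := by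
  choose b hb using fun i => exists_eq_sum_of_isHomogeneous_one (h1 i ▸ D.hom i)
  refine ⟨b, hb, fun i => ?_⟩
  have := D.degree i
  rw [h1, h1, mul_one, mul_one] at this
  rw [D.pullback, this]

lemma PrimeData.det_ne_zero [IsAlgClosed k] [CharZero k] {F : Fin 3 → MvPolynomial (Fin 3) k}
    {d : ℕ} {Q : MvPolynomial (Fin 3) k} {p : Fin 3 → MvPolynomial (Fin 3) k}
    {σ : Equiv.Perm (Fin 3)} {e : Fin 3 → ℕ} {γ : Fin 3 → k} (D : PrimeData F d Q p σ γ e)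
    (hd : 2 ≤ d) {b : Matrix (Fin 3) (Fin 3) k} (hb : ∀ i, p i = ∑ j, C (b i j) * X j)
    (hp : ∀ i, bind₁ F (p i) = C (γ i) * p (σ i) ^ d) : b.det ≠ 0 := by
  intro hdet
  have hinf : Infinite k := IsAlgClosed.instInfinite
  obtain ⟨u, hu, hub⟩ := exists_vecMul_eq_zero_iff.2 hdet
  have hev : ∀ i v, eval v (p i) = (b *ᵥ v) i := fun i v => by
    rw [hb, eval_C_sum]; rfl
  have hrel : ∀ v, ∑ i, u i * (b *ᵥ v) i = 0 := fun v => by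
    change u ⬝ᵥ b *ᵥ v = 0
    rw [dotProduct_mulVec, hub, zero_dotProduct]
  have hsep : ∀ i j, i ≠ j → ∃ v, (b *ᵥ v) i = 0 ∧ (b *ᵥ v) j = 1 := fun i j hij => by
    by_contra! hcon
    refine hij (D.eq_of_dvd i j (dvd_of_forall_eval_eq_zero (D.prime i) fun v hv => ?_))
    rw [hev] at hv ⊢
    by_contra h
    refine hcon (((b *ᵥ v) j)⁻¹ • v) ?_ ?_
    · rw [mulVec_smul, Pi.smul_apply, hv, smul_zero]
    · rw [mulVec_smul, Pi.smul_apply, smul_eq_mul, inv_mul_cancel₀ h]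
  have hrel' : ∀ v, ∑ i, u i * γ i * (b *ᵥ v) (σ i) ^ d = 0 := fun v => by
    rw [← hrel fun i => eval v (F i)]
    refine sum_congr rfl fun i _ => ?_
    rw [← hev i (fun i => eval v (F i)), ← eval_bind₁, hp, map_mul, map_pow, hev, eval_C, mul_assoc]
  have hu0 : ∀ i, u i ≠ 0 := by
    by_contra! ⟨i, hi⟩
    apply hu
    funext j
    by_cases hij : i = j
    · rw [← hij]; exact hi
    obtain ⟨l, hli, hlj⟩ : ∃ l, l ≠ i ∧ l ≠ j := by
      have : ∀ i j : Fin 3, ∃ l, l ≠ i ∧ l ≠ j := by decide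
      exact this i j
    obtain ⟨v, hv, hv'⟩ := hsep l j hlj
    have h1 := hrel v
    rw [← sum_subset (subset_univ {i, j, l}) (by
      have : ∀ i j l : Fin 3, i ≠ j → l ≠ i → l ≠ j → ∀ x ∈ univ, x ∉ ({i, j, l} : Finset _) →
        False := by decide
      exact fun x h h' => (this i j l hij hli hlj x h h').elim),
      sum_insert (by simp [hij, hli.symm]), sum_insert (by simp [hlj.symm]), sum_singleton, hi, hv,
      hv'] at h1
    simpa using h1
  set w : Fin 3 → k := fun i => u (σ.symm i) * γ (σ.symm i) with hw
  have hw0 : ∀ i, w i ≠ 0 := fun i => mul_ne_zero (hu0 _) (D.c_ne _)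
  have hrelw : ∀ v, ∑ i, w i * (b *ᵥ v) i ^ d = 0 := fun v => by
    rw [← hrel' v, ← Equiv.sum_comp σ]
    simp [hw]
  obtain ⟨v₀, h00, h01⟩ := hsep 0 1 (by decide)
  obtain ⟨v₁, h11, h10⟩ := hsep 1 0 (by decide)
  have hpoly : Polynomial.C (w 0) * Polynomial.X ^ d + Polynomial.C (w 1) +
      Polynomial.C (w 2 * (- (u 2)⁻¹) ^ d) *
        (Polynomial.C (u 0) * Polynomial.X + Polynomial.C (u 1)) ^ d = 0 := by
    refine Polynomial.funext fun s => ?_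
    have e1 := hrel (v₀ + s • v₁)
    have e2 := hrelw (v₀ + s • v₁)
    rw [Fin.sum_univ_three] at e1 e2
    simp only [mulVec_add, mulVec_smul, Pi.add_apply, Pi.smul_apply, smul_eq_mul, h00, h01, h10,
      h11, zero_add, mul_one, mul_zero, add_zero] at e1 e2
    have e3 : (b *ᵥ v₀) 2 + s * (b *ᵥ v₁) 2 = - (u 2)⁻¹ * (u 0 * s + u 1) := by
      have := hu0 2
      field_simp
      linear_combination e1
    rw [e3] at e2
    simp only [Polynomial.eval_add, Polynomial.eval_mul, Polynomial.eval_C, Polynomial.eval_pow,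
      Polynomial.eval_X, Polynomial.eval_zero]
    rw [← e2, mul_pow]
    ring
  have h1 := congrArg (Polynomial.eval 0) (congrArg Polynomial.derivative hpoly)
  have hd0 : (d : k) ≠ 0 := Nat.cast_ne_zero.2 (by omega)
  simp [Polynomial.derivative_pow, show d - 1 ≠ 0 by omega, hu0, hw0, hd0] at h1

/-- An endomorphism permuting three lines is a permuted power map in suitable coordinates. -/
theorem PrimeData.exists_power_form [IsAlgClosed k] [CharZero k]
    {F : Fin 3 → MvPolynomial (Fin 3) k} {d : ℕ} {Q : MvPolynomial (Fin 3) k}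
    {p : Fin 3 → MvPolynomial (Fin 3) k} {σ : Equiv.Perm (Fin 3)} {e : Fin 3 → ℕ} {γ : Fin 3 → k}
    (D : PrimeData F d Q p σ γ e) (hd : 2 ≤ d) :
    ∃ (M : GL (Fin 3) k) (c : kˣ) (σ : Equiv.Perm (Fin 3)), ∀ v : Fin 3 → k,
      (M : Matrix (Fin 3) (Fin 3) k).mulVec (fun i => eval v (F i)) =
        fun i => (c : k) * ((M : Matrix (Fin 3) (Fin 3) k).mulVec v (σ i)) ^ d := by
  have hdeg : ∀ i, (p i).totalDegree = 1 := fun i => by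
    have h1 := D.sum_le
    have h2 := D.degree_pos
    rw [Fin.sum_univ_three] at h1
    have := h2 0
    have := h2 1
    have := h2 2
    fin_cases i <;> simp only [Fin.zero_eta, Fin.mk_one, Fin.reduceFinMk] <;> omega
  obtain ⟨b, hb, hp⟩ := D.exists_rows hdeg
  have hdet := D.det_ne_zero hd hb hp
  obtain ⟨m, hm, hmσ⟩ := exists_twisted_root hd σ D.c_ne
  have hM : (diagonal m * b).det ≠ 0 := by
    rw [det_mul, det_diagonal]
    exact mul_ne_zero (prod_ne_zero_iff.2 fun i _ => hm i) hdet
  refine ⟨GeneralLinearGroup.mkOfDetNeZero _ hM, 1, σ, fun v => ?_⟩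
  funext i
  have hev : ∀ i v, eval v (p i) = (b *ᵥ v) i := fun i v => by
    rw [hb, eval_C_sum]; rfl
  have hMv : ∀ v i, ((diagonal m * b) *ᵥ v) i = m i * (b *ᵥ v) i := fun v i => by
    rw [← mulVec_mulVec, mulVec_diagonal]
  change ((diagonal m * b) *ᵥ _) i = _ * ((diagonal m * b) *ᵥ v) (σ i) ^ d
  rw [hMv, hMv, mul_pow, hmσ, ← hev i (fun i => eval v (F i)), ← eval_bind₁, hp, map_mul, map_pow,
      hev, eval_C]
  simp
  ring

end
section
variable {k : Type*} [Field k]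

/-- The automorphism of the polynomial ring given by an invertible linear substitution. -/
noncomputable def linEquiv (A A' : Matrix (Fin 3) (Fin 3) k) (h : A * A' = 1) (h' : A' * A = 1) :
    MvPolynomial (Fin 3) k ≃ₐ[k] MvPolynomial (Fin 3) k :=
  AlgEquiv.ofAlgHom (bind₁ (lin A)) (bind₁ (lin A'))
    (AlgHom.ext fun u => bind₁_lin_bind₁_lin h' u) (AlgHom.ext fun u => bind₁_lin_bind₁_lin h u)

lemma prime_bind₁_lin {A A' : Matrix (Fin 3) (Fin 3) k} (h : A * A' = 1) (h' : A' * A = 1)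
    {p : MvPolynomial (Fin 3) k} (hp : Prime p) : Prime (bind₁ (lin A) p) :=
  (MulEquiv.prime_iff (linEquiv A A' h h').toMulEquiv).2 hp

lemma bind₁_lin_dvd_iff {A A' : Matrix (Fin 3) (Fin 3) k} (h : A * A' = 1) (h' : A' * A = 1)
    {u v : MvPolynomial (Fin 3) k} : bind₁ (lin A) u ∣ bind₁ (lin A) v ↔ u ∣ v :=
  map_dvd_iff (linEquiv A A' h h')

lemma bind₁_lin_ne_zero {A A' : Matrix (Fin 3) (Fin 3) k} (h : A * A' = 1) (h' : A' * A = 1)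
    {u : MvPolynomial (Fin 3) k} (hu : u ≠ 0) : bind₁ (lin A) u ≠ 0 :=
  (map_ne_zero_iff (linEquiv A A' h h') (linEquiv A A' h h').injective).2 hu

lemma IsHomogeneous_bind₁_lin (A : Matrix (Fin 3) (Fin 3) k) {u : MvPolynomial (Fin 3) k} {n : ℕ}
    (hu : u.IsHomogeneous n) : (bind₁ (lin A) u).IsHomogeneous n := by
  have := hu.aeval (lin A) (isHomogeneous_lin A)
  rwa [one_mul] at this

lemma totalDegree_bind₁_lin {A A' : Matrix (Fin 3) (Fin 3) k} (h : A * A' = 1) (h' : A' * A = 1)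
    {u : MvPolynomial (Fin 3) k} {n : ℕ} (hu : u.IsHomogeneous n) (hu0 : u ≠ 0) :
    (bind₁ (lin A) u).totalDegree = u.totalDegree := by
  rw [(IsHomogeneous_bind₁_lin A hu).totalDegree (bind₁_lin_ne_zero h h' hu0), hu.totalDegree hu0]

lemma dvd_of_dvd_comp_lin {A A' : Matrix (Fin 3) (Fin 3) k} (h : A' * A = 1)
    {H : Fin 3 → MvPolynomial (Fin 3) k} {p : MvPolynomial (Fin 3) k}
    (hp : ∀ i, p ∣ comp (lin A) H i) (i : Fin 3) : p ∣ H i := by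
  have h1 : H i = ∑ j, C (A' i j) * comp (lin A) H j := by
    have h2 := congrArg (bind₁ H) (show bind₁ (lin A) (lin A' i) = X i by
      rw [← bind₁_lin_bind₁_lin h (X i), bind₁_X_right])
    rw [← bind₁_comp, bind₁_lin, bind₁_X_right] at h2
    exact h2.symm
  rw [h1]
  exact Finset.dvd_sum fun j _ => dvd_mul_of_dvd_right (hp j) _

variable {d m m' : ℕ} {F G H H' : Fin 3 → MvPolynomial (Fin 3) k}
  {Q Q' : MvPolynomial (Fin 3) k} {c c' : k}

/-- The conjugate of a map by a linear change of coordinates. -/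
noncomputable def linConj (A A' : Matrix (Fin 3) (Fin 3) k) (F : Fin 3 → MvPolynomial (Fin 3) k) :
    Fin 3 → MvPolynomial (Fin 3) k := comp (lin A) (comp F (lin A'))

lemma bind₁_linConj (A A' : Matrix (Fin 3) (Fin 3) k) (F : Fin 3 → MvPolynomial (Fin 3) k)
    (u : MvPolynomial (Fin 3) k) :
    bind₁ (linConj A A' F) u = bind₁ (lin A') (bind₁ F (bind₁ (lin A) u)) := by
  rw [linConj, bind₁_comp, bind₁_comp]

lemma linConj_apply (A A' : Matrix (Fin 3) (Fin 3) k) (F : Fin 3 → MvPolynomial (Fin 3) k)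
    (i : Fin 3) : linConj A A' F i = bind₁ (lin A') (bind₁ F (lin A i)) := by
  rw [← bind₁_X_right (linConj A A' F) i, bind₁_linConj, bind₁_X_right]

lemma isHomogeneous_linConj (A A' : Matrix (Fin 3) (Fin 3) k)
    (hF : ∀ i, (F i).IsHomogeneous d) (i : Fin 3) : (linConj A A' F i).IsHomogeneous d := by
  rw [linConj_apply]
  refine IsHomogeneous_bind₁_lin _ ?_
  have := (isHomogeneous_lin A i).aeval F hF
  rwa [mul_one] at this

lemma Conj.transport (S : Conj d m m' F G H H' Q Q' c c') {A A' : Matrix (Fin 3) (Fin 3) k}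
    (h : A * A' = 1) (h' : A' * A = 1) :
    Conj d m m' (linConj A A' F) G (comp H (lin A')) (comp (lin A) H') (bind₁ (lin A') Q) Q' c c'
    where
  F_hom := isHomogeneous_linConj A A' S.F_hom
  G_hom := S.G_hom
  F_nz := fun v hv => by
    by_contra! hcon
    have h1 : ∀ i, eval (A' *ᵥ v) (bind₁ F (lin A i)) = 0 := fun i => by
      rw [← hcon i, linConj_apply, eval_bind₁ (lin A')]
      congr 2
      funext j
      rw [eval_lin]
    have h2 : A *ᵥ (fun i => eval (A' *ᵥ v) (F i)) = 0 := by
      funext i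
      rw [← eval_lin, ← eval_bind₁, h1]
      rfl
    have hAv : A' *ᵥ v ≠ 0 := fun h0 => hv (by
      rw [← one_mulVec v, ← h, ← mulVec_mulVec, h0, mulVec_zero])
    obtain ⟨i, hi⟩ := S.F_nz _ hAv
    apply hi
    have h3 : (fun i => eval (A' *ᵥ v) (F i)) = 0 := by
      rw [← one_mulVec (fun i => eval (A' *ᵥ v) (F i)), ← h', ← mulVec_mulVec, h2, mulVec_zero]
    exact congrFun h3 i
  G_nz := S.G_nz
  H_hom := fun i => IsHomogeneous_bind₁_lin _ (S.H_hom i)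
  H'_hom := fun i => by
    have := (isHomogeneous_lin A i).aeval H' S.H'_hom
    rwa [mul_one] at this
  H_prim := fun p hp => by
    obtain ⟨i, hi⟩ := S.H_prim _ (prime_bind₁_lin h h' hp)
    refine ⟨i, fun hpi => hi ?_⟩
    rw [← bind₁_lin_bind₁_lin h' (H i)]
    exact (bind₁_lin_dvd_iff h h').2 hpi
  H'_prim := fun p hp => by
    by_contra! hcon
    obtain ⟨i, hi⟩ := S.H'_prim p hp
    exact hi (dvd_of_dvd_comp_lin h' hcon i)
  H_F := fun i => by
    rw [bind₁_linConj, comp, bind₁_lin_bind₁_lin h', S.H_F, map_mul, bind₁_C_right,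
      show comp H (lin A') = fun i => bind₁ (lin A') (H i) from rfl, ← bind₁_comp]
    rfl
  H'_G := fun i => by
    rw [linConj_apply, bind₁_comp, bind₁_lin_bind₁_lin h', comp, bind₁_lin, bind₁_lin, map_sum,
      map_sum, Finset.mul_sum]
    refine Finset.sum_congr rfl fun j _ => ?_
    rw [map_mul, map_mul, S.H'_G, bind₁_C_right, bind₁_C_right]
    ring
  H'_H := fun i => by
    rw [bind₁_comp, comp, bind₁_lin, map_sum]
    have : ∀ j, bind₁ H (C (A i j) * H' j) = Q * (C (A i j) * X j) := fun j => by
      rw [map_mul, S.H'_H, bind₁_C_right]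
      ring
    rw [Finset.sum_congr rfl fun j _ => this j, ← Finset.mul_sum, map_mul,
      show ∑ j, C (A i j) * X j = lin A i from rfl]
    congr 1
    rw [← bind₁_lin_bind₁_lin h (X i), bind₁_X_right]
  H_H' := fun i => by
    rw [bind₁_comp, comp, bind₁_lin_bind₁_lin h', S.H_H']
  Q_ne := bind₁_lin_ne_zero h' h S.Q_ne
  Q'_ne := S.Q'_ne
  c_ne := S.c_ne
  c'_ne := S.c'_ne

lemma PrimeData.transport {r : ℕ} {p : Fin r → MvPolynomial (Fin 3) k} {σ : Equiv.Perm (Fin r)}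
    {e : Fin r → ℕ} {γ : Fin r → k} (D : PrimeData F d Q p σ γ e)
    {A A' : Matrix (Fin 3) (Fin 3) k} (h : A * A' = 1) (h' : A' * A = 1) :
    PrimeData (linConj A A' F) d (bind₁ (lin A') Q) (fun i => bind₁ (lin A') (p i)) σ γ e := by
  have hdeg : ∀ i, (bind₁ (lin A') (p i)).totalDegree = (p i).totalDegree := fun i =>
    totalDegree_bind₁_lin h' h (D.hom i) (D.prime i).ne_zero
  refine ⟨fun i => prime_bind₁_lin h' h (D.prime i),
    fun i j hij => D.eq_of_dvd i j ((bind₁_lin_dvd_iff h' h).1 hij),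
    fun i => (bind₁_lin_dvd_iff h' h).2 (D.dvd i),
    fun i => by rw [hdeg]; exact IsHomogeneous_bind₁_lin _ (D.hom i), fun N u hu => ?_,
    fun i => ?_, D.c_ne, fun i => by rw [hdeg, hdeg]; exact D.degree i, D.pos,
    fun i => by rw [hdeg]; exact D.degree_pos i, by simpa only [hdeg] using D.sum_le⟩
  · rw [← bind₁_lin_bind₁_lin h u, ← map_pow, bind₁_lin_dvd_iff h' h] at hu
    obtain ⟨a, n, ha, hn⟩ := D.factor N _ hu
    refine ⟨a, n, ha, ?_⟩
    rw [← bind₁_lin_bind₁_lin h u, hn, map_mul, map_prod, bind₁_C_right]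
    simp only [map_pow]
  · rw [bind₁_linConj, bind₁_lin_bind₁_lin h', D.pullback, map_mul, map_pow, bind₁_C_right]

end
section
variable {k : Type*} [Field k]

/-- Setting the middle coordinate to zero. -/
noncomputable def slice : MvPolynomial (Fin 3) k →ₐ[k] MvPolynomial (Fin 3) k :=
  bind₁ ![X 0, 0, X 2]

lemma eval_slice (v : Fin 3 → k) (u : MvPolynomial (Fin 3) k) :
    eval v (slice u) = eval ![v 0, 0, v 2] u := by
  rw [slice, eval_bind₁]
  congr 2
  funext i
  fin_cases i <;> simp

lemma isHomogeneous_slice {u : MvPolynomial (Fin 3) k} {n : ℕ} (hu : u.IsHomogeneous n) :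
    (slice u).IsHomogeneous n := by
  have h : ∀ i, ((![X 0, 0, X 2] : Fin 3 → MvPolynomial (Fin 3) k) i).IsHomogeneous 1 := fun i => by
    fin_cases i
    · exact isHomogeneous_X _ _
    · exact isHomogeneous_zero _ _ _
    · exact isHomogeneous_X _ _
  have := hu.aeval _ h
  rwa [one_mul] at this

lemma isHomogeneous_iterate_pderiv {u : MvPolynomial (Fin 3) k} {n : ℕ} (hu : u.IsHomogeneous n)
    (l : ℕ) : ((pderiv (R := k) (1 : Fin 3))^[l] u).IsHomogeneous (n - l) := by
  simpa using isHomogeneous_iterate (e := 1) (fun u n hu => hu.pderiv) hu l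

lemma iterate_derivative_aeval {γ : Fin 3 → Polynomial k} (h0 : Polynomial.derivative (γ 0) = 0)
    (h1 : Polynomial.derivative (γ 1) = 1) (h2 : Polynomial.derivative (γ 2) = 0) (l : ℕ)
    (u : MvPolynomial (Fin 3) k) :
    Polynomial.derivative^[l] (aeval γ u) = aeval γ ((pderiv (R := k) (1 : Fin 3))^[l] u) := by
  induction l generalizing u with
  | zero => rfl
  | succ l ih =>
    rw [Function.iterate_succ_apply, Function.iterate_succ_apply, ← ih, derivative_aeval,
      Fin.sum_univ_three, h0, h1, h2, mul_zero, mul_zero, mul_one, zero_add, add_zero]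

lemma eq_sum_slice [CharZero k] {u : MvPolynomial (Fin 3) k} {n : ℕ} (hu : u.IsHomogeneous n) :
    u = ∑ l ∈ range (n + 1),
      C ((l.factorial : k)⁻¹) * X 1 ^ l * slice ((pderiv (R := k) (1 : Fin 3))^[l] u) := by
  refine MvPolynomial.funext fun v => ?_
  set γ : Fin 3 → Polynomial k := ![Polynomial.C (v 0), Polynomial.X, Polynomial.C (v 2)] with hγ
  have hd : ∀ l, Polynomial.derivative^[l] (aeval γ u) =
      aeval γ ((pderiv (R := k) (1 : Fin 3))^[l] u) := fun l =>
    iterate_derivative_aeval (by simp [hγ]) (by simp [hγ]) (by simp [hγ]) l u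
  have hdeg : (aeval γ u).natDegree < n + 1 := by
    refine Nat.lt_succ_of_le (aeval_natDegree_le (m := n) (n := 1) u hu.totalDegree_le γ ?_ |>.trans
      (by omega))
    intro i
    fin_cases i
    · simp [hγ]
    · simp [hγ]
    · simp [hγ]
  have h1 := Polynomial.eval_eq_sum_range' hdeg (v 1)
  have hv : (fun i => (γ i).eval (v 1)) = v := by
    funext i
    fin_cases i <;> simp [hγ]
  have hv0 : (fun i => (γ i).eval 0) = ![v 0, 0, v 2] := by
    funext i
    fin_cases i <;> simp [hγ]
  rw [eval_polynomial_aeval, hv] at h1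
  rw [h1, map_sum]
  refine Finset.sum_congr rfl fun l _ => ?_
  rw [map_mul, map_mul, eval_slice, eval_C, map_pow, eval_X, ← hv0, ← eval_polynomial_aeval, ← hd,
    ← Polynomial.coeff_zero_eq_eval_zero, Polynomial.coeff_iterate_derivative, zero_add,
    Nat.descFactorial_self, nsmul_eq_mul]
  have : (l.factorial : k) ≠ 0 := Nat.cast_ne_zero.2 l.factorial_ne_zero
  field_simp

lemma iterate_pderiv_bind₁ {H : Fin 3 → MvPolynomial (Fin 3) k} {E : MvPolynomial (Fin 3) k}
    (h0 : pderiv 1 (H 0) = 0) (h1 : pderiv 1 (H 1) = E) (h2 : pderiv 1 (H 2) = 0)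
    (hE : pderiv 1 E = 0) (l : ℕ) (u : MvPolynomial (Fin 3) k) :
    (pderiv (R := k) (1 : Fin 3))^[l] (bind₁ H u) =
      E ^ l * bind₁ H ((pderiv (R := k) (1 : Fin 3))^[l] u) := by
  induction l with
  | zero => simp
  | succ l ih =>
    rw [Function.iterate_succ_apply', ih, Derivation.leibniz, Derivation.leibniz_pow, hE,
      smul_zero, smul_zero, smul_zero, add_zero, pderiv_bind₁, Fin.sum_univ_three, h0, h1, h2,
      Function.iterate_succ_apply', smul_eq_mul]
    ring

lemma iterate_pderiv_mul {E : MvPolynomial (Fin 3) k} (hE : pderiv 1 E = 0) (l : ℕ)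
    (u : MvPolynomial (Fin 3) k) : (pderiv (R := k) (1 : Fin 3))^[l] (E * u) =
      E * (pderiv (R := k) (1 : Fin 3))^[l] u := by
  induction l with
  | zero => rfl
  | succ l ih =>
    rw [Function.iterate_succ_apply', ih, Derivation.leibniz, hE, smul_zero, add_zero,
      Function.iterate_succ_apply', smul_eq_mul]

end
section
variable {k : Type*} [Field k]

lemma eq_slice_of_pderiv_eq_zero [CharZero k] {u : MvPolynomial (Fin 3) k} {n : ℕ}
    (hu : u.IsHomogeneous n) (h : pderiv 1 u = 0) : slice u = u := by
  conv_rhs => rw [eq_sum_slice hu]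
  rw [Finset.sum_eq_single 0]
  · simp
  · intro l _ hl
    obtain ⟨l, rfl⟩ := Nat.exists_eq_succ_of_ne_zero hl
    rw [Function.iterate_succ_apply, h, Function.iterate_fixed (map_zero _), map_zero, mul_zero]
  · simp

lemma monomial_eq_iff {a b : k} (ha : a ≠ 0) (hb : b ≠ 0) {i j i' j' : ℕ}
    (h : (C a * (X 0 ^ i * X 2 ^ j) : MvPolynomial (Fin 3) k) = C b * (X 0 ^ i' * X 2 ^ j')) :
    i = i' ∧ j = j' := by
  have h1 := congrArg (aeval ![Polynomial.X, 0, (1 : Polynomial k)]) h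
  have h2 := congrArg (aeval ![1, 0, (Polynomial.X : Polynomial k)]) h
  simp only [map_mul, map_pow, aeval_X, algHom_C, Matrix.cons_val, one_pow, mul_one, one_mul,
    Polynomial.algebraMap_eq] at h1 h2
  have h3 := congrArg Polynomial.natDegree h1
  have h4 := congrArg Polynomial.natDegree h2
  rw [Polynomial.natDegree_C_mul_X_pow _ _ ha, Polynomial.natDegree_C_mul_X_pow _ _ hb] at h3 h4
  exact ⟨h3, h4⟩

lemma exists_eq_C_mul_pow {P R u v : MvPolynomial (Fin 3) k} (hR : Prime R)
    (hR1 : R.IsHomogeneous 1) (hRP : ¬ R ∣ P) {a : k} (ha : a ≠ 0) {i j i' j' l : ℕ}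
    (hu : u.IsHomogeneous l) (hj : j < j')
    (h : C a * (P ^ i * R ^ j) ^ l * u = (P ^ i' * R ^ j') ^ l * v) :
    ∃ b : k, u = C b * R ^ l := by
  have h1 : R ^ l ∣ u := by
    obtain ⟨t, rfl⟩ := Nat.exists_eq_add_of_lt hj
    have h2 : C a * P ^ (i * l) * u = R ^ l * (R ^ (t * l) * P ^ (i' * l) * v) := by
      apply mul_left_cancel₀ (pow_ne_zero (j * l) hR.ne_zero)
      calc R ^ (j * l) * (C a * P ^ (i * l) * u) = C a * (P ^ i * R ^ j) ^ l * u := by ring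
        _ = _ := by rw [h]; ring
    refine hR.pow_dvd_of_dvd_mul_left l (a := C a * P ^ (i * l)) (fun h3 => ?_) ⟨_, h2⟩
    rcases hR.dvd_or_dvd h3 with h4 | h4
    · exact hR.not_isUnit (isUnit_of_dvd_unit h4 (isUnit_iff_exists_C.2 ⟨a, ha, rfl⟩))
    · exact hRP (hR.dvd_of_dvd_pow h4)
  obtain ⟨w, hw⟩ := h1
  have h2 : (R ^ l).IsHomogeneous l := by simpa using hR1.pow l
  have h3 := isHomogeneous_of_mul_left h2 (pow_ne_zero _ hR.ne_zero) (hw ▸ hu)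
  rw [Nat.sub_self] at h3
  have h4 := totalDegree_eq_zero_iff_eq_C.1 (Nat.le_zero.1 h3.totalDegree_le)
  exact ⟨_, by rw [hw, h4, mul_comm]⟩

lemma slice_monomial (a : k) (i j : ℕ) :
    slice (C a * (X 0 ^ i * X 2 ^ j) : MvPolynomial (Fin 3) k) = C a * (X 0 ^ i * X 2 ^ j) := by
  simp [slice]

lemma pderiv_monomial_eq_zero (a : k) (i j : ℕ) :
    pderiv 1 (C a * (X 0 ^ i * X 2 ^ j) : MvPolynomial (Fin 3) k) = 0 := by
  simp [Derivation.leibniz, Derivation.leibniz_pow,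
    pderiv_X_of_ne (show (0 : Fin 3) ≠ 1 by decide),
    pderiv_X_of_ne (show (2 : Fin 3) ≠ 1 by decide)]

lemma not_X_dvd_X {i j : Fin 3} (hij : i ≠ j) : ¬ (X i : MvPolynomial (Fin 3) k) ∣ X j := by
  rintro ⟨u, hu⟩
  have h1 := congrArg (eval (Pi.single j 1)) hu
  simp [hij] at h1

lemma prime_X (i : Fin 3) : Prime (X i : MvPolynomial (Fin 3) k) :=
  prime_of_isHomogeneous_one (isHomogeneous_X _ _) (X_ne_zero _)

/-- A conjugacy with coordinates adapted to two invariant lines. -/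
structure Adapted (d m m' : ℕ) (F G H H' : Fin 3 → MvPolynomial (Fin 3) k)
    (Q Q' : MvPolynomial (Fin 3) k) (c c' f₀ f₂ g₀ g₂ h₀ h₂ φ ψ : k) (α β : ℕ) : Prop where
  conj : Conj d m m' F G H H' Q Q' c c'
  F_eq : (F 0 = C f₀ * X 0 ^ d ∧ F 2 = C f₂ * X 2 ^ d) ∨
    (F 0 = C f₀ * X 2 ^ d ∧ F 2 = C f₂ * X 0 ^ d)
  G_eq : (G 0 = C g₀ * X 0 ^ d ∧ G 2 = C g₂ * X 2 ^ d) ∨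
    (G 0 = C g₀ * X 2 ^ d ∧ G 2 = C g₂ * X 0 ^ d)
  F_one : (pderiv (R := k) (1 : Fin 3))^[d - 1] (F 1) = C φ * X 1
  G_one : (pderiv (R := k) (1 : Fin 3))^[d - 1] (G 1) = C ψ * X 1
  H_zero : H 0 = C h₀ * (X 0 ^ (α + 1) * X 2 ^ β)
  H_two : H 2 = C h₂ * (X 0 ^ α * X 2 ^ (β + 1))
  degree : m = α + β + 1
  factor : ∀ u, u ∣ Q ^ 3 → ∃ (e : k) (i j : ℕ), e ≠ 0 ∧ u = C e * (X 0 ^ i * X 2 ^ j)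
  f₀_ne : f₀ ≠ 0
  f₂_ne : f₂ ≠ 0
  g₀_ne : g₀ ≠ 0
  g₂_ne : g₂ ≠ 0
  h₀_ne : h₀ ≠ 0
  h₂_ne : h₂ ≠ 0
  φ_ne : φ ≠ 0
  ψ_ne : ψ ≠ 0

namespace Adapted
variable {d m m' : ℕ} {F G H H' : Fin 3 → MvPolynomial (Fin 3) k}
  {Q Q' : MvPolynomial (Fin 3) k} {c c' f₀ f₂ g₀ g₂ h₀ h₂ φ ψ : k} {α β : ℕ}
  (S : Adapted d m m' F G H H' Q Q' c c' f₀ f₂ g₀ g₂ h₀ h₂ φ ψ α β)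
include S

lemma pderiv_F : pderiv 1 (F 0) = 0 ∧ pderiv 1 (F 2) = 0 := by
  have h1 := fun a : k => pderiv_monomial_eq_zero a d 0
  have h2 := fun a : k => pderiv_monomial_eq_zero a 0 d
  simp only [pow_zero, mul_one, one_mul] at h1 h2
  rcases S.F_eq with ⟨h, h'⟩ | ⟨h, h'⟩ <;> rw [h, h']
  · exact ⟨h1 _, h2 _⟩
  · exact ⟨h2 _, h1 _⟩

lemma exists_H_one [CharZero k] (hd : 2 ≤ d) : ∃ (e : k) (i j : ℕ), e ≠ 0 ∧ i + j = α + β ∧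
    H 1 = C e * (X 0 ^ i * X 2 ^ j) * X 1 := by
  have hH0 : pderiv 1 (H 0) = 0 := by rw [S.H_zero, pderiv_monomial_eq_zero]
  have hH2 : pderiv 1 (H 2) = 0 := by rw [S.H_two, pderiv_monomial_eq_zero]
  have h1 : pderiv 1 (H 1) ∣ jdet H := by
    rw [jdet, det_fin_three]
    simp only [jac_apply, hH0, hH2]
    exact ⟨pderiv 0 (H 0) * pderiv 2 (H 2) - pderiv 2 (H 0) * pderiv 0 (H 2), by ring⟩
  obtain ⟨e, i, j, he, hE⟩ := S.factor _ (h1.trans S.conj.jdet_dvd)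
  set E : MvPolynomial (Fin 3) k := C e * (X 0 ^ i * X 2 ^ j) with hEdef
  have hdE : pderiv 1 E = 0 := pderiv_monomial_eq_zero _ _ _
  have hE0 : E ≠ 0 := mul_ne_zero (C_ne_zero.2 he)
    (mul_ne_zero (pow_ne_zero _ (X_ne_zero _)) (pow_ne_zero _ (X_ne_zero _)))
  have hEhom : E.IsHomogeneous (i + j) := by
    have := (isHomogeneous_C (Fin 3) e).mul (((isHomogeneous_X k (0 : Fin 3)).pow i).mul
      ((isHomogeneous_X k (2 : Fin 3)).pow j))
    simpa using this
  have hij : i + j = α + β := by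
    have h2 : (pderiv 1 (H 1)).IsHomogeneous (m - 1) := (S.conj.H_hom 1).pderiv
    rw [hE] at h2
    have := hEhom.inj_right h2 hE0
    have := S.degree
    omega
  refine ⟨e, i, j, he, hij, ?_⟩
  set B := H 1 - E * X 1 with hB
  have hBhom : B.IsHomogeneous m := by
    refine (S.conj.H_hom 1).sub ?_
    have := hEhom.mul (isHomogeneous_X k (1 : Fin 3))
    rwa [hij, ← S.degree] at this
  have hdB : pderiv 1 B = 0 := by
    rw [hB, map_sub, hE, Derivation.leibniz, hdE, pderiv_X_self]
    simp
  have hsB := eq_slice_of_pderiv_eq_zero hBhom hdB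
  have hH1 : H 1 = E * X 1 + B := by rw [hB]; ring
  have h3 := congrArg ((pderiv (R := k) (1 : Fin 3))^[d - 1]) (S.conj.H_F 1)
  obtain ⟨hF0, hF2⟩ := S.pderiv_F
  have hdF : ∀ u : MvPolynomial (Fin 3) k, pderiv 1 u = 0 → pderiv 1 (bind₁ F u) = 0 :=
    fun u hu => by
      rw [pderiv_bind₁, Fin.sum_univ_three, hF0, hF2, hu, map_zero, zero_mul, mul_zero, mul_zero,
        add_zero, add_zero]
  rw [iterate_pderiv_mul (pderiv_C), iterate_pderiv_bind₁ hH0 hE hH2 hdE, S.G_one, map_mul,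
    bind₁_C_right, bind₁_X_right, hH1, map_add, map_mul, bind₁_X_right, iterate_map_add,
    iterate_pderiv_mul (hdF _ hdE), S.F_one] at h3
  obtain ⟨n, hn⟩ : ∃ n, d - 1 = n + 1 := ⟨d - 2, by omega⟩
  rw [hn, Function.iterate_succ_apply _ _ (bind₁ F B), hdF _ hdB,
    Function.iterate_fixed (map_zero _), add_zero] at h3
  have h4 := congrArg slice h3
  have hs1 : slice (X 1 : MvPolynomial (Fin 3) k) = 0 := by simp [slice]
  simp only [map_mul, map_add, map_pow, hs1, mul_zero, zero_add, hsB] at h4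
  have hsE : slice E = E := slice_monomial _ _ _
  have hsC : ∀ a : k, slice (C a : MvPolynomial (Fin 3) k) = C a := fun a => by simp [slice]
  rw [hsE, hsC, hsC] at h4
  have h5 : B = 0 := by
    have h6 : (C c : MvPolynomial (Fin 3) k) ≠ 0 := C_ne_zero.2 S.conj.c_ne
    have h7 : (C ψ : MvPolynomial (Fin 3) k) ≠ 0 := C_ne_zero.2 S.ψ_ne
    simpa [h6, h7, hE0] using h4.symm
  rw [hH1, h5, add_zero]

end Adapted

end
section
variable {k : Type*} [Field k]

namespace Adapted
variable {d m m' : ℕ} {F G H H' : Fin 3 → MvPolynomial (Fin 3) k}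
  {Q Q' : MvPolynomial (Fin 3) k} {c c' f₀ f₂ g₀ g₂ h₀ h₂ φ ψ : k} {α β : ℕ}
  (S : Adapted d m m' F G H H' Q Q' c c' f₀ f₂ g₀ g₂ h₀ h₂ φ ψ α β)
include S

lemma slice_bind_H {e : k} {i j : ℕ} (hH : H 1 = C e * (X 0 ^ i * X 2 ^ j) * X 1)
    {u : MvPolynomial (Fin 3) k} {n : ℕ} (hu : u.IsHomogeneous n) :
    slice (bind₁ H u) = (X 0 ^ α * X 2 ^ β) ^ n * bind₁ ![C h₀ * X 0, 0, C h₂ * X 2] u := by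
  rw [← bind₁_mul_of_isHomogeneous hu, slice, bind₁_bind₁]
  congr 2
  funext x
  fin_cases x
  · simp only [Fin.zero_eta, S.H_zero, Matrix.cons_val]
    simp
    ring
  · simp only [Fin.mk_one, hH, Matrix.cons_val]
    simp
  · simp only [Fin.reduceFinMk, S.H_two, Matrix.cons_val]
    simp
    ring

lemma comparison [CharZero k] (hd : 2 ≤ d) {e : k} {i j : ℕ} (he : e ≠ 0)
    (hH : H 1 = C e * (X 0 ^ i * X 2 ^ j) * X 1) :
    ∃ κ : k, κ ≠ 0 ∧ bind₁ F (X 0 ^ i * X 2 ^ j) = C κ * (X 0 ^ i * X 2 ^ j) ^ d ∧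
      ∀ n ≤ d, ∃ (b : k) (v : MvPolynomial (Fin 3) k), b ≠ 0 ∧
        C b * (X 0 ^ i * X 2 ^ j) ^ (d - n) * slice ((pderiv (R := k) (1 : Fin 3))^[n] (F 1)) =
          (X 0 ^ α * X 2 ^ β) ^ (d - n) * v := by
  set M : MvPolynomial (Fin 3) k := X 0 ^ i * X 2 ^ j with hM
  have hM0 : M ≠ 0 := mul_ne_zero (pow_ne_zero _ (X_ne_zero _)) (pow_ne_zero _ (X_ne_zero _))
  have hMhom : M.IsHomogeneous (i + j) := by
    have := ((isHomogeneous_X k (0 : Fin 3)).pow i).mul ((isHomogeneous_X k (2 : Fin 3)).pow j)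
    simpa using this
  have hdM : pderiv 1 M = 0 := by
    have h := pderiv_monomial_eq_zero (1 : k) i j
    rwa [C_1, one_mul] at h
  have hdE : pderiv 1 (C e * M) = 0 := pderiv_monomial_eq_zero e i j
  obtain ⟨hF0, hF2⟩ := S.pderiv_F
  have hdF : pderiv 1 (bind₁ F M) = 0 := by
    rw [pderiv_bind₁, Fin.sum_univ_three, hF0, hF2, hdM, map_zero, zero_mul, mul_zero, mul_zero,
      add_zero, add_zero]
  have hsF : slice (bind₁ F M) = bind₁ F M :=
    eq_slice_of_pderiv_eq_zero (hMhom.aeval F S.conj.F_hom) hdF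
  have hsM : slice M = M := by
    have h := slice_monomial (1 : k) i j
    rwa [C_1, one_mul] at h
  have hsC : ∀ a : k, slice (C a : MvPolynomial (Fin 3) k) = C a := fun a => by simp [slice]
  have hH0 : pderiv 1 (H 0) = 0 := by rw [S.H_zero, pderiv_monomial_eq_zero]
  have hH2 : pderiv 1 (H 2) = 0 := by rw [S.H_two, pderiv_monomial_eq_zero]
  have hH1 : pderiv 1 (H 1) = C e * M := by
    rw [hH, Derivation.leibniz, hdE, pderiv_X_self]
    simp
  have key : ∀ n, C e * bind₁ F M * slice ((pderiv (R := k) (1 : Fin 3))^[n] (F 1)) =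
      C c * ((C e * M) ^ n * slice (bind₁ H ((pderiv (R := k) (1 : Fin 3))^[n] (G 1)))) := by
    intro n
    have h1 := congrArg (fun u => slice ((pderiv (R := k) (1 : Fin 3))^[n] u)) (S.conj.H_F 1)
    rw [iterate_pderiv_mul pderiv_C, iterate_pderiv_bind₁ hH0 hH1 hH2 hdE, hH, map_mul, map_mul,
      bind₁_C_right, bind₁_X_right, mul_assoc, iterate_pderiv_mul pderiv_C,
      iterate_pderiv_mul hdF] at h1
    simp only [map_mul, map_pow, hsF, hsM, hsC] at h1
    rw [mul_assoc, h1]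
  have hdd : ∀ (f : MvPolynomial (Fin 3) k) (a : k),
      (pderiv (R := k) (1 : Fin 3))^[d - 1] f = C a * X 1 →
      (pderiv (R := k) (1 : Fin 3))^[d] f = C a := fun f a h => by
    obtain ⟨n, rfl⟩ : ∃ n, d = n + 1 := ⟨d - 1, by omega⟩
    rw [Nat.add_sub_cancel] at h
    rw [Function.iterate_succ_apply', h, Derivation.leibniz, pderiv_C, pderiv_X_self]
    simp
  have h2 := key d
  rw [hdd _ _ S.F_one, hdd _ _ S.G_one, bind₁_C_right, hsC, hsC] at h2
  have hφ : (C φ : MvPolynomial (Fin 3) k) ≠ 0 := C_ne_zero.2 S.φ_ne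
  have hCe : (C e : MvPolynomial (Fin 3) k) ≠ 0 := C_ne_zero.2 he
  have h3 : bind₁ F M = C (e ^ d * c * ψ / (e * φ)) * M ^ d := by
    apply mul_left_cancel₀ (mul_ne_zero hCe hφ)
    calc C e * C φ * bind₁ F M = C e * bind₁ F M * C φ := by ring
      _ = C (e ^ d * c * ψ) * M ^ d := by
        rw [h2]
        simp only [map_mul, map_pow]
        ring
      _ = C (e * φ * (e ^ d * c * ψ / (e * φ))) * M ^ d := by
        rw [mul_div_cancel₀ _ (mul_ne_zero he S.φ_ne)]
      _ = _ := by
        rw [map_mul, map_mul, mul_assoc]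
  have hκ : e ^ d * c * ψ / (e * φ) ≠ 0 :=
    div_ne_zero (mul_ne_zero (mul_ne_zero (pow_ne_zero _ he) S.conj.c_ne) S.ψ_ne)
      (mul_ne_zero he S.φ_ne)
  refine ⟨_, hκ, h3, fun n hn => ?_⟩
  set κ := e ^ d * c * ψ / (e * φ)
  have h4 := key n
  rw [S.slice_bind_H hH (isHomogeneous_iterate_pderiv (S.conj.G_hom 1) n), h3] at h4
  refine ⟨e * κ, C c * C e ^ n *
    bind₁ ![C h₀ * X 0, 0, C h₂ * X 2] ((pderiv (R := k) (1 : Fin 3))^[n] (G 1)),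
    mul_ne_zero he hκ, ?_⟩
  · apply mul_left_cancel₀ (pow_ne_zero n hM0)
    calc M ^ n * (C (e * κ) * M ^ (d - n) * slice ((pderiv (R := k) (1 : Fin 3))^[n] (F 1)))
        = C e * (C κ * M ^ d) * slice ((pderiv (R := k) (1 : Fin 3))^[n] (F 1)) := by
          conv_rhs => rw [← Nat.add_sub_cancel' hn, pow_add]
          rw [map_mul]
          ring
      _ = M ^ n * ((X 0 ^ α * X 2 ^ β) ^ (d - n) * (C c * C e ^ n *
          bind₁ ![C h₀ * X 0, 0, C h₂ * X 2] ((pderiv (R := k) (1 : Fin 3))^[n] (G 1)))) := by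
          rw [h4]
          ring

lemma ne_of_two_le (hm : 2 ≤ m) {e : k} {i j : ℕ} (hij : i + j = α + β)
    (hH : H 1 = C e * (X 0 ^ i * X 2 ^ j) * X 1) : i ≠ α := by
  intro hi
  obtain rfl : j = β := by omega
  subst hi
  have h1 : ∀ x, (X 0 ^ i * X 2 ^ j : MvPolynomial (Fin 3) k) ∣ H x := fun x => by
    fin_cases x
    · exact ⟨C h₀ * X 0, S.H_zero.trans (by ring)⟩
    · exact ⟨C e * X 1, hH.trans (by ring)⟩
    · exact ⟨C h₂ * X 2, S.H_two.trans (by ring)⟩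
  have := S.degree
  by_cases hi0 : i = 0
  · obtain ⟨x, hx⟩ := S.conj.H_prim (X 2) (prime_X _)
    exact hx (((dvd_pow_self _ (by omega)).mul_left _).trans (h1 x))
  · obtain ⟨x, hx⟩ := S.conj.H_prim (X 0) (prime_X _)
    exact hx (((dvd_pow_self _ hi0).mul_right _).trans (h1 x))

lemma not_swapped [CharZero k] (hd : 2 ≤ d) (hm : 2 ≤ m) :
    ¬ (F 0 = C f₀ * X 2 ^ d ∧ F 2 = C f₂ * X 0 ^ d) := by
  rintro ⟨hF0, hF2⟩
  obtain ⟨e, i, j, he, hij, hH⟩ := S.exists_H_one hd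
  obtain ⟨κ, hκ, hE, -⟩ := S.comparison hd he hH
  have hbind : ∀ a b : ℕ, bind₁ F (X 0 ^ a * X 2 ^ b) =
      C (f₀ ^ a * f₂ ^ b) * (X 0 ^ (d * b) * X 2 ^ (d * a)) := fun a b => by
    simp only [map_mul, map_pow, bind₁_X_right, hF0, hF2]
    ring
  have hfne : ∀ a b : ℕ, f₀ ^ a * f₂ ^ b ≠ 0 := fun a b =>
    mul_ne_zero (pow_ne_zero _ S.f₀_ne) (pow_ne_zero _ S.f₂_ne)
  have hd0 : 0 < d := by omega
  have h1 : i = j := by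
    have h2 : (C (f₀ ^ i * f₂ ^ j) * (X 0 ^ (d * j) * X 2 ^ (d * i)) : MvPolynomial (Fin 3) k) =
        C κ * (X 0 ^ (d * i) * X 2 ^ (d * j)) := by
      rw [← hbind, hE]
      ring
    exact Nat.eq_of_mul_eq_mul_left hd0 (monomial_eq_iff (hfne _ _) hκ h2).2
  have h2 := S.conj.H_F 0
  have h2' := S.conj.H_F 2
  rw [S.H_zero, map_mul, hbind, bind₁_C_right, ← mul_assoc, ← map_mul] at h2
  rw [S.H_two, map_mul, hbind, bind₁_C_right, ← mul_assoc, ← map_mul] at h2'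
  have h3 : α = β := by
    rcases S.G_eq with ⟨hG0, hG2⟩ | ⟨hG0, hG2⟩
    · rw [hG0, map_mul (bind₁ H), bind₁_C_right, map_pow, bind₁_X_right, S.H_zero,
        show C c * (C g₀ * (C h₀ * (X 0 ^ (α + 1) * X 2 ^ β)) ^ d) =
          (C (c * (g₀ * h₀ ^ d)) * (X 0 ^ (d * (α + 1)) * X 2 ^ (d * β)) :
            MvPolynomial (Fin 3) k) by
            simp only [map_mul, map_pow]
            ring] at h2
      rw [hG2, map_mul (bind₁ H), bind₁_C_right, map_pow, bind₁_X_right, S.H_two,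
        show C c * (C g₂ * (C h₂ * (X 0 ^ α * X 2 ^ (β + 1))) ^ d) =
          (C (c * (g₂ * h₂ ^ d)) * (X 0 ^ (d * α) * X 2 ^ (d * (β + 1))) :
            MvPolynomial (Fin 3) k) by
            simp only [map_mul, map_pow]
            ring] at h2'
      have h4 := Nat.eq_of_mul_eq_mul_left hd0 (monomial_eq_iff (mul_ne_zero S.h₀_ne (hfne _ _))
        (mul_ne_zero S.conj.c_ne (mul_ne_zero S.g₀_ne (pow_ne_zero _ S.h₀_ne))) h2).1
      have h5 := Nat.eq_of_mul_eq_mul_left hd0 (monomial_eq_iff (mul_ne_zero S.h₂_ne (hfne _ _))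
        (mul_ne_zero S.conj.c_ne (mul_ne_zero S.g₂_ne (pow_ne_zero _ S.h₂_ne))) h2').1
      omega
    · rw [hG0, map_mul (bind₁ H), bind₁_C_right, map_pow, bind₁_X_right, S.H_two,
        show C c * (C g₀ * (C h₂ * (X 0 ^ α * X 2 ^ (β + 1))) ^ d) =
          (C (c * (g₀ * h₂ ^ d)) * (X 0 ^ (d * α) * X 2 ^ (d * (β + 1))) :
            MvPolynomial (Fin 3) k) by
            simp only [map_mul, map_pow]
            ring] at h2
      exact (Nat.eq_of_mul_eq_mul_left hd0 (monomial_eq_iff (mul_ne_zero S.h₀_ne (hfne _ _))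
        (mul_ne_zero S.conj.c_ne (mul_ne_zero S.g₀_ne (pow_ne_zero _ S.h₂_ne))) h2).1).symm
  exact S.ne_of_two_le hm hij hH (by omega)

theorem exists_form [CharZero k] (hd : 2 ≤ d) (hm : 2 ≤ m) :
    (F 0 = C f₀ * X 0 ^ d ∧ F 2 = C f₂ * X 2 ^ d) ∧ ∃ (s : Fin 3) (b : ℕ → k),
      (s = 0 ∨ s = 2) ∧ b d ≠ 0 ∧ b (d - 1) = 0 ∧
      F 1 = ∑ l ∈ range (d + 1), C (b l) * X 1 ^ l * X s ^ (d - l) := by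
  refine ⟨S.F_eq.resolve_right (S.not_swapped hd hm), ?_⟩
  obtain ⟨e, i, j, he, hij, hH⟩ := S.exists_H_one hd
  obtain ⟨κ, hκ, -, hn⟩ := S.comparison hd he hH
  have hi := S.ne_of_two_le hm hij hH
  have h1 : ∃ s : Fin 3, (s = 0 ∨ s = 2) ∧ ∀ n ≤ d, ∃ b : k,
      slice ((pderiv (R := k) (1 : Fin 3))^[n] (F 1)) = C b * X s ^ (d - n) := by
    have hhom := fun n => isHomogeneous_slice (isHomogeneous_iterate_pderiv (S.conj.F_hom 1) n)
    rcases lt_or_gt_of_ne hi with hlt | hlt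
    · refine ⟨0, Or.inl rfl, fun n hnd => ?_⟩
      obtain ⟨b, v, hb, hv⟩ := hn n hnd
      rw [mul_comm (X 0 ^ i), mul_comm (X 0 ^ α)] at hv
      exact exists_eq_C_mul_pow (prime_X 0) (isHomogeneous_X _ _) (not_X_dvd_X (by decide)) hb
        (hhom n) hlt hv
    · refine ⟨2, Or.inr rfl, fun n hnd => ?_⟩
      obtain ⟨b, v, hb, hv⟩ := hn n hnd
      exact exists_eq_C_mul_pow (prime_X 2) (isHomogeneous_X _ _) (not_X_dvd_X (by decide)) hb
        (hhom n) (by omega) hv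
  obtain ⟨s, hs, hb⟩ := h1
  choose! b hb using hb
  have hd1 : b (d - 1) = 0 := by
    have h2 := hb (d - 1) (by omega)
    rw [S.F_one, map_mul, show slice (X 1 : MvPolynomial (Fin 3) k) = 0 by simp [slice],
      mul_zero] at h2
    by_contra h3
    exact mul_ne_zero (C_ne_zero.2 h3) (pow_ne_zero _ (X_ne_zero s)) h2.symm
  have hdd : b d ≠ 0 := by
    have h2 := hb d le_rfl
    obtain ⟨n, rfl⟩ : ∃ n, d = n + 1 := ⟨d - 1, by omega⟩
    have h3 := S.F_one
    rw [Nat.add_sub_cancel] at h3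
    rw [Function.iterate_succ_apply', h3, Nat.sub_self, pow_zero, mul_one, Derivation.leibniz,
      pderiv_C, pderiv_X_self, smul_zero, add_zero, smul_eq_mul, mul_one, slice,
      bind₁_C_right] at h2
    rw [← C_injective _ _ h2]
    exact S.φ_ne
  refine ⟨s, fun l => (l.factorial : k)⁻¹ * b l, hs,
    mul_ne_zero (inv_ne_zero (Nat.cast_ne_zero.2 (Nat.factorial_ne_zero _))) hdd,
    by simp only [hd1, mul_zero], ?_⟩
  conv_lhs => rw [eq_sum_slice (S.conj.F_hom 1)]
  refine Finset.sum_congr rfl fun l hl => ?_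
  rw [hb l (Nat.lt_succ_iff.1 (Finset.mem_range.1 hl)), map_mul]
  ring

end Adapted

end
section
variable {k : Type*} [Field k]

lemma eval_linConj {A A' : Matrix (Fin 3) (Fin 3) k} (h' : A' * A = 1)
    (F : Fin 3 → MvPolynomial (Fin 3) k) (v : Fin 3 → k) (i : Fin 3) :
    (A *ᵥ fun j => eval v (F j)) i = eval (A *ᵥ v) (linConj A A' F i) := by
  have h1 : (fun i => eval (A *ᵥ v) (lin A' i)) = v := by
    funext j
    rw [eval_lin, mulVec_mulVec, h', one_mulVec]
  rw [linConj_apply, eval_bind₁, h1, eval_bind₁, eval_lin]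

lemma sum_range_eq_add_sum_Icc {f : ℕ → k} {d : ℕ} (hd : 2 ≤ d) (h : f (d - 1) = 0) :
    ∑ l ∈ range (d + 1), f l = f d + ∑ j ∈ Icc 2 d, f (d - j) := by
  rw [← Finset.sum_range_reflect]
  have h1 : range (d + 1) = insert 0 (insert 1 (Icc 2 d)) := by
    ext x
    simp only [Finset.mem_range, Finset.mem_insert, Finset.mem_Icc]
    omega
  rw [h1, Finset.sum_insert (by simp), Finset.sum_insert (by simp)]
  simp only [Nat.add_sub_cancel, Nat.sub_zero, h, zero_add]

theorem exists_special_form [IsAlgClosed k] {d : ℕ} (hd : 2 ≤ d)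
    {F : Fin 3 → MvPolynomial (Fin 3) k} {A A' : Matrix (Fin 3) (Fin 3) k} (h : A * A' = 1)
    (h' : A' * A = 1) {t s : Fin 3} (hts : (t = 0 ∧ s = 2) ∨ (t = 2 ∧ s = 0)) {f g : k}
    {b : ℕ → k} (hf : f ≠ 0) (hg : g ≠ 0) (hb : b d ≠ 0) (hb1 : b (d - 1) = 0)
    (hFt : linConj A A' F t = C f * X t ^ d) (hFs : linConj A A' F s = C g * X s ^ d)
    (hF1 : linConj A A' F 1 = ∑ l ∈ range (d + 1), C (b l) * X 1 ^ l * X s ^ (d - l)) :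
    ∃ (M : GL (Fin 3) k) (c : kˣ) (a : ℕ → k), ∀ v : Fin 3 → k,
      (M : Matrix (Fin 3) (Fin 3) k).mulVec (fun i => eval v (F i)) =
        ![(c : k) * ((M : Matrix (Fin 3) (Fin 3) k).mulVec v 0) ^ d,
          (c : k) * (((M : Matrix (Fin 3) (Fin 3) k).mulVec v 1) ^ d +
            ∑ j ∈ Icc 2 d, a j * ((M : Matrix (Fin 3) (Fin 3) k).mulVec v 2) ^ j *
              ((M : Matrix (Fin 3) (Fin 3) k).mulVec v 1) ^ (d - j)),
          (c : k) * ((M : Matrix (Fin 3) (Fin 3) k).mulVec v 2) ^ d] := by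
  have hroot : ∀ a : k, a ≠ 0 → ∃ n : k, n ≠ 0 ∧ n ^ d = n * a := fun a ha => by
    obtain ⟨n, hn⟩ := IsAlgClosed.exists_pow_nat_eq a (n := d - 1) (by omega)
    refine ⟨n, fun h0 => ha ?_, ?_⟩
    · rw [← hn, h0, zero_pow (by omega)]
    · rw [← hn, ← pow_succ', Nat.sub_add_cancel (by omega)]
  obtain ⟨m₀, hm₀, hm₀f⟩ := hroot f hf
  obtain ⟨m₁, hm₁, hm₁b⟩ := hroot _ hb
  obtain ⟨m₂, hm₂, hm₂g⟩ := hroot g hg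
  set N : Matrix (Fin 3) (Fin 3) k :=
    of ![Pi.single t m₀, Pi.single 1 m₁, Pi.single s m₂] with hN
  have hNv : ∀ u, N *ᵥ u = ![m₀ * u t, m₁ * u 1, m₂ * u s] := fun u => by
    funext i
    fin_cases i <;> simp [hN, mulVec]
  have hNdet : N.det ≠ 0 := by
    rcases hts with ⟨rfl, rfl⟩ | ⟨rfl, rfl⟩ <;> rw [hN, det_fin_three] <;>
      simp [hm₀, hm₁, hm₂]
  have hMdet : (N * A).det ≠ 0 := by
    rw [det_mul]
    refine mul_ne_zero hNdet fun h0 => ?_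
    have := congrArg det h
    rw [det_mul, h0, zero_mul, det_one] at this
    exact zero_ne_one this
  refine ⟨GeneralLinearGroup.mkOfDetNeZero _ hMdet, 1,
    fun j => m₁ * b (d - j) / (m₂ ^ j * m₁ ^ (d - j)), fun v => ?_⟩
  change (N * A) *ᵥ _ = ![((1 : kˣ) : k) * (((N * A) *ᵥ v) 0) ^ d, _ * ((((N * A) *ᵥ v) 1) ^ d +
    ∑ j ∈ Icc 2 d, _ * (((N * A) *ᵥ v) 2) ^ j * (((N * A) *ᵥ v) 1) ^ (d - j)),
    _ * (((N * A) *ᵥ v) 2) ^ d]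
  rw [← mulVec_mulVec, ← mulVec_mulVec, hNv, hNv, eval_linConj h', eval_linConj h',
    eval_linConj h', hFt, hFs, hF1]
  set u := A *ᵥ v
  simp only [Units.val_one, one_mul, Matrix.cons_val, map_mul, map_pow, map_sum, eval_C, eval_X]
  congr 1
  · rw [mul_pow, hm₀f]
    ring
  congr 1
  · rw [sum_range_eq_add_sum_Icc hd (by rw [hb1]; ring), mul_add, Finset.mul_sum, Nat.sub_self,
      pow_zero, mul_pow, hm₁b]
    congr 1
    · ring
    refine Finset.sum_congr rfl fun j hj => ?_
    have hj2 := (Finset.mem_Icc.1 hj).2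
    rw [Nat.sub_sub_self hj2, mul_pow, mul_pow]
    field_simp
  · congr 1
    rw [mul_pow, hm₂g]
    ring

end
section
variable {k : Type*} [Field k]

lemma bind₁_lin_mul (M N : Matrix (Fin 3) (Fin 3) k) (u : MvPolynomial (Fin 3) k) :
    bind₁ (lin (M * N)) u = bind₁ (lin N) (bind₁ (lin M) u) := by
  rw [bind₁_bind₁]
  congr 2
  funext i
  rw [bind₁_lin]
  simp only [lin, Matrix.mul_apply, map_sum, map_mul, Finset.sum_mul, Finset.mul_sum]
  rw [Finset.sum_comm]
  exact Finset.sum_congr rfl fun _ _ => Finset.sum_congr rfl fun _ _ => by ring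

lemma lin_mul_apply (M N : Matrix (Fin 3) (Fin 3) k) (i : Fin 3) :
    lin (M * N) i = bind₁ (lin N) (lin M i) := by
  rw [← bind₁_X_right (lin (M * N)) i, bind₁_lin_mul, bind₁_X_right]

lemma linConj_linConj (A A' B B' : Matrix (Fin 3) (Fin 3) k)
    (F : Fin 3 → MvPolynomial (Fin 3) k) :
    linConj B B' (linConj A A' F) = linConj (B * A) (A' * B') F := by
  funext i
  rw [linConj_apply, bind₁_linConj, linConj_apply, lin_mul_apply, bind₁_lin_mul]

lemma bind₁_lin_lin {A A' : Matrix (Fin 3) (Fin 3) k} (h : A * A' = 1) (i : Fin 3) :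
    bind₁ (lin A') (lin A i) = X i := by
  rw [← bind₁_lin_bind₁_lin h (X i), bind₁_X_right]

lemma exists_matrix_of_rows {q₀ q₂ : MvPolynomial (Fin 3) k} (h₀ : q₀.IsHomogeneous 1)
    (h₂ : q₂.IsHomogeneous 1) (hq₀ : q₀ ≠ 0) (hq : ¬ q₀ ∣ q₂) :
    ∃ A A' : Matrix (Fin 3) (Fin 3) k, A * A' = 1 ∧ A' * A = 1 ∧ lin A 0 = q₀ ∧ lin A 2 = q₂ := by
  obtain ⟨b, rfl⟩ := exists_eq_sum_of_isHomogeneous_one h₀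
  obtain ⟨e, rfl⟩ := exists_eq_sum_of_isHomogeneous_one h₂
  have hb : b ≠ 0 := fun h => hq₀ (by simp [h])
  have hcross : b ⨯₃ e ≠ 0 := fun h => by
    obtain ⟨a, rfl⟩ := exists_eq_smul_of_cross_eq_zero hb h
    refine hq ⟨C a, ?_⟩
    rw [Finset.sum_mul]
    refine Finset.sum_congr rfl fun j _ => ?_
    rw [Pi.smul_apply, smul_eq_mul, map_mul]
    ring
  obtain ⟨i, hi⟩ := Function.ne_iff.1 hcross
  set A : Matrix (Fin 3) (Fin 3) k := of ![b, Pi.single i 1, e] with hA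
  have hdet : A.det ≠ 0 := by
    have : A.det = - (b ⨯₃ e) i := by
      rw [hA, det_fin_three, cross_apply]
      fin_cases i <;> simp <;> ring
    rw [this]
    exact neg_ne_zero.2 hi
  have hu : IsUnit A.det := Ne.isUnit hdet
  exact ⟨A, A⁻¹, mul_nonsing_inv _ hu, nonsing_inv_mul _ hu, rfl, rfl⟩

lemma iterate_pderiv_ne_zero [CharZero k] {u : MvPolynomial (Fin 3) k} {d : ℕ}
    (hu : u.IsHomogeneous d) (h : eval (Pi.single 1 1) u ≠ 0) :
    (pderiv (R := k) (1 : Fin 3))^[d] u ≠ 0 := by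
  intro h0
  apply h
  rw [eq_sum_slice hu, map_sum]
  refine Finset.sum_eq_zero fun l hl => ?_
  rw [map_mul, eval_slice]
  have hz : (![(Pi.single 1 1 : Fin 3 → k) 0, 0, (Pi.single 1 1 : Fin 3 → k) 2] : Fin 3 → k) =
      0 := by
    funext i
    fin_cases i <;> simp
  rw [hz]
  rcases Nat.lt_or_ge l d with hld | hld
  · rw [eval_zero_of_isHomogeneous (isHomogeneous_iterate_pderiv hu l) (by omega), mul_zero]
  · obtain rfl : l = d := le_antisymm (Nat.lt_succ_iff.1 (Finset.mem_range.1 hl)) hld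
    rw [h0, map_zero, mul_zero]

lemma linConj_eq_of_pullback {d : ℕ} {F : Fin 3 → MvPolynomial (Fin 3) k}
    {A A' : Matrix (Fin 3) (Fin 3) k} (h : A * A' = 1) {i j : Fin 3} {a : k}
    (hF : bind₁ F (lin A i) = C a * lin A j ^ d) : linConj A A' F i = C a * X j ^ d := by
  rw [linConj_apply, hF, map_mul, map_pow, bind₁_C_right, bind₁_lin_lin h]

theorem exists_adapted_coordinates [CharZero k] {d : ℕ} (hd : 2 ≤ d)
    {F : Fin 3 → MvPolynomial (Fin 3) k} (hF : ∀ i, (F i).IsHomogeneous d)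
    (hFnz : ∀ v : Fin 3 → k, v ≠ 0 → ∃ i, eval v (F i) ≠ 0)
    {q₀ q₂ : MvPolynomial (Fin 3) k} (h₀ : q₀.IsHomogeneous 1)
    (h₂ : q₂.IsHomogeneous 1) (hq₀ : q₀ ≠ 0) (hq : ¬ q₀ ∣ q₂) {f₀ f₂ : k}
    (hFq : (bind₁ F q₀ = C f₀ * q₀ ^ d ∧ bind₁ F q₂ = C f₂ * q₂ ^ d) ∨
      (bind₁ F q₀ = C f₀ * q₂ ^ d ∧ bind₁ F q₂ = C f₂ * q₀ ^ d)) :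
    ∃ (A A' : Matrix (Fin 3) (Fin 3) k) (φ : k), A * A' = 1 ∧ A' * A = 1 ∧ lin A 0 = q₀ ∧
      lin A 2 = q₂ ∧ φ ≠ 0 ∧
      ((linConj A A' F 0 = C f₀ * X 0 ^ d ∧ linConj A A' F 2 = C f₂ * X 2 ^ d) ∨
        (linConj A A' F 0 = C f₀ * X 2 ^ d ∧ linConj A A' F 2 = C f₂ * X 0 ^ d)) ∧
      (pderiv (R := k) (1 : Fin 3))^[d - 1] (linConj A A' F 1) = C φ * X 1 := by
  obtain ⟨A, A', h, h', rfl, rfl⟩ := exists_matrix_of_rows h₀ h₂ hq₀ hq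
  set P := linConj A A' F with hP
  have hPhom : ∀ i, (P i).IsHomogeneous d := isHomogeneous_linConj A A' hF
  have hPeq : (P 0 = C f₀ * X 0 ^ d ∧ P 2 = C f₂ * X 2 ^ d) ∨
      (P 0 = C f₀ * X 2 ^ d ∧ P 2 = C f₂ * X 0 ^ d) := by
    rcases hFq with ⟨h1, h2⟩ | ⟨h1, h2⟩
    · exact Or.inl ⟨linConj_eq_of_pullback h h1, linConj_eq_of_pullback h h2⟩
    · exact Or.inr ⟨linConj_eq_of_pullback h h1, linConj_eq_of_pullback h h2⟩
  have hX : ∀ j : Fin 3, j ≠ 1 → ∀ a : k, pderiv 1 (C a * X j ^ d : MvPolynomial (Fin 3) k) = 0 ∧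
      eval (Pi.single 1 1) (C a * X j ^ d : MvPolynomial (Fin 3) k) = 0 := fun j hj a => by
    constructor
    · simp [Derivation.leibniz, Derivation.leibniz_pow, pderiv_X_of_ne hj]
    · simp [hj, show d ≠ 0 by omega]
  have hP0 : pderiv 1 (P 0) = 0 ∧ eval (Pi.single 1 1) (P 0) = 0 := by
    rcases hPeq with ⟨h1, -⟩ | ⟨h1, -⟩ <;> rw [h1]
    · exact hX 0 (by decide) _
    · exact hX 2 (by decide) _
  have hP2 : pderiv 1 (P 2) = 0 ∧ eval (Pi.single 1 1) (P 2) = 0 := by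
    rcases hPeq with ⟨-, h1⟩ | ⟨-, h1⟩ <;> rw [h1]
    · exact hX 2 (by decide) _
    · exact hX 0 (by decide) _
  have hP1 : eval (Pi.single 1 1) (P 1) ≠ 0 := fun h0 => by
    have hAA : A *ᵥ (A' *ᵥ Pi.single 1 1) = Pi.single 1 1 := by
      rw [mulVec_mulVec, h, one_mulVec]
    have h1 : A *ᵥ (fun j => eval (A' *ᵥ Pi.single 1 1) (F j)) = 0 := by
      funext i
      rw [eval_linConj h', hAA]
      fin_cases i
      · exact hP0.2
      · exact h0
      · exact hP2.2
    have hne : A' *ᵥ (Pi.single 1 1 : Fin 3 → k) ≠ 0 := fun h2 => by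
      rw [h2, mulVec_zero] at hAA
      have := congrFun hAA 1
      simp at this
    obtain ⟨i, hi⟩ := hFnz _ hne
    apply hi
    have h3 : (fun j => eval (A' *ᵥ Pi.single 1 1) (F j)) = 0 := by
      rw [← one_mulVec (fun j => eval (A' *ᵥ Pi.single 1 1) (F j)), ← h', ← mulVec_mulVec, h1,
        mulVec_zero]
    exact congrFun h3 i
  have hT1 : ((pderiv (R := k) (1 : Fin 3))^[d - 1] (P 1)).IsHomogeneous 1 := by
    have := isHomogeneous_iterate_pderiv (hPhom 1) (d - 1)
    rwa [show d - (d - 1) = 1 by omega] at this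
  obtain ⟨t, ht⟩ := exists_eq_sum_of_isHomogeneous_one hT1
  have ht1 : t 1 ≠ 0 := fun h0 => by
    apply iterate_pderiv_ne_zero (hPhom 1) hP1
    obtain ⟨n, rfl⟩ : ∃ n, d = n + 1 := ⟨d - 1, by omega⟩
    rw [Nat.add_sub_cancel] at ht
    rw [Function.iterate_succ_apply', ht, Fin.sum_univ_three, h0]
    simp [Derivation.leibniz, pderiv_X_of_ne (show (0 : Fin 3) ≠ 1 by decide),
      pderiv_X_of_ne (show (2 : Fin 3) ≠ 1 by decide)]
  set B : Matrix (Fin 3) (Fin 3) k := !![1, 0, 0; t 0, t 1, t 2; 0, 0, 1] with hB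
  set B' : Matrix (Fin 3) (Fin 3) k :=
    !![1, 0, 0; -t 0 / t 1, 1 / t 1, -t 2 / t 1; 0, 0, 1] with hB'
  have hBB : B * B' = 1 := by
    ext i j
    fin_cases i <;> fin_cases j <;> simp [hB, hB', Matrix.mul_apply, Fin.sum_univ_three] <;>
      field_simp <;> ring
  have hBB' : B' * B = 1 := mul_eq_one_comm.1 hBB
  have hB0 : lin B 0 = X 0 := by simp [lin, Fin.sum_univ_three, hB]
  have hB2 : lin B 2 = X 2 := by simp [lin, Fin.sum_univ_three, hB]
  have hB1 : lin B 1 = (pderiv (R := k) (1 : Fin 3))^[d - 1] (P 1) := by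
    rw [ht, lin, hB]
    exact Finset.sum_congr rfl fun j _ => by fin_cases j <;> rfl
  have hA0 : lin (B * A) 0 = lin A 0 := by rw [lin_mul_apply, hB0, bind₁_X_right]
  have hA2 : lin (B * A) 2 = lin A 2 := by rw [lin_mul_apply, hB2, bind₁_X_right]
  have hBA : B * A * (A' * B') = 1 := by
    rw [Matrix.mul_assoc, ← Matrix.mul_assoc A, h, Matrix.one_mul, hBB]
  refine ⟨B * A, A' * B', t 1 * (1 / t 1) ^ (d - 1), hBA, mul_eq_one_comm.1 hBA, hA0, hA2,
    mul_ne_zero ht1 (pow_ne_zero _ (one_div_ne_zero ht1)), ?_, ?_⟩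
  · rw [← hA0, ← hA2] at hFq
    rcases hFq with ⟨h1, h2⟩ | ⟨h1, h2⟩
    · exact Or.inl ⟨linConj_eq_of_pullback hBA h1, linConj_eq_of_pullback hBA h2⟩
    · exact Or.inr ⟨linConj_eq_of_pullback hBA h1, linConj_eq_of_pullback hBA h2⟩
  · have hB'd : ∀ i, pderiv 1 (lin B' i) = C (B' i 1) := fun i => by
      simp [lin, Fin.sum_univ_three, Derivation.leibniz,
        pderiv_X_of_ne (show (0 : Fin 3) ≠ 1 by decide),
        pderiv_X_of_ne (show (2 : Fin 3) ≠ 1 by decide)]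
    have hPT : (pderiv (R := k) (1 : Fin 3))^[d - 1] (bind₁ P (lin B 1)) = C (t 1) * lin B 1 := by
      obtain ⟨n, hn⟩ : ∃ n, d - 1 = n + 1 := ⟨d - 2, by omega⟩
      rw [bind₁_lin, Fin.sum_univ_three, iterate_map_add, iterate_map_add,
        iterate_pderiv_mul pderiv_C, iterate_pderiv_mul pderiv_C, iterate_pderiv_mul pderiv_C, hB1,
        hn, Function.iterate_succ_apply _ _ (P 0), Function.iterate_succ_apply _ _ (P 2), hP0.1,
        hP2.1, Function.iterate_fixed (map_zero _), mul_zero, mul_zero, zero_add, add_zero]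
      rfl
    rw [← linConj_linConj, ← hP, linConj_apply,
      iterate_pderiv_bind₁ ((hB'd 0).trans (map_zero C)) (hB'd 1) ((hB'd 2).trans (map_zero C))
        pderiv_C, hPT, map_mul, bind₁_C_right, bind₁_lin_lin hBB, map_mul, map_pow]
    rw [show B' 1 1 = 1 / t 1 from rfl]
    ring

end
section
variable {k : Type*} [Field k]

theorem jdet_eq_zero_of_derivation {A : Fin 3 → MvPolynomial (Fin 3) k} {w : Fin 3 → k} (hw : w ≠ 0)
    (h : ∀ i, ∑ j, pderiv j (A i) * C (w j) = 0) : jdet A = 0 := by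
  unfold jdet
  refine Matrix.exists_mulVec_eq_zero_iff.mp ⟨fun j => C (w j), ?_, ?_⟩
  · intro h0
    refine hw (funext fun j => ?_)
    have := congrFun h0 j
    simpa using this
  · funext i
    simpa [Matrix.mulVec, dotProduct] using h i

variable {d m m' : ℕ} {F G H H' : Fin 3 → MvPolynomial (Fin 3) k}
  {Q Q' : MvPolynomial (Fin 3) k} {c c' : k}

theorem PrimeData.totalDegree_eq_one_of_three {Q : MvPolynomial (Fin 3) k}
    {p : Fin 3 → MvPolynomial (Fin 3) k}
    {σ : Equiv.Perm (Fin 3)} {e : Fin 3 → ℕ} {γ : Fin 3 → k} (D : PrimeData F d Q p σ γ e)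
    (i : Fin 3) : (p i).totalDegree = 1 := by
  have h := D.sum_le
  have h0 := D.degree_pos 0
  have h1 := D.degree_pos 1
  have h2 := D.degree_pos 2
  rw [Fin.sum_univ_three] at h
  fin_cases i <;> simp only [Fin.zero_eta, Fin.mk_one, Fin.reduceFinMk] <;> omega

variable [IsAlgClosed k] [CharZero k]

theorem Conj.false_of_two_three (S : Conj d m m' F G H H' Q Q' c c') (hd : 2 ≤ d)
    {p : Fin 2 → MvPolynomial (Fin 3) k}
    {σ : Equiv.Perm (Fin 2)} {e : Fin 2 → ℕ} {γ : Fin 2 → k} (D : PrimeData F d Q p σ γ e)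
    {p' : Fin 3 → MvPolynomial (Fin 3) k}
    {σ' : Equiv.Perm (Fin 3)} {e' : Fin 3 → ℕ} {γ' : Fin 3 → k}
    (D' : PrimeData G d Q' p' σ' γ' e') : False := by
  obtain ⟨b', hb', hG⟩ := D'.exists_rows (fun i => D'.totalDegree_eq_one_of_three i)
  have hdet := D'.det_ne_zero hd hb' hG
  obtain ⟨b, hb, -⟩ := D.exists_rows (fun i => D.totalDegree_eq_one hd S.F_hom S.F_nz i)
  obtain ⟨w, hw, hw0, hw1⟩ := PlaneEndo.exists_ne_zero_dotProduct_eq_zero (b 0) (b 1)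
  have hbw : ∀ i, ∑ j, b i j * w j = 0 := by
    intro i
    fin_cases i
    · exact hw0
    · exact hw1
  let E : Derivation k (MvPolynomial (Fin 3) k) (MvPolynomial (Fin 3) k) :=
    ∑ j, w j • pderiv j
  have hE : ∀ u, E u = ∑ j, pderiv j u * C (w j) := by
    intro u
    simp [E, Fin.sum_univ_three, smul_eq_C_mul, mul_comm]
  have hEp : ∀ i, E (p i) = 0 := by
    intro i
    have h1 : E (p i) = C (∑ j, b i j * w j) := by
      rw [hE, hb i]
      simp [Fin.sum_univ_three, pderiv_X, Pi.single_apply]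
    rw [h1, hbw, C_0]
  have hzero : jdet (PlaneEndo.comp (lin b') H) = 0 := by
    refine jdet_eq_zero_of_derivation hw fun i => ?_
    rw [← hE]
    obtain ⟨a, n, -, hn, -⟩ := S.exists_bind_H_prime D D' i
    have h1 : PlaneEndo.comp (lin b') H i = bind₁ H (p' i) := by
      rw [hb' i]; rfl
    rw [h1, hn, Fin.prod_univ_two, ← smul_eq_C_mul, Derivation.map_smul, Derivation.leibniz,
      Derivation.leibniz_pow, Derivation.leibniz_pow, hEp, hEp]
    simp
  rw [jdet_comp, jdet_lin, algHom_C, algebraMap_eq] at hzero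
  rcases mul_eq_zero.mp hzero with h | h
  · exact hdet (by simpa using h)
  · exact S.jdet_ne_zero h

end
section
variable {k : Type*} [Field k]

theorem eq_of_pow_mul_eq_pow_mul {R : Type*} [CommRing R] [IsDomain R] {q u v : R} (hq : q ≠ 0)
    {i j : ℕ} (h : q ^ i * u = q ^ j * v) (hu : ¬ q ∣ u) (hv : ¬ q ∣ v) : i = j := by
  rcases lt_trichotomy i j with hij | hij | hij
  · obtain ⟨n, rfl⟩ := Nat.exists_eq_add_of_lt hij
    rw [pow_add, pow_add, mul_assoc, mul_assoc] at h
    exact absurd ⟨q ^ n * v, by linear_combination mul_left_cancel₀ (pow_ne_zero i hq) h⟩ hu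
  · exact hij
  · obtain ⟨n, rfl⟩ := Nat.exists_eq_add_of_lt hij
    rw [pow_add, pow_add, mul_assoc, mul_assoc] at h
    exact absurd ⟨q ^ n * u, by linear_combination -mul_left_cancel₀ (pow_ne_zero j hq) h⟩ hv

theorem not_dvd_C_mul_pow {q s : MvPolynomial (Fin 3) k} (hq : Prime q) (hs : ¬ q ∣ s) {a : k}
    (ha : a ≠ 0) (n : ℕ) : ¬ q ∣ C a * s ^ n := by
  intro h
  rcases hq.dvd_or_dvd h with h | h
  · exact hq.not_isUnit (isUnit_of_dvd_unit h ((isUnit_iff_ne_zero.mpr ha).map C))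
  · exact hs (hq.dvd_of_dvd_pow h)

variable {d m m' : ℕ} {F G H H' : Fin 3 → MvPolynomial (Fin 3) k}
  {Q Q' : MvPolynomial (Fin 3) k} {c c' : k}

theorem diff_eq_one_of_mul_eq {x₀ x₁ y₀ y₁ z₀ z₁ m : ℕ} (hy : y₀ + y₁ = m) (hz : z₀ + z₁ = m)
    (h : 1 + (z₀ * x₀ + z₁ * x₁) = y₀ * x₀ + y₁ * x₁) : x₀ = x₁ + 1 ∨ x₁ = x₀ + 1 := by
  have h1 : ((x₀ : ℤ) - x₁) * (y₀ - z₀) = 1 := by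
    zify at hy hz h
    have e1 : (y₁ : ℤ) = m - y₀ := by linarith
    have e2 : (z₁ : ℤ) = m - z₀ := by linarith
    rw [e1, e2] at h
    linarith
  rcases Int.eq_one_or_neg_one_of_mul_eq_one h1 with h | h <;> omega

theorem Conj.exists_exponents (S : Conj d m m' F G H H' Q Q' c c')
    {p : Fin 2 → MvPolynomial (Fin 3) k}
    {σ : Equiv.Perm (Fin 2)} {e : Fin 2 → ℕ} {γ : Fin 2 → k} (D : PrimeData F d Q p σ γ e)
    {p' : Fin 2 → MvPolynomial (Fin 3) k}
    {σ' : Equiv.Perm (Fin 2)} {e' : Fin 2 → ℕ} {γ' : Fin 2 → k}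
    (D' : PrimeData G d Q' p' σ' γ' e')
    (h1 : ∀ i, (p i).totalDegree = 1) (h1' : ∀ i, (p' i).totalDegree = 1) :
    ∃ (a : Fin 2 → k) (n : Fin 2 → Fin 2 → ℕ), (∀ i, a i ≠ 0) ∧
      (∀ i, bind₁ H (p' i) = C (a i) * (p 0 ^ n i 0 * p 1 ^ n i 1)) ∧
      (∀ i, n i 0 + n i 1 = m) ∧ (n 0 0 = n 1 0 + 1 ∨ n 1 0 = n 0 0 + 1) := by
  choose a n ha hn hdeg using S.exists_bind_H_prime D D'
  choose a' n' ha' hn' hdeg' using S.symm.exists_bind_H_prime D' D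
  simp only [h1, h1', mul_one, Fin.sum_univ_two] at hdeg hdeg'
  simp only [Fin.prod_univ_two] at hn hn'
  refine ⟨a, n, ha, hn, fun i => (hdeg i).symm, ?_⟩
  have hp : ¬ p 0 ∣ p 1 := fun h => absurd (D.eq_of_dvd 0 1 h) (by decide)
  have key : ∀ i, Q * p i = p 0 ^ (n' i 0 * n 0 0 + n' i 1 * n 1 0) *
      (C (a' i * a 0 ^ n' i 0 * a 1 ^ n' i 1) * p 1 ^ (n' i 0 * n 0 1 + n' i 1 * n 1 1)) := by
    intro i
    have h := S.symm.bind_H'_bind_H (h1 i ▸ D.hom i)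
    rw [hn', pow_one] at h
    rw [← h]
    simp only [map_mul, map_pow, hn, algHom_C, algebraMap_eq]
    ring
  have h0 := key 0
  have h1 := key 1
  have hk : ∀ i, a' i * a 0 ^ n' i 0 * a 1 ^ n' i 1 ≠ 0 := fun i =>
    mul_ne_zero (mul_ne_zero (ha' i) (pow_ne_zero _ (ha 0))) (pow_ne_zero _ (ha 1))
  refine diff_eq_one_of_mul_eq (m := m') (hdeg' 0).symm (hdeg' 1).symm ?_
  refine eq_of_pow_mul_eq_pow_mul (D.prime 0).ne_zero (u := C (a' 1 * a 0 ^ n' 1 0 * a 1 ^ n' 1 1) *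
    p 1 ^ (n' 1 0 * n 0 1 + n' 1 1 * n 1 1))
    (v := C (a' 0 * a 0 ^ n' 0 0 * a 1 ^ n' 0 1) *
    p 1 ^ (n' 0 0 * n 0 1 + n' 0 1 * n 1 1 + 1)) ?_
    (not_dvd_C_mul_pow (D.prime 0) hp (hk 1) _) (not_dvd_C_mul_pow (D.prime 0) hp (hk 0) _)
  rw [pow_add, mul_assoc, ← h1, pow_one, pow_add _ _ 1, pow_one]
  linear_combination p 1 * h0

end
section
variable {k : Type*} [Field k]
variable {d m m' : ℕ} {F G H H' : Fin 3 → MvPolynomial (Fin 3) k}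
  {Q Q' : MvPolynomial (Fin 3) k} {c c' : k}

theorem PrimeData.pullback_pair {p : Fin 2 → MvPolynomial (Fin 3) k}
    {σ : Equiv.Perm (Fin 2)} {e : Fin 2 → ℕ} {γ : Fin 2 → k} (D : PrimeData F d Q p σ γ e)
    (h1 : ∀ i, (p i).totalDegree = 1) {i j : Fin 2} (hij : i ≠ j) :
    (bind₁ F (p i) = C (γ i) * p i ^ d ∧ bind₁ F (p j) = C (γ j) * p j ^ d) ∨
      (bind₁ F (p i) = C (γ i) * p j ^ d ∧ bind₁ F (p j) = C (γ j) * p i ^ d) := by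
  obtain ⟨-, -, h⟩ := D.exists_rows h1
  have two : ∀ x : Fin 2, x = i ∨ x = j := by
    intro x
    omega
  have hne : σ i ≠ σ j := fun h => hij (σ.injective h)
  rcases two (σ i) with hi | hi
  · have hj : σ j = j := (two (σ j)).resolve_left fun hj => hne (hi.trans hj.symm)
    exact Or.inl ⟨by simpa only [hi] using h i, by simpa only [hj] using h j⟩
  · have hj : σ j = i := (two (σ j)).resolve_right fun hj => hne (hi.trans hj.symm)
    exact Or.inr ⟨by simpa only [hi] using h i, by simpa only [hj] using h j⟩

theorem PrimeData.card_le {r : ℕ} {p : Fin r → MvPolynomial (Fin 3) k}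
    {σ : Equiv.Perm (Fin r)} {e : Fin r → ℕ} {γ : Fin r → k} (D : PrimeData F d Q p σ γ e) :
    r ≤ 3 := by
  refine le_trans ?_ D.sum_le
  calc r = ∑ _i : Fin r, 1 := by simp
    _ ≤ _ := Finset.sum_le_sum fun i _ => D.degree_pos i

variable [IsAlgClosed k] [CharZero k]

theorem Conj.exists_special_form_of_exponents (S : Conj d m m' F G H H' Q Q' c c') (hd : 2 ≤ d)
    (hm : 2 ≤ m) {p : Fin 2 → MvPolynomial (Fin 3) k}
    {σ : Equiv.Perm (Fin 2)} {e : Fin 2 → ℕ} {γ : Fin 2 → k} (D : PrimeData F d Q p σ γ e)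
    {p' : Fin 2 → MvPolynomial (Fin 3) k}
    {σ' : Equiv.Perm (Fin 2)} {e' : Fin 2 → ℕ} {γ' : Fin 2 → k}
    (D' : PrimeData G d Q' p' σ' γ' e')
    (h1 : ∀ i, (p i).totalDegree = 1) (h1' : ∀ i, (p' i).totalDegree = 1)
    {a : Fin 2 → k} {n : Fin 2 → Fin 2 → ℕ} (ha : ∀ i, a i ≠ 0)
    (hH : ∀ i, bind₁ H (p' i) = C (a i) * (p 0 ^ n i 0 * p 1 ^ n i 1))
    (hn : ∀ i, n i 0 + n i 1 = m) {i₀ i₁ : Fin 2} (hi : i₀ ≠ i₁) (hni : n i₀ 0 = n i₁ 0 + 1) :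
    ∃ (M : GL (Fin 3) k) (c : kˣ) (a : ℕ → k), ∀ v : Fin 3 → k,
      (M : Matrix (Fin 3) (Fin 3) k).mulVec (fun i => eval v (F i)) =
        ![(c : k) * ((M : Matrix (Fin 3) (Fin 3) k).mulVec v 0) ^ d,
          (c : k) * (((M : Matrix (Fin 3) (Fin 3) k).mulVec v 1) ^ d +
            ∑ j ∈ Icc 2 d, a j * ((M : Matrix (Fin 3) (Fin 3) k).mulVec v 2) ^ j *
              ((M : Matrix (Fin 3) (Fin 3) k).mulVec v 1) ^ (d - j)),
          (c : k) * ((M : Matrix (Fin 3) (Fin 3) k).mulVec v 2) ^ d] := by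
  have hp : ∀ i, (p i).IsHomogeneous 1 := fun i => h1 i ▸ D.hom i
  have hp' : ∀ i, (p' i).IsHomogeneous 1 := fun i => h1' i ▸ D'.hom i
  obtain ⟨A, A', φ, hA, hA', hA0, hA2, hφ, hF, hF1⟩ :=
    exists_adapted_coordinates hd S.F_hom S.F_nz (hp 0) (hp 1)
      (D.prime 0).ne_zero (fun h => absurd (D.eq_of_dvd 0 1 h) (by decide))
      (D.pullback_pair h1 (by decide : (0 : Fin 2) ≠ 1))
  obtain ⟨B, B', ψ, hB, hB', hB0, hB2, hψ, hG, hG1⟩ :=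
    exists_adapted_coordinates hd S.G_hom S.G_nz (hp' i₀) (hp' i₁)
      (D'.prime i₀).ne_zero (fun h => hi (D'.eq_of_dvd i₀ i₁ h))
      (D'.pullback_pair h1' hi)
  have S2 := ((S.transport hA hA').symm.transport hB hB').symm
  have D2 := D.transport hA hA'
  have hX0 : bind₁ (lin A') (p 0) = X 0 := by rw [← hA0, bind₁_lin_lin hA]
  have hX2 : bind₁ (lin A') (p 1) = X 2 := by rw [← hA2, bind₁_lin_lin hA]
  have hpull : ∀ i, bind₁ (lin A') (bind₁ H (p' i)) = C (a i) * (X 0 ^ n i 0 * X 2 ^ n i 1) := by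
    intro i
    rw [hH, map_mul, map_mul, map_pow, map_pow, hX0, hX2, algHom_C, algebraMap_eq]
  have hcomp : ∀ i, PlaneEndo.comp (lin B) (PlaneEndo.comp H (lin A')) i =
      bind₁ (lin A') (bind₁ H (lin B i)) := by
    intro i
    exact (bind₁_bind₁ _ _ _).symm
  have hn0 := hn i₀
  have hn1 := hn i₁
  have had : Adapted d m m' (linConj A A' F) (linConj B B' G) _ _ _ _ c c' (γ 0) (γ 1) (γ' i₀)
      (γ' i₁) (a i₀) (a i₁) φ ψ (n i₁ 0) (n i₀ 1) :=
    { conj := S2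
      F_eq := hF
      G_eq := hG
      F_one := hF1
      G_one := hG1
      H_zero := by rw [hcomp, hB0, hpull, hni]
      H_two := by
        rw [hcomp, hB2, hpull]
        congr 3
        omega
      degree := by omega
      factor := by
        intro u hu
        obtain ⟨b, l, hb, hl⟩ := D2.factor 3 u hu
        refine ⟨b, l 0, l 1, hb, ?_⟩
        rw [hl, Fin.prod_univ_two, hX0, hX2]
      f₀_ne := D.c_ne 0
      f₂_ne := D.c_ne 1
      g₀_ne := D'.c_ne i₀
      g₂_ne := D'.c_ne i₁
      h₀_ne := ha i₀
      h₂_ne := ha i₁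
      φ_ne := hφ
      ψ_ne := hψ }
  obtain ⟨⟨hF0, hF2⟩, s, b, hs, hb, hb1, hb2⟩ := had.exists_form hd hm
  rcases hs with rfl | rfl
  · exact exists_special_form hd hA hA' (Or.inr ⟨rfl, rfl⟩) (D.c_ne 1) (D.c_ne 0) hb hb1 hF2 hF0 hb2
  · exact exists_special_form hd hA hA' (Or.inl ⟨rfl, rfl⟩) (D.c_ne 0) (D.c_ne 1) hb hb1 hF0 hF2 hb2

theorem Conj.exists_special_form (S : Conj d m m' F G H H' Q Q' c c') (hd : 2 ≤ d)
    (hm : 2 ≤ m) {p : Fin 2 → MvPolynomial (Fin 3) k}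
    {σ : Equiv.Perm (Fin 2)} {e : Fin 2 → ℕ} {γ : Fin 2 → k} (D : PrimeData F d Q p σ γ e)
    {r' : ℕ} {p' : Fin r' → MvPolynomial (Fin 3) k}
    {σ' : Equiv.Perm (Fin r')} {e' : Fin r' → ℕ} {γ' : Fin r' → k}
    (D' : PrimeData G d Q' p' σ' γ' e') :
    ∃ (M : GL (Fin 3) k) (c : kˣ) (a : ℕ → k), ∀ v : Fin 3 → k,
      (M : Matrix (Fin 3) (Fin 3) k).mulVec (fun i => eval v (F i)) =
        ![(c : k) * ((M : Matrix (Fin 3) (Fin 3) k).mulVec v 0) ^ d,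
          (c : k) * (((M : Matrix (Fin 3) (Fin 3) k).mulVec v 1) ^ d +
            ∑ j ∈ Icc 2 d, a j * ((M : Matrix (Fin 3) (Fin 3) k).mulVec v 2) ^ j *
              ((M : Matrix (Fin 3) (Fin 3) k).mulVec v 1) ^ (d - j)),
          (c : k) * ((M : Matrix (Fin 3) (Fin 3) k).mulVec v 2) ^ d] := by
  have hr := D'.card_le
  have hr0 := D'.pos
  obtain rfl | rfl | rfl : r' = 1 ∨ r' = 2 ∨ r' = 3 := by omega
  · exact absurd (S.symm.eq_one_of_eq_one D' D) (by decide)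
  · have h1 := D.totalDegree_eq_one hd S.F_hom S.F_nz
    have h1' := D'.totalDegree_eq_one hd S.G_hom S.G_nz
    obtain ⟨a, n, ha, hH, hn, h | h⟩ := S.exists_exponents D D' h1 h1'
    · exact S.exists_special_form_of_exponents hd hm D D' h1 h1' ha hH hn (by decide) h
    · exact S.exists_special_form_of_exponents hd hm D D' h1 h1' ha hH hn (by decide) h
  · exact (S.false_of_two_three hd D D').elim

end
section
variable {k : Type*} [Field k]

theorem represents_of_map_eq {A : Fin 3 → MvPolynomial (Fin 3) k}
    {f : FractionRing (MvPolynomial (Fin 2) k) →ₐ[k] FractionRing (MvPolynomial (Fin 2) k)}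
    (hx : f (algebraMap (MvPolynomial (Fin 2) k) _ (X 0)) = ev (A 0) / ev (A 2))
    (hy : f (algebraMap (MvPolynomial (Fin 2) k) _ (X 1)) = ev (A 1) / ev (A 2)) :
    PlaneEndo.Represents f A := by
  refine ⟨fun h => ?_, hx, hy⟩
  rw [h, div_zero, map_eq_zero, FaithfulSMul.algebraMap_eq_zero_iff] at hx
  exact X_ne_zero _ hx

theorem ev_sum (b : Fin 3 → k) :
    ev (∑ j, C (b j) * X j) = algebraMap (MvPolynomial (Fin 2) k)
      (FractionRing (MvPolynomial (Fin 2) k)) (C (b 0) * X 0 + C (b 1) * X 1 + C (b 2)) := by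
  rw [ev_apply]
  simp [dehom, Fin.sum_univ_three, algebraMap_eq]

variable {d m' : ℕ} {F G H H' : Fin 3 → MvPolynomial (Fin 3) k}
  {Q Q' : MvPolynomial (Fin 3) k} {c c' : k}

theorem Conj.exists_linear_form [CharZero k] (S : Conj d 1 m' F G H H' Q Q' c c') :
    ∃ N : GL (Fin 3) k, ∀ i, H i = ∑ j, C ((N : Matrix (Fin 3) (Fin 3) k) i j) * X j := by
  choose b hb using fun i => exists_eq_sum_of_isHomogeneous_one (S.H_hom i)
  have h : (Matrix.of b).det ≠ 0 := by
    intro h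
    have h2 : H = lin (Matrix.of b) := funext hb
    apply S.jdet_ne_zero
    rw [h2, jdet_lin, h, C_0]
  exact ⟨GeneralLinearGroup.mkOfDetNeZero _ h, hb⟩

end
end PlaneEndo

/-- If two endomorphisms of `ℙ²` of degree `d ≥ 2` are conjugate by a birational map `φ`,
then either `φ` is a linear automorphism, or `f₁` is linearly conjugate to a permutation
of coordinates composed with `[x:y:z] ↦ [x^d:y^d:z^d]`, or `f₁` is linearly conjugate to
the homogenization of `(x,y) ↦ (x^d, y^d + Σ_{j=2}^d a_j y^{d-j})`. -/
theorem birational_conjugacy_linear_or_special_form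
    (k : Type*) [Field k] [IsAlgClosed k] [CharZero k]
    (d : ℕ) (hd : 2 ≤ d)
    (F G : Fin 3 → MvPolynomial (Fin 3) k)
    (hFhom : ∀ i, (F i).IsHomogeneous d) (hGhom : ∀ i, (G i).IsHomogeneous d)
    (hFnz : ∀ v : Fin 3 → k, v ≠ 0 → ∃ i, eval v (F i) ≠ 0)
    (hGnz : ∀ v : Fin 3 → k, v ≠ 0 → ∃ i, eval v (G i) ≠ 0)
    (fstar₁ fstar₂ :
      FractionRing (MvPolynomial (Fin 2) k) →ₐ[k] FractionRing (MvPolynomial (Fin 2) k))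
    (hf₁x : fstar₁ (algebraMap (MvPolynomial (Fin 2) k) _ (X 0)) =
      algebraMap (MvPolynomial (Fin 2) k) _ (aeval ![X 0, X 1, 1] (F 0)) /
        algebraMap (MvPolynomial (Fin 2) k) _ (aeval ![X 0, X 1, 1] (F 2)))
    (hf₁y : fstar₁ (algebraMap (MvPolynomial (Fin 2) k) _ (X 1)) =
      algebraMap (MvPolynomial (Fin 2) k) _ (aeval ![X 0, X 1, 1] (F 1)) /
        algebraMap (MvPolynomial (Fin 2) k) _ (aeval ![X 0, X 1, 1] (F 2)))
    (hf₂x : fstar₂ (algebraMap (MvPolynomial (Fin 2) k) _ (X 0)) =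
      algebraMap (MvPolynomial (Fin 2) k) _ (aeval ![X 0, X 1, 1] (G 0)) /
        algebraMap (MvPolynomial (Fin 2) k) _ (aeval ![X 0, X 1, 1] (G 2)))
    (hf₂y : fstar₂ (algebraMap (MvPolynomial (Fin 2) k) _ (X 1)) =
      algebraMap (MvPolynomial (Fin 2) k) _ (aeval ![X 0, X 1, 1] (G 1)) /
        algebraMap (MvPolynomial (Fin 2) k) _ (aeval ![X 0, X 1, 1] (G 2)))
    (φ : FractionRing (MvPolynomial (Fin 2) k) ≃ₐ[k] FractionRing (MvPolynomial (Fin 2) k))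
    (hconj : ∀ u, fstar₁ (φ u) = φ (fstar₂ u)) :
    -- (i) `φ` is induced by a linear automorphism of `ℙ²`
    (∃ N : GL (Fin 3) k,
      φ (algebraMap (MvPolynomial (Fin 2) k) _ (X 0)) =
        algebraMap (MvPolynomial (Fin 2) k) _
            (C ((N : Matrix (Fin 3) (Fin 3) k) 0 0) * X 0 +
             C ((N : Matrix (Fin 3) (Fin 3) k) 0 1) * X 1 +
             C ((N : Matrix (Fin 3) (Fin 3) k) 0 2)) /
          algebraMap (MvPolynomial (Fin 2) k) _
            (C ((N : Matrix (Fin 3) (Fin 3) k) 2 0) * X 0 +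
             C ((N : Matrix (Fin 3) (Fin 3) k) 2 1) * X 1 +
             C ((N : Matrix (Fin 3) (Fin 3) k) 2 2)) ∧
      φ (algebraMap (MvPolynomial (Fin 2) k) _ (X 1)) =
        algebraMap (MvPolynomial (Fin 2) k) _
            (C ((N : Matrix (Fin 3) (Fin 3) k) 1 0) * X 0 +
             C ((N : Matrix (Fin 3) (Fin 3) k) 1 1) * X 1 +
             C ((N : Matrix (Fin 3) (Fin 3) k) 1 2)) /
          algebraMap (MvPolynomial (Fin 2) k) _
            (C ((N : Matrix (Fin 3) (Fin 3) k) 2 0) * X 0 +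
             C ((N : Matrix (Fin 3) (Fin 3) k) 2 1) * X 1 +
             C ((N : Matrix (Fin 3) (Fin 3) k) 2 2))) ∨
    -- (ii) `f₁` is linearly conjugate to a permutation of coordinates composed with `g_d`
    (∃ (M : GL (Fin 3) k) (c : kˣ) (σ : Equiv.Perm (Fin 3)), ∀ v : Fin 3 → k,
      (M : Matrix (Fin 3) (Fin 3) k).mulVec (fun i => eval v (F i)) =
        fun i => (c : k) * ((M : Matrix (Fin 3) (Fin 3) k).mulVec v (σ i)) ^ d) ∨
    -- (iii) `f₁` is linearly conjugate to the homogenization of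
    -- `(x,y) ↦ (x^d, y^d + Σ_{j=2}^d a_j y^{d-j})`
    (∃ (M : GL (Fin 3) k) (c : kˣ) (a : ℕ → k), ∀ v : Fin 3 → k,
      (M : Matrix (Fin 3) (Fin 3) k).mulVec (fun i => eval v (F i)) =
        ![(c : k) * ((M : Matrix (Fin 3) (Fin 3) k).mulVec v 0) ^ d,
          (c : k) * (((M : Matrix (Fin 3) (Fin 3) k).mulVec v 1) ^ d +
            ∑ j ∈ Icc 2 d, a j * ((M : Matrix (Fin 3) (Fin 3) k).mulVec v 2) ^ j *
              ((M : Matrix (Fin 3) (Fin 3) k).mulVec v 1) ^ (d - j)),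
          (c : k) * ((M : Matrix (Fin 3) (Fin 3) k).mulVec v 2) ^ d]) := by
  have hf : PlaneEndo.Represents fstar₁ F := PlaneEndo.represents_of_map_eq hf₁x hf₁y
  have hg : PlaneEndo.Represents fstar₂ G := PlaneEndo.represents_of_map_eq hf₂x hf₂y
  obtain ⟨m, m', H, H', Q, Q', c, c', hφ, S⟩ :=
    PlaneEndo.exists_conj (by omega) hFhom hGhom hFnz hGnz hf hg φ hconj
  obtain ⟨hm, hm'⟩ := S.pos
  rcases hm.eq_or_lt with rfl | hm
  · left
    obtain ⟨N, hN⟩ := S.exists_linear_form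
    refine ⟨N, ?_, ?_⟩
    · rw [← PlaneEndo.ev_sum, ← PlaneEndo.ev_sum, ← hN, ← hN]
      exact hφ.map_x
    · rw [← PlaneEndo.ev_sum, ← PlaneEndo.ev_sum, ← hN, ← hN]
      exact hφ.map_y
  · right
    obtain ⟨r, p, σ, γ, e, D⟩ := S.exists_primeData hd (by nlinarith)
    obtain ⟨r', p', σ', γ', e', D'⟩ := S.symm.exists_primeData hd (by nlinarith)
    have hr := D.card_le
    have hr0 := D.pos
    obtain rfl | rfl | rfl : r = 1 ∨ r = 2 ∨ r = 3 := by omega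
    · exact (S.false_of_single hd hm D D').elim
    · exact Or.inr (S.exists_special_form hd hm D D')
    · exact Or.inl (D.exists_power_form hd)
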